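/- arXiv:math/0405553 — 6 statements merged into one kernel-verified Lean document; each statement's English description precedes it below -/
import Mathlib

section
/- Let (W,S) be a Coxeter system and let s,t ∈ S. Then s is conjugate to t in W if and only if there exists a sequence s₁,…,s_n ∈ S with s₁ = s, s_n = t, and m(sᵢ,sᵢ₊₁) odd for each i ∈ {1,…,n−1}, where m(a,b) denotes the order of ab in W. -/
theorem isConj_of_odd_aux {B : Type*} {W : Type*} [Group W] {M : CoxeterMatrix B}
    (cs : CoxeterSystem M W) (a b : B) (h : Odd (M a b)) :
    IsConj (cs.simple a) (cs.simple b) := by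
  obtain ⟨k, hk⟩ := h
  have h1 := cs.simple_mul_simple_pow a b
  rw [hk] at h1
  have ha := cs.simple_mul_simple_self a
  have hb := cs.simple_mul_simple_self b
  generalize cs.simple a = x at *
  generalize cs.simple b = y at *
  have hx : x⁻¹ = x := inv_eq_of_mul_eq_one_left ha
  have hy : y⁻¹ = y := inv_eq_of_mul_eq_one_left hb
  have h2 : ∀ n : ℕ, x * (x * y) ^ n = ((x * y) ^ n)⁻¹ * x := by
    intro n
    have : SemiconjBy x (x * y) (x * y)⁻¹ := by
      unfold SemiconjBy
      rw [mul_inv_rev, hx, hy, mul_assoc, ← mul_assoc]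
      simp [ha, mul_assoc]
    have := this.pow_right n
    rw [inv_pow] at this
    exact this
  rw [isConj_iff]
  refine ⟨((x * y) ^ k), ?_⟩
  rw [mul_inv_eq_iff_eq_mul]
  -- goal: (xy)^k x = y (xy)^k
  have h3 : x * (x * y) ^ (k + 1) = ((x * y) ^ (k + 1))⁻¹ * x := h2 (k + 1)
  have h4 : ((x * y) ^ (k + 1))⁻¹ = (x * y) ^ k := by
    apply inv_eq_of_mul_eq_one_left
    rw [← pow_add, ← h1]; congr 1; ring
  rw [h4] at h3
  rw [← h3, pow_succ', ← mul_assoc, ← mul_assoc, ha, one_mul]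

/-- Two simple generators `s`, `t` are conjugate in `W` iff they are connected by a chain
of simple generators in which consecutive ones have odd Coxeter matrix entry. -/
theorem stmt_5 {B : Type*} {W : Type*} [Group W] {M : CoxeterMatrix B}
    (cs : CoxeterSystem M W) (i j : B) :
    IsConj (cs.simple i) (cs.simple j) ↔
      ∃ l : List B, l.Chain' (fun a b => Odd (M a b)) ∧
        l.head? = some i ∧ l.getLast? = some j := by
  classical
  constructor
  · intro h
    have key : Relation.ReflTransGen (fun a b => Odd (M a b)) i j := by
      let f : B → ℤˣ := fun b =>
        if Relation.ReflTransGen (fun a b => Odd (M a b)) i b then -1 else 1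
      have hf : M.IsLiftable f := by
        intro a b
        rcases Nat.even_or_odd (M a b) with he | ho
        · obtain ⟨k, hk⟩ := he
          rw [hk, ← two_mul, pow_mul, Int.units_sq, one_pow]
        · have ho' : Odd (M b a) := by rw [M.symmetric]; exact ho
          have : f a = f b := by
            have : Relation.ReflTransGen (fun a b => Odd (M a b)) i a ↔
                Relation.ReflTransGen (fun a b => Odd (M a b)) i b :=
              ⟨fun h => h.tail ho, fun h => h.tail ho'⟩
            simp only [f, this]
          rw [this, ← sq, Int.units_sq, one_pow]
      obtain ⟨c, hc⟩ := isConj_iff.mp h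
      have h2 := congrArg (cs.lift ⟨f, hf⟩) hc
      rw [map_mul, map_mul, map_inv, mul_comm, inv_mul_cancel_left,
        cs.lift_apply_simple, cs.lift_apply_simple] at h2
      by_contra hn
      have hi : f i = -1 := if_pos Relation.ReflTransGen.refl
      have hj : f j = 1 := if_neg hn
      rw [hi, hj] at h2
      exact absurd h2 (by decide)
    clear h
    induction key using Relation.ReflTransGen.head_induction_on with
    | refl => exact ⟨[j], List.isChain_singleton j, rfl, rfl⟩
    | @head a b hab _ ih =>
      obtain ⟨l, hl, hh, hlast⟩ := ih
      cases l with
      | nil => simp at hh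
      | cons c l =>
        simp only [List.head?_cons, Option.some.injEq] at hh
        subst hh
        exact ⟨a :: c :: l, List.isChain_cons_cons.mpr ⟨hab, hl⟩, by simp, by
          rw [List.getLast?_cons_cons]; exact hlast⟩
  · rintro ⟨l, hl, hh, hlast⟩
    induction l generalizing i with
    | nil => simp at hh
    | cons c l ih =>
      simp only [List.head?_cons, Option.some.injEq] at hh
      subst hh
      cases l with
      | nil =>
        simp only [List.getLast?_singleton, Option.some.injEq] at hlast
        subst hlast
        exact IsConj.refl _
      | cons d l =>
        have h := List.isChain_cons_cons.mp hl
        rw [List.getLast?_cons_cons] at hlast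
        exact (isConj_of_odd_aux cs c d h.1).trans (ih d h.2 (by simp) hlast)
end

section
/- Let (W,S) be a Coxeter system with first letters: if w = s₁⋯s_l is a reduced representation of an involution w (w² = 1) whose length is minimal in its conjugacy class, then for each i ∈ {1,…,l−1} the cyclic rotation w = (s_{i+1}⋯s_l)(s₁⋯s_i) is also a reduced representation of w. -/
namespace Stmt8

open CoxeterSystem

variable {B : Type*} {W : Type*} [Group W] {M : CoxeterMatrix B} (cs : CoxeterSystem M W)

open Classical in
/-- The basic permutation attached to a simple reflection. -/
noncomputable def f (i : B) : Equiv.Perm (W × ZMod 2) where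
  toFun p := (cs.simple i * p.1 * cs.simple i, p.2 + if p.1 = cs.simple i then 1 else 0)
  invFun p := (cs.simple i * p.1 * cs.simple i, p.2 + if p.1 = cs.simple i then 1 else 0)
  left_inv p := by
    have h : cs.simple i * p.1 * cs.simple i = cs.simple i ↔ p.1 = cs.simple i := by
      rw [mul_eq_right, ← cs.inv_simple i, inv_mul_eq_one, cs.inv_simple]; exact eq_comm
    have h2 : (1 : ZMod 2) + 1 = 0 := by decide
    ext
    · simp [mul_assoc]
    · simp only [h]
      split_ifs <;> simp [add_assoc, h2]
  right_inv p := by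
    have h : cs.simple i * p.1 * cs.simple i = cs.simple i ↔ p.1 = cs.simple i := by
      rw [mul_eq_right, ← cs.inv_simple i, inv_mul_eq_one, cs.inv_simple]; exact eq_comm
    have h2 : (1 : ZMod 2) + 1 = 0 := by decide
    ext
    · simp [mul_assoc]
    · simp only [h]
      split_ifs <;> simp [add_assoc, h2]

open Classical in
theorem f_apply (i : B) (p : W × ZMod 2) : f cs i p =
    (cs.simple i * p.1 * cs.simple i, p.2 + if p.1 = cs.simple i then 1 else 0) := rfl

open Classical in
theorem prod_f (ω : List B) (p : W × ZMod 2) : (ω.map (f cs)).prod p =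
    (cs.wordProd ω * p.1 * (cs.wordProd ω)⁻¹, p.2 + ((cs.rightInvSeq ω).count p.1 : ℕ)) := by
  induction ω with
  | nil => simp
  | cons i ω ih =>
    have h : cs.wordProd ω * p.1 * (cs.wordProd ω)⁻¹ = cs.simple i ↔
        (cs.wordProd ω)⁻¹ * cs.simple i * cs.wordProd ω = p.1 := by
      constructor
      · intro h; rw [← h]; group
      · intro h; rw [← h]; group
    rw [List.map_cons, List.prod_cons, Equiv.Perm.mul_apply, ih, f_apply]
    simp only [h]
    simp only [wordProd_cons, rightInvSeq, List.count_cons, beq_iff_eq, Nat.cast_add,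
      Nat.cast_ite, Nat.cast_one, Nat.cast_zero, mul_inv_rev, inv_simple, mul_assoc, add_assoc]

open Classical in
theorem even_count (i j : B) (t : W) :
    Even ((cs.leftInvSeq (alternatingWord i j (2 * M i j))).count t) := by
  set L := cs.leftInvSeq (alternatingWord i j (2 * M i j)) with hL
  have hlen : L.length = 2 * M i j := by simp [hL]
  have : L.drop (M i j) = L.take (M i j) := by
    apply List.ext_getElem
    · simp [hlen]; omega
    · intro k h1 h2
      have h3 : k < M i j := by simp [hlen] at h1; omega
      rw [List.getElem_drop, List.getElem_take]
      simp only [hL]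
      rw [getElem_leftInvSeq_alternatingWord cs i j _ _ (by omega), getElem_leftInvSeq_alternatingWord cs i j _ _ (by omega)]
      rw [prod_alternatingWord_eq_mul_pow, prod_alternatingWord_eq_mul_pow]
      have e1 : (2 * (M i j + k) + 1) / 2 = M i j + k := by omega
      have e2 : (2 * k + 1) / 2 = k := by omega
      have o1 : ¬ Even (2 * (M i j + k) + 1) := by simp
      have o2 : ¬ Even (2 * k + 1) := by simp
      rw [e1, e2, if_neg o1, if_neg o2, pow_add]
      simp [M.symmetric]
  rw [← List.take_append_drop (M i j) L, List.count_append, this]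
  exact ⟨_, rfl⟩

theorem liftable : M.IsLiftable (f cs) := by
  classical
  intro i j
  have key : ((alternatingWord i j (2 * M i j)).map (f cs)).prod = 1 := by
    ext1 p
    rw [prod_f]
    have h := even_count cs j i p.1
    have hr : alternatingWord i j (2 * M i j) = (alternatingWord j i (2 * M j i)).reverse := by
      rw [M.symmetric j i]
      apply List.ext_getElem
      · simp
      · intro k h1 h2
        simp only [length_alternatingWord, List.length_reverse] at h1 h2
        rw [List.getElem_reverse, getElem_alternatingWord _ _ _ _ h1,
          getElem_alternatingWord _ _ _ _ (by simp only [length_alternatingWord]; omega)]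
        simp only [length_alternatingWord, Nat.even_iff]
        split_ifs <;> first | rfl | omega
    have h1 : cs.wordProd (alternatingWord i j (2 * M i j)) = 1 := by
      rw [prod_alternatingWord_eq_mul_pow]; simp
    rw [h1]
    rw [hr, rightInvSeq_reverse, List.count_reverse, (ZMod.natCast_eq_zero_iff_even).2 h]
    simp
  have : ∀ m, ((alternatingWord i j (2 * m)).map (f cs)).prod = (f cs i * f cs j) ^ m := by
    intro m
    induction m with
    | zero => simp [alternatingWord]
    | succ m ih =>
      rw [show 2 * (m+1) = 2 * m + 1 + 1 by ring]
      simp [alternatingWord, ih, pow_succ, mul_assoc]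
  rw [← this, key]

open Classical in
theorem count_eq {ω ω' : List B} (h : cs.wordProd ω = cs.wordProd ω') (t : W) :
    (((cs.rightInvSeq ω).count t : ℕ) : ZMod 2) = ((cs.rightInvSeq ω').count t : ℕ) := by
  have key : ∀ ω : List B, cs.lift ⟨f cs, liftable cs⟩ (cs.wordProd ω) = (ω.map (f cs)).prod := by
    intro ω
    induction ω with
    | nil => simp
    | cons i ω ih => simp [wordProd_cons, ih]
  have h1 := key ω
  rw [h, key ω'] at h1
  have h2 := congrArg (fun g => (g (t, (0 : ZMod 2))).2) h1
  simp only [prod_f, zero_add] at h2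
  exact h2.symm

/-- The exchange condition. -/
theorem exchange {ω : List B} (i : B)
    (h : cs.length (cs.wordProd ω * cs.simple i) < cs.length (cs.wordProd ω)) :
    ∃ k < ω.length, cs.wordProd ω * cs.simple i = cs.wordProd (ω.eraseIdx k) := by
  classical
  obtain ⟨ω', h1, h2⟩ := cs.exists_isReduced (cs.wordProd ω * cs.simple i)
  have h3 : cs.wordProd ω = cs.wordProd (ω'.concat i) := by
    rw [wordProd_concat, ← h2]; simp
  have h4 : cs.IsReduced (ω'.concat i) := by
    unfold CoxeterSystem.IsReduced at *
    rw [← h3]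
    rw [← h2] at h1
    have := cs.length_mul_simple (cs.wordProd ω) i
    simp only [List.length_concat]
    omega
  have h5 : cs.simple i ∈ cs.rightInvSeq (ω'.concat i) := by
    rw [rightInvSeq_concat]; simp
  have h6 := List.count_eq_one_of_mem h4.nodup_rightInvSeq h5
  have h7 := count_eq cs h3 (cs.simple i)
  rw [h6] at h7
  have h8 : cs.simple i ∈ cs.rightInvSeq ω := by
    by_contra hc
    rw [List.count_eq_zero_of_not_mem hc] at h7
    exact absurd h7 (by decide)
  obtain ⟨k, hk, hk2⟩ := List.getElem_of_mem h8
  refine ⟨k, by simpa using hk, ?_⟩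
  rw [← wordProd_mul_getD_rightInvSeq, ← hk2, List.getD_eq_getElem _ _ hk]

theorem rot_one (i : B) (ω : List B) (hred : cs.IsReduced (i :: ω))
    (hw2 : cs.wordProd (i :: ω) * cs.wordProd (i :: ω) = 1)
    (hmin : ∀ v : W, cs.length (cs.wordProd (i :: ω)) ≤
      cs.length (v * cs.wordProd (i :: ω) * v⁻¹)) :
    cs.wordProd (ω ++ [i]) = cs.wordProd (i :: ω) := by
  have hinv : (cs.wordProd (i :: ω))⁻¹ = cs.wordProd (i :: ω) := inv_eq_of_mul_eq_one_left hw2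
  have hl : cs.length (cs.wordProd ω) = ω.length := by
    have h : cs.IsReduced ω := by simpa using hred.drop 1
    exact h
  have hlt : cs.length (cs.wordProd (i :: ω) * cs.simple i) < cs.length (cs.wordProd (i :: ω)) := by
    rw [← cs.length_inv, mul_inv_rev, hinv, cs.inv_simple, hred.eq, wordProd_cons,
      simple_mul_simple_cancel_left, hl]
    simp
  obtain ⟨k, hk, he⟩ := exchange cs i hlt
  rw [wordProd_append, wordProd_singleton]
  cases k with
  | zero =>
    simp only [List.eraseIdx_cons_zero] at he
    rw [← he]; simp
  | succ k =>
    exfalso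
    simp only [List.eraseIdx_cons_succ, wordProd_cons, mul_assoc] at he
    have h1 := mul_left_cancel he
    have h2 := hmin (cs.simple i)
    rw [hred.eq, wordProd_cons, cs.inv_simple, simple_mul_simple_cancel_left, h1] at h2
    have h3 := cs.length_wordProd_le (ω.eraseIdx k)
    have h4 := List.length_eraseIdx_le ω k
    simp only [List.length_cons] at h2
    omega

end Stmt8

/-- If `ω` is a reduced word for an involution `w` of minimal length in its conjugacy class,
then every cyclic rotation of `ω` is again a reduced word for `w`. -/
theorem stmt_8 {B : Type*} {W : Type*} [Group W] {M : CoxeterMatrix B}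
    (cs : CoxeterSystem M W) (w : W) (ω : List B)
    (hred : cs.IsReduced ω) (hw : w = cs.wordProd ω)
    (hw2 : w * w = 1)
    (hmin : ∀ v : W, cs.length w ≤ cs.length (v * w * v⁻¹)) :
    ∀ i : ℕ, 0 < i → i < ω.length →
      cs.wordProd (ω.drop i ++ ω.take i) = w ∧
      cs.IsReduced (ω.drop i ++ ω.take i) := by
  have key : ∀ n : ℕ, cs.wordProd (ω.rotate n) = w ∧ cs.IsReduced (ω.rotate n) := by
    intro n
    induction n with
    | zero => simpa using ⟨hw.symm, hred⟩
    | succ n ih =>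
      obtain ⟨h1, h2⟩ := ih
      rw [← List.rotate_rotate]
      generalize ω.rotate n = τ at h1 h2 ⊢
      cases τ with
      | nil => simpa using ⟨h1, h2⟩
      | cons a τ =>
        subst h1
        have h3 := Stmt8.rot_one cs a τ h2 hw2 hmin
        rw [List.rotate_cons_succ, List.rotate_zero]
        refine ⟨h3, ?_⟩
        unfold CoxeterSystem.IsReduced at *
        rw [h3, h2]; simp
  intro i _ hi
  have := key i
  rwa [List.rotate_eq_drop_append_take hi.le] at this
end

section
/- Let (W,S) be a Coxeter system in which every 3-element subset of S generates an infinite subgroup (i.e., the Davis–Vinberg complex is at most 2-dimensional). Let w ∈ W be a nontrivial involution of minimal length in its conjugacy class that is not a reflection. Then there exist s',t' ∈ S with m(s',t') even, and w = (s't')^{m'} where m' = m(s',t')/2. -/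
namespace Stmt14
open Classical in
noncomputable def sgnMap {B W : Type*} [Group W] {M : CoxeterMatrix B}
    (cs : CoxeterSystem M W) (i : B) : Function.End (W × ZMod 2) :=
  fun p => (cs.simple i * p.1 * cs.simple i, p.2 + if p.1 = cs.simple i then 1 else 0)

open Classical in
lemma sgnMap_pow {B W : Type*} [Group W] {M : CoxeterMatrix B}
    (cs : CoxeterSystem M W) (i j : B) (k : ℕ) (p : W × ZMod 2) :
    ((sgnMap cs i * sgnMap cs j) ^ k) p =
      ((cs.simple i * cs.simple j) ^ k * p.1 * ((cs.simple i * cs.simple j) ^ k)⁻¹,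
        p.2 + ∑ q ∈ Finset.range (2 * k),
          if p.1 = (cs.simple j * cs.simple i) ^ q * cs.simple j then 1 else 0) := by
  have hinv : (cs.simple i * cs.simple j)⁻¹ = cs.simple j * cs.simple i := by simp
  have hsemi : ∀ a : ℕ, cs.simple j * (cs.simple i * cs.simple j) ^ a =
      (cs.simple j * cs.simple i) ^ a * cs.simple j := by
    intro a
    induction a with
    | zero => simp
    | succ a ih => rw [pow_succ, ← mul_assoc, ih, pow_succ]; simp only [mul_assoc]
  have hi : ∀ (c x y : W), c * x * c⁻¹ = y ↔ x = c⁻¹ * y * c := by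
    intro c x y
    constructor
    · rintro rfl; group
    · rintro rfl; group
  induction k with
  | zero => simp; rfl
  | succ k ih =>
    rw [pow_succ']
    show sgnMap cs i (sgnMap cs j (((sgnMap cs i * sgnMap cs j) ^ k) p)) = _
    rw [ih]
    have e1 : ((cs.simple i * cs.simple j) ^ k * p.1 * ((cs.simple i * cs.simple j) ^ k)⁻¹
        = cs.simple j) ↔ p.1 = (cs.simple j * cs.simple i) ^ (2 * k) * cs.simple j := by
      rw [hi, ← inv_pow, hinv, mul_assoc, hsemi, two_mul, pow_add, mul_assoc]
    have e2 : (cs.simple j * ((cs.simple i * cs.simple j) ^ k * p.1 *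
        ((cs.simple i * cs.simple j) ^ k)⁻¹) * cs.simple j
        = cs.simple i) ↔ p.1 = (cs.simple j * cs.simple i) ^ (2 * k + 1) * cs.simple j := by
      have : cs.simple j * ((cs.simple i * cs.simple j) ^ k * p.1 *
        ((cs.simple i * cs.simple j) ^ k)⁻¹) * cs.simple j = (cs.simple j * 
        (cs.simple i * cs.simple j) ^ k) * p.1 * (cs.simple j * 
        (cs.simple i * cs.simple j) ^ k)⁻¹ := by simp [mul_assoc]
      rw [this, hi, mul_inv_rev, ← inv_pow, hinv, cs.inv_simple, hsemi,
        show 2 * k + 1 = k + 1 + k by ring, pow_add, pow_succ]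
      simp only [mul_assoc]
    simp only [sgnMap, e1, e2]
    rw [show 2 * (k + 1) = 2 * k + 1 + 1 by ring, Finset.sum_range_succ, Finset.sum_range_succ]
    ext
    · simp [pow_succ', mul_assoc]
    · simp only [add_assoc]

lemma sgnMap_liftable {B W : Type*} [Group W] {M : CoxeterMatrix B}
    (cs : CoxeterSystem M W) : M.IsLiftable (sgnMap cs) := by
  classical
  intro i j
  funext p
  rw [sgnMap_pow, cs.simple_mul_simple_pow, two_mul, Finset.sum_range_add]
  simp only [pow_add, cs.simple_mul_simple_pow', one_mul, CharTwo.add_self_eq_zero]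
  simp
  rfl

/-- The parity cocycle. -/
noncomputable def nn {B W : Type*} [Group W] {M : CoxeterMatrix B}
    (cs : CoxeterSystem M W) (w x : W) : ZMod 2 :=
  (cs.lift ⟨sgnMap cs, sgnMap_liftable cs⟩ w (x, 0)).2

section
variable {B W : Type*} [Group W] {M : CoxeterMatrix B} (cs : CoxeterSystem M W)

lemma lift_apply_eq (w x : W) (e : ZMod 2) :
    cs.lift ⟨sgnMap cs, sgnMap_liftable cs⟩ w (x, e) = (w * x * w⁻¹, e + nn cs w x) := by
  induction w using cs.simple_induction_left generalizing x e with
  | one =>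
    rw [nn, map_one]
    show (x, e) = (1 * x * 1⁻¹, e + 0)
    simp
  | mul_simple_left w i ih =>
    have h : ∀ e, cs.lift ⟨sgnMap cs, sgnMap_liftable cs⟩ (cs.simple i * w) (x, e) =
        sgnMap cs i (cs.lift ⟨sgnMap cs, sgnMap_liftable cs⟩ w (x, e)) := by
      intro e
      rw [map_mul, cs.lift_apply_simple]; rfl
    rw [nn, h, h, ih, ih]
    simp [sgnMap, mul_assoc, add_assoc]

lemma nn_mul (v w x : W) : nn cs (v * w) x = nn cs w x + nn cs v (w * x * w⁻¹) := by
  have : cs.lift ⟨sgnMap cs, sgnMap_liftable cs⟩ (v * w) (x, 0) =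
      cs.lift ⟨sgnMap cs, sgnMap_liftable cs⟩ v 
        (cs.lift ⟨sgnMap cs, sgnMap_liftable cs⟩ w (x, 0)) := by
    rw [map_mul]; rfl
  rw [nn, this, lift_apply_eq, lift_apply_eq]
  simp

lemma nn_one (x : W) : nn cs 1 x = 0 := by rw [nn, map_one]; rfl

open Classical in
lemma nn_simple (i : B) (x : W) : nn cs (cs.simple i) x = if x = cs.simple i then 1 else 0 := by
  rw [nn, cs.lift_apply_simple]; simp [sgnMap]

lemma zmod2_ne (a : ZMod 2) : a ≠ 0 ↔ a = 1 := by revert a; decide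

lemma nn_inv (w x : W) : nn cs w⁻¹ x = nn cs w (w⁻¹ * x * w) := by
  have h := nn_mul cs w w⁻¹ x
  rw [mul_inv_cancel, nn_one, inv_inv] at h
  exact CharTwo.add_eq_zero.mp h.symm

lemma mem_ris_of_nn (ω : List B) (x : W) (h : nn cs (cs.wordProd ω) x ≠ 0) :
    x ∈ cs.rightInvSeq ω := by
  classical
  induction ω with
  | nil => simp [nn_one] at h
  | cons i ω ih =>
    rw [cs.wordProd_cons, nn_mul, nn_simple] at h
    by_cases h' : nn cs (cs.wordProd ω) x = 0
    · rw [h', zero_add] at h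
      have : cs.wordProd ω * x * (cs.wordProd ω)⁻¹ = cs.simple i := by
        by_contra hc; simp [hc] at h
      rw [CoxeterSystem.rightInvSeq, ← this]
      simp [mul_assoc]
    · exact List.mem_cons_of_mem _ (ih h')

lemma nn_refl {t : W} (ht : cs.IsReflection t) : nn cs t t = 1 := by
  obtain ⟨u, i, rfl⟩ := ht
  rw [nn_mul, nn_mul, nn_inv]
  simp [mul_assoc, nn_simple]
  rw [add_comm, add_assoc, CharTwo.add_self_eq_zero, add_zero]

lemma nn_iff {t : W} (ht : cs.IsReflection t) (w : W) :
    nn cs w t = 1 ↔ cs.length (w * t) < cs.length w := by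
  have key : ∀ w, nn cs w t = 1 → cs.length (w * t) < cs.length w := by
    intro w h
    obtain ⟨ω, hω, rfl⟩ := cs.exists_isReduced w
    exact (cs.isRightInversion_of_mem_rightInvSeq hω (mem_ris_of_nn cs ω t (by simp [h]))).2
  refine ⟨key w, fun h => ?_⟩
  by_contra hc
  have h0 : nn cs w t = 0 := by
    by_contra h'
    exact hc ((zmod2_ne _).mp h')
  have := key (w * t) (by
    rw [nn_mul, nn_refl cs ht]; simp [h0])
  rw [mul_assoc, ht.mul_self, mul_one] at this
  omega

lemma nn_simple_iff (w : W) (i : B) :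
    nn cs w (cs.simple i) = 1 ↔ cs.IsRightDescent w i := nn_iff cs (cs.isReflection_simple i) w

end

section
variable {B W : Type*} [Group W] {M : CoxeterMatrix B} (cs : CoxeterSystem M W)

lemma descent_comm (w : W) (hw2 : w * w = 1)
    (hmin : ∀ v : W, cs.length w ≤ cs.length (v * w * v⁻¹)) (i : B)
    (hi : cs.IsRightDescent w i) : w * cs.simple i * w⁻¹ = cs.simple i := by
  classical
  have hinv : w⁻¹ = w := inv_eq_of_mul_eq_one_left hw2
  have h1 : cs.IsLeftDescent w i := by
    rw [← cs.isRightDescent_inv_iff, hinv]; exact hi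
  have h2 := hmin (cs.simple i)
  rw [cs.inv_simple] at h2
  have h3 : nn cs (cs.simple i * w) (cs.simple i) ≠ 1 := by
    rw [Ne, nn_simple_iff, CoxeterSystem.IsRightDescent]
    unfold CoxeterSystem.IsLeftDescent at h1
    omega
  rw [nn_mul, (nn_simple_iff cs w i).mpr hi, nn_simple] at h3
  by_contra hc
  simp [hc] at h3

lemma nn_conj_simple (w : W) (i : B) (hi : w * cs.simple i * w⁻¹ = cs.simple i) (x : W) :
    nn cs w (cs.simple i * x * cs.simple i) = nn cs w x := by
  classical
  have h : w * cs.simple i = cs.simple i * w := by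
    exact mul_inv_eq_iff_eq_mul.mp hi
  have h1 := nn_mul cs w (cs.simple i) x
  rw [h, nn_mul, nn_simple, nn_simple, cs.inv_simple] at h1
  have : w * x * w⁻¹ = cs.simple i ↔ x = cs.simple i := by
    nth_rw 1 [← hi]
    simp
  simp only [this] at h1
  rw [add_comm] at h1
  exact (add_left_cancel h1).symm

lemma closure_facts (w : W) (T : Set B) (hT : ∀ i ∈ T, nn cs w (cs.simple i) = 1)
    (hc : ∀ i ∈ T, w * cs.simple i * w⁻¹ = cs.simple i) (v : W)
    (hv : v ∈ Subgroup.closure (cs.simple '' T)) :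
    (∀ x, nn cs w (v * x * v⁻¹) = nn cs w x) ∧ (∀ x, nn cs v x ≠ 0 → nn cs w x ≠ 0) := by
  classical
  induction hv using Subgroup.closure_induction with
  | mem v hv =>
    obtain ⟨i, hi, rfl⟩ := hv
    constructor
    · intro x
      rw [cs.inv_simple]
      exact nn_conj_simple cs w i (hc i hi) x
    · intro x hx
      rw [nn_simple] at hx
      have : x = cs.simple i := by
        by_contra h; simp [h] at hx
      rw [this, hT i hi]
      exact one_ne_zero
  | one => simp [nn_one]
  | mul u v _ _ hu hv =>
    constructor
    · intro x
      rw [← hv.1 x, ← hu.1 (v * x * v⁻¹)]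
      congr 1
      group
    · intro x hx hw
      apply hx
      rw [nn_mul]
      have a : nn cs v x = 0 := by
        by_contra h; exact hv.2 x h hw
      have b : nn cs u (v * x * v⁻¹) = 0 := by
        by_contra h; exact hu.2 _ h (by rw [hv.1, hw])
      rw [a, b, add_zero]
  | inv v _ hv =>
    have h1 : ∀ x, nn cs w (v⁻¹ * x * v⁻¹⁻¹) = nn cs w x := by
      intro x
      rw [← hv.1]
      congr 1
      group
    refine ⟨h1, fun x hx => ?_⟩
    rw [nn_inv] at hx
    have := hv.2 _ hx
    have h2 := h1 x
    rw [inv_inv] at h2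
    rwa [h2] at this

lemma length_le_of (v w : W) (h : ∀ x, nn cs v x ≠ 0 → nn cs w x ≠ 0) :
    cs.length v ≤ cs.length w := by
  obtain ⟨ω, hω, rfl⟩ := cs.exists_isReduced v
  obtain ⟨ω', hω', rfl⟩ := cs.exists_isReduced w
  rw [hω.eq, hω'.eq, ← cs.length_rightInvSeq ω, ← cs.length_rightInvSeq ω']
  apply List.Subperm.length_le
  apply List.Nodup.subperm (CoxeterSystem.IsReduced.nodup_rightInvSeq cs hω)
  intro t ht
  apply mem_ris_of_nn
  apply h
  have := cs.isRightInversion_of_mem_rightInvSeq hω ht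
  rw [(nn_iff cs this.1 _).mpr this.2]
  exact one_ne_zero

lemma finite_length_le [Finite B] (n : ℕ) : {v : W | cs.length v ≤ n}.Finite := by
  apply ((List.finite_length_le B n).image cs.wordProd).subset
  intro v hv
  obtain ⟨ω, hω, rfl⟩ := cs.exists_isReduced v
  exact ⟨ω, by simpa [hω.eq] using hv, rfl⟩

lemma mem_closure (w : W) (T : Set B) (hT : ∀ i, i ∈ T ↔ nn cs w (cs.simple i) = 1)
    (hc : ∀ i ∈ T, w * cs.simple i * w⁻¹ = cs.simple i)
    (hfin : (Subgroup.closure (cs.simple '' T) : Set W).Finite) :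
    w ∈ Subgroup.closure (cs.simple '' T) := by
  obtain ⟨v, hv, hmax⟩ := Set.exists_max_image _ cs.length hfin ⟨1, Subgroup.one_mem _⟩
  have hvi := Subgroup.inv_mem _ hv
  obtain ⟨f1, f2⟩ := closure_facts cs w T (fun i hi => (hT i).mp hi) hc _ hvi
  by_cases hu : w * v⁻¹ = 1
  · rw [mul_inv_eq_one.mp hu]; exact hv
  exfalso
  obtain ⟨i, hi⟩ := cs.exists_rightDescent_of_ne_one hu
  rw [← nn_simple_iff, nn_mul, f1] at hi
  by_cases hw : nn cs w (cs.simple i) = 0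
  · rw [hw, add_zero] at hi
    exact f2 _ (by rw [hi]; exact one_ne_zero) hw
  · have hw1 := (zmod2_ne _).mp hw
    rw [hw1] at hi
    have hnd : ¬ cs.IsRightDescent v⁻¹ i := by
      rw [← nn_simple_iff]
      intro h
      rw [h] at hi
      revert hi; decide
    rw [cs.not_isRightDescent_iff, cs.length_inv] at hnd
    have := hmax (v⁻¹ * cs.simple i)
      (Subgroup.mul_mem _ hvi (Subgroup.subset_closure ⟨i, (hT i).mpr hw1, rfl⟩))
    omega

lemma dihedral_mem (i j : B) (v : W)
    (hv : v ∈ Subgroup.closure {cs.simple i, cs.simple j}) :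
    (∃ k : ℤ, v = (cs.simple i * cs.simple j) ^ k) ∨
    (∃ k : ℤ, v = (cs.simple i * cs.simple j) ^ k * cs.simple i) := by
  set c := cs.simple i * cs.simple j with hcdef
  have hsw : ∀ k : ℤ, cs.simple i * c ^ k = c ^ (-k) * cs.simple i := by
    intro k
    have h1 : cs.simple i * c * (cs.simple i)⁻¹ = c⁻¹ := by simp [hcdef]
    have h2 : cs.simple i * c ^ k * (cs.simple i)⁻¹ = c ^ (-k) := by
      rw [← conj_zpow, h1, inv_zpow, zpow_neg]
    rw [← h2]; group
  have hss := cs.simple_mul_simple_self i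
  induction hv using Subgroup.closure_induction with
  | mem v hv =>
    rcases hv with rfl | rfl
    · exact Or.inr ⟨0, by simp⟩
    · exact Or.inr ⟨-1, by simp [hcdef]⟩
  | one => exact Or.inl ⟨0, by simp⟩
  | mul u v _ _ hu hv =>
    rcases hu with ⟨a, rfl⟩ | ⟨a, rfl⟩ <;> rcases hv with ⟨b, rfl⟩ | ⟨b, rfl⟩
    · exact Or.inl ⟨a + b, by rw [zpow_add]⟩
    · exact Or.inr ⟨a + b, by rw [zpow_add, mul_assoc]⟩
    · exact Or.inr ⟨a + -b, by rw [zpow_add, mul_assoc, hsw, mul_assoc]⟩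
    · exact Or.inl ⟨a + -b, by
        rw [zpow_add, mul_assoc, ← mul_assoc (cs.simple i), hsw, mul_assoc (c ^ (-b)), hss,
          mul_one]⟩
  | inv v _ hv =>
    rcases hv with ⟨a, rfl⟩ | ⟨a, rfl⟩
    · exact Or.inl ⟨-a, by rw [zpow_neg]⟩
    · exact Or.inr ⟨a, by rw [mul_inv_rev, cs.inv_simple, ← zpow_neg, hsw, neg_neg]⟩

lemma dihedral_refl (i j : B) (k : ℤ) :
    cs.IsReflection ((cs.simple i * cs.simple j) ^ k * cs.simple i) := by
  set c := cs.simple i * cs.simple j with hcdef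
  have hsw : ∀ k : ℤ, cs.simple i * c ^ k = c ^ (-k) * cs.simple i := by
    intro k
    have h1 : cs.simple i * c * (cs.simple i)⁻¹ = c⁻¹ := by simp [hcdef]
    have h2 : cs.simple i * c ^ k * (cs.simple i)⁻¹ = c ^ (-k) := by
      rw [← conj_zpow, h1, inv_zpow, zpow_neg]
    rw [← h2]; group
  obtain ⟨p, rfl | rfl⟩ := Int.even_or_odd' k
  · refine ⟨c ^ p, i, ?_⟩
    rw [mul_assoc, ← zpow_neg, hsw, neg_neg, ← mul_assoc, ← zpow_add, two_mul]
  · have : cs.IsReflection (c * cs.simple i) := ⟨cs.simple i, j, by simp [hcdef]⟩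
    have h := this.conj (c ^ p)
    convert h using 1
    rw [mul_assoc, mul_assoc, ← zpow_neg, hsw, neg_neg, ← mul_assoc, ← mul_assoc,
      ← zpow_add_one, ← zpow_add]
    congr 2
    ring

end
end Stmt14

namespace Stmt14
open Module Polynomial.Chebyshev

noncomputable def geoForm {B : Type*} (M : CoxeterMatrix B) (i : B) : Dual ℝ (B →₀ ℝ) :=
  Finsupp.linearCombination ℝ (fun j => -2 * Real.cos (Real.pi / M i j))

lemma geoForm_single {B : Type*} (M : CoxeterMatrix B) (i j : B) :
    geoForm M i (Finsupp.single j 1) = -2 * Real.cos (Real.pi / M i j) := by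
  simp [geoForm]

lemma geoForm_self {B : Type*} (M : CoxeterMatrix B) (i : B) :
    geoForm M i (Finsupp.single i 1) = 2 := by
  simp [geoForm_single]

noncomputable def geoRefl {B : Type*} (M : CoxeterMatrix B) (i : B) :
    (B →₀ ℝ) ≃ₗ[ℝ] (B →₀ ℝ) := reflection (geoForm_self M i)

lemma geo_t {B : Type*} (M : CoxeterMatrix B) (i j : B) :
    2 * Real.cos (2 * Real.pi / M i j) = 
    geoForm M i (Finsupp.single j 1) * geoForm M j (Finsupp.single i 1) - 2 := by
  rw [geoForm_single, geoForm_single, M.symmetric j i, mul_div_assoc, Real.cos_two_mul]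
  ring

lemma sin_pos_aux {m : ℕ} (hm : 3 ≤ m) : 0 < Real.sin (2 * Real.pi / m) := by
  have hm' : (3 : ℝ) ≤ m := by exact_mod_cast hm
  apply Real.sin_pos_of_pos_of_lt_pi
  · have := Real.pi_pos; positivity
  · rw [div_lt_iff₀ (by linarith)]
    nlinarith [Real.pi_pos]

lemma S_even {h : ℕ} (hh : 2 ≤ h) :
    (S ℝ ((h : ℤ) - 1)).eval (2 * Real.cos (2 * Real.pi / ((2 * h : ℕ) : ℝ))) = 0 := by
  have h1 := S_two_mul_real_cos (2 * Real.pi / ((2 * h : ℕ) : ℝ)) ((h : ℤ) - 1)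
  have h2 := sin_pos_aux (m := 2 * h) (by omega)
  have h0 : (h : ℝ) ≠ 0 := by positivity
  have h3 : (((h : ℤ) - 1 : ℤ) + 1 : ℝ) * (2 * Real.pi / ((2 * h : ℕ) : ℝ)) = Real.pi := by
    push_cast; field_simp; ring
  rw [h3, Real.sin_pi] at h1
  exact (mul_eq_zero.mp h1).resolve_right h2.ne'

lemma S_odd {h : ℕ} (hh : 1 ≤ h) :
    (S ℝ (h : ℤ)).eval (2 * Real.cos (2 * Real.pi / ((2 * h + 1 : ℕ) : ℝ))) +
    (S ℝ ((h : ℤ) - 1)).eval (2 * Real.cos (2 * Real.pi / ((2 * h + 1 : ℕ) : ℝ))) = 0 := by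
  have h1 := S_two_mul_real_cos (2 * Real.pi / ((2 * h + 1 : ℕ) : ℝ)) ((h : ℤ) - 1)
  have h1' := S_two_mul_real_cos (2 * Real.pi / ((2 * h + 1 : ℕ) : ℝ)) (h : ℤ)
  have h2 := sin_pos_aux (m := 2 * h + 1) (by omega)
  have h0 : (2 * h + 1 : ℝ) ≠ 0 := by positivity
  have h3 : (((h : ℤ) : ℝ) + 1) * (2 * Real.pi / ((2 * h + 1 : ℕ) : ℝ)) =
      2 * Real.pi - (((h : ℤ) - 1 : ℤ) + 1 : ℝ) * (2 * Real.pi / ((2 * h + 1 : ℕ) : ℝ)) := by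
    push_cast; field_simp; ring
  rw [h3, Real.sin_two_pi_sub] at h1'
  have : ((S ℝ (h : ℤ)).eval (2 * Real.cos (2 * Real.pi / ((2 * h + 1 : ℕ) : ℝ))) +
    (S ℝ ((h : ℤ) - 1)).eval (2 * Real.cos (2 * Real.pi / ((2 * h + 1 : ℕ) : ℝ)))) *
     Real.sin (2 * Real.pi / ((2 * h + 1 : ℕ) : ℝ)) = 0 := by
    rw [add_mul, h1, h1']; ring
  exact (mul_eq_zero.mp this).resolve_right h2.ne'

lemma geoRefl_liftable {B : Type*} (M : CoxeterMatrix B) : M.IsLiftable (geoRefl M) := by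
  intro i j
  have hdiag : i = j → (geoRefl M i * geoRefl M j) ^ M i j = 1 := by
    rintro rfl
    rw [M.diagonal, pow_one]
    ext1 z
    exact involutive_reflection (geoForm_self M i) z
  by_cases hij : i = j
  · exact hdiag hij
  have h1 : M i j ≠ 1 := M.off_diagonal i j hij
  obtain h0 | h2 | h3 : M i j = 0 ∨ M i j = 2 ∨ 3 ≤ M i j := by omega
  · rw [h0, pow_zero]
  · have e1 : geoForm M i (Finsupp.single j 1) = 0 := by simp [geoForm_single, h2]
    have e2 : geoForm M j (Finsupp.single i 1) = 0 := by
      simp [geoForm_single, M.symmetric j i, h2]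
    rw [h2]
    apply LinearEquiv.ext
    intro z
    rw [pow_two]
    simp only [geoRefl, LinearEquiv.mul_apply, reflection_apply, map_sub, map_smul, e1, e2,
      geoForm_self, LinearEquiv.coe_one, id]
    module
  · apply LinearEquiv.ext
    intro z
    rw [geoRefl, geoRefl, reflection_mul_reflection_pow_apply _ _ _ _ _ (geo_t M i j)]
    obtain ⟨h, hh | hh⟩ := Nat.even_or_odd' (M i j)
    · have key := S_even (h := h) (by omega)
      rw [← hh] at key
      rw [show (((M i j : ℕ) : ℤ) - 2) / 2 = (h : ℤ) - 1 by omega,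
        show (((M i j : ℕ) : ℤ) - 1) / 2 = (h : ℤ) - 1 by omega, key]
      simp
    · have key := S_odd (h := h) (by omega)
      rw [← hh] at key
      rw [show (((M i j : ℕ) : ℤ) - 2) / 2 = (h : ℤ) - 1 by omega,
        show (((M i j : ℕ) : ℤ) - 1) / 2 = (h : ℤ) by omega, 
        show (((M i j : ℕ) : ℤ) - 3) / 2 = (h : ℤ) - 1 by omega,
        show (((M i j : ℕ) : ℤ)) / 2 = (h : ℤ) by omega, key]
      simp

lemma dvd_of_pow {B : Type*} (M : CoxeterMatrix B) {i j : B} (hij : i ≠ j) (k : ℕ)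
    (hk : (geoRefl M i * geoRefl M j) ^ k = 1) : M i j ∣ k := by
  have h1 : M i j ≠ 1 := M.off_diagonal i j hij
  have hx : ((geoRefl M i * geoRefl M j) ^ k) (Finsupp.single i 1) = Finsupp.single i 1 := by
    rw [hk]; rfl
  rw [geoRefl, geoRefl, reflection_mul_reflection_pow_apply_self _ _ _ _ (geo_t M i j)] at hx
  have hi := DFunLike.congr_fun hx i
  have hj := DFunLike.congr_fun hx j
  simp only [Finsupp.add_apply, Finsupp.smul_apply, Finsupp.single_eq_same, 
    Finsupp.single_eq_of_ne hij, Finsupp.single_eq_of_ne hij.symm, smul_eq_mul, mul_zero, mul_one,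
    add_zero, zero_add, geoForm_single] at hi hj
  obtain h0 | h2 | h3 : M i j = 0 ∨ M i j = 2 ∨ 3 ≤ M i j := by omega
  · simp [M.symmetric j i, h0] at hj hi
    rw [h0]
    have : (k : ℝ) = 0 := by linarith
    simpa using this
  · rw [h2]
    by_contra hodd
    have hev : (geoRefl M i * geoRefl M j) ^ 2 = 1 := h2 ▸ geoRefl_liftable M i j
    obtain ⟨q, rfl⟩ : Odd k := by
      rw [← Nat.not_even_iff_odd, even_iff_two_dvd]; exact hodd
    rw [pow_succ, pow_mul, hev, one_pow, one_mul] at hk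
    have e2 : geoForm M j (Finsupp.single i 1) = 0 := by
      simp [geoForm_single, M.symmetric j i, h2]
    have h3 : (geoRefl M i * geoRefl M j) (Finsupp.single i 1) = Finsupp.single i 1 := by
      rw [hk]; rfl
    rw [LinearEquiv.mul_apply, geoRefl, geoRefl, reflection_apply _ (geoForm_self M j), e2,
      zero_smul, sub_zero, reflection_apply_self] at h3
    have := DFunLike.congr_fun h3 i
    simp at this
    linarith
  · have hs := sin_pos_aux h3
    have hc : Real.cos (Real.pi / M i j) ≠ 0 := by
      have hm' : (3 : ℝ) ≤ M i j := by exact_mod_cast h3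
      apply ne_of_gt
      apply Real.cos_pos_of_mem_Ioo
      constructor
      · have := Real.pi_pos
        have : 0 < Real.pi / M i j := by positivity
        linarith
      · rw [div_lt_iff₀ (by linarith)]
        nlinarith [Real.pi_pos]
    rw [M.symmetric j i] at hj
    have hz : (S ℝ ((k : ℤ) - 1)).eval (2 * Real.cos (2 * Real.pi / M i j)) = 0 := by
      rcases mul_eq_zero.mp hj with h | h
      · exact h
      · exfalso; apply hc; linarith
    rw [hz, add_zero] at hi
    have g1 := S_two_mul_real_cos (2 * Real.pi / M i j) ((k : ℤ) - 1)
    have g2 := S_two_mul_real_cos (2 * Real.pi / M i j) (k : ℤ)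
    rw [hz, zero_mul] at g1
    rw [hi, one_mul, add_mul, one_mul, Real.sin_add] at g2
    push_cast at g1 g2
    rw [sub_add_cancel] at g1
    rw [← g1, zero_mul, zero_add] at g2
    have hcos : Real.cos ((k : ℝ) * (2 * Real.pi / M i j)) = 1 :=
      mul_right_cancel₀ hs.ne' (by rw [one_mul]; exact g2.symm)
    rw [Real.cos_eq_one_iff] at hcos
    obtain ⟨n, hn⟩ := hcos
    have hm0 : (M i j : ℝ) ≠ 0 := by
      have : M i j ≠ 0 := by omega
      exact_mod_cast this
    have : (n : ℝ) * M i j = k := by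
      have hp := Real.pi_pos.ne'
      field_simp at hn
      linarith
    have : n * (M i j : ℤ) = k := by exact_mod_cast this
    exact_mod_cast (Dvd.intro_left n this : (M i j : ℤ) ∣ (k : ℤ))

lemma orderOf_simple_mul_simple {B W : Type*} [Group W] {M : CoxeterMatrix B}
    (cs : CoxeterSystem M W) {i j : B} (hij : i ≠ j) :
    orderOf (cs.simple i * cs.simple j) = M i j := by
  apply Nat.dvd_antisymm
  · exact orderOf_dvd_of_pow_eq_one (cs.simple_mul_simple_pow i j)
  · apply dvd_of_pow M hij
    have := congrArg (cs.lift ⟨geoRefl M, geoRefl_liftable M⟩)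
      (pow_orderOf_eq_one (cs.simple i * cs.simple j))
    rwa [map_pow, map_mul, cs.lift_apply_simple, cs.lift_apply_simple, map_one] at this

end Stmt14

/-- In a Coxeter system whose Davis–Vinberg complex is at most 2-dimensional (every
3-element subset of the generators generates an infinite subgroup), every nontrivial
involution of minimal length in its conjugacy class which is not a reflection equals
`(s't')^{m'}` for some generators `s', t'` with `m(s',t') = 2m'` even. -/
theorem stmt_14 {B : Type*} {W : Type*} [Group W] [Finite B] {M : CoxeterMatrix B}
    (cs : CoxeterSystem M W)
    (hdim : ∀ T : Set B, 2 < T.ncard → (Subgroup.closure (cs.simple '' T) : Set W).Infinite)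
    (w : W) (hw2 : w * w = 1) (hw1 : w ≠ 1)
    (hmin : ∀ v : W, cs.length w ≤ cs.length (v * w * v⁻¹))
    (hrefl : ¬ cs.IsReflection w) :
    ∃ s' t' : B, M s' t' ≠ 0 ∧ Even (M s' t') ∧
      w = (cs.simple s' * cs.simple t') ^ (M s' t' / 2) := by
  classical
  have hdesc := Stmt14.descent_comm cs w hw2 hmin
  set T : Set B := {i | cs.IsRightDescent w i} with hTdef
  have hT : ∀ i, i ∈ T ↔ Stmt14.nn cs w (cs.simple i) = 1 := fun i =>
    (Stmt14.nn_simple_iff cs w i).symm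
  have hfin : (Subgroup.closure (cs.simple '' T) : Set W).Finite := by
    apply (Stmt14.finite_length_le cs (cs.length w)).subset
    intro v hv
    exact Stmt14.length_le_of cs v w
      (Stmt14.closure_facts cs w T (fun i hi => (hT i).mp hi) hdesc v hv).2
  have hw : w ∈ Subgroup.closure (cs.simple '' T) :=
    Stmt14.mem_closure cs w T hT hdesc hfin
  have hcard : T.ncard ≤ 2 := by
    by_contra h
    exact hdim T (by omega) hfin
  have hpair : ∀ i j : B, T = {i, j} → i ≠ j ∧ ∃ k : ℤ, w = (cs.simple i * cs.simple j) ^ k := by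
    rintro i j hij
    rw [hij, Set.image_pair] at hw
    rcases Stmt14.dihedral_mem cs i j w hw with ⟨k, hk⟩ | ⟨k, hk⟩
    · refine ⟨?_, k, hk⟩
      rintro rfl
      rw [cs.simple_mul_simple_self, one_zpow] at hk
      exact hw1 hk
    · exact absurd (hk ▸ Stmt14.dihedral_refl cs i j k) hrefl
  obtain ⟨i, j, hij⟩ : ∃ i j : B, T = {i, j} := by
    obtain h | h | h : T.ncard = 0 ∨ T.ncard = 1 ∨ T.ncard = 2 := by omega
    · exfalso
      rw [Set.ncard_eq_zero] at h
      rw [h] at hw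
      simp at hw
      exact hw1 hw
    · obtain ⟨i, hi⟩ := Set.ncard_eq_one.mp h
      exact ⟨i, i, by simp [hi]⟩
    · obtain ⟨i, j, -, hi⟩ := Set.ncard_eq_two.mp h
      exact ⟨i, j, hi⟩
  obtain ⟨hne, k, hk⟩ := hpair i j hij
  have hord := Stmt14.orderOf_simple_mul_simple cs hne
  have hd1 : (M i j : ℤ) ∣ 2 * k := by
    rw [← hord, orderOf_dvd_iff_zpow_eq_one, two_mul, zpow_add, ← hk, hw2]
  have hd2 : ¬ (M i j : ℤ) ∣ k := by
    rw [← hord, orderOf_dvd_iff_zpow_eq_one, ← hk]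
    exact hw1
  obtain ⟨q, hq⟩ := hd1
  have hm0 : M i j ≠ 0 := by
    intro h0
    apply hd2
    rw [h0] at hq ⊢
    simp at hq
    simp [hq]
  have hqodd : Odd q := by
    rw [← Int.not_even_iff_odd]
    rintro ⟨r, rfl⟩
    exact hd2 ⟨r, by linarith⟩
  have heven : Even (M i j) := by
    have h1 : Even ((M i j : ℤ) * q) := ⟨k, by rw [← hq]; ring⟩
    rcases Int.even_mul.mp h1 with h | h
    · exact_mod_cast h
    · exact absurd h (Int.not_even_iff_odd.mpr hqodd)
  refine ⟨i, j, hm0, heven, ?_⟩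
  obtain ⟨h, hh⟩ := heven
  obtain ⟨r, rfl⟩ := hqodd
  have hk2 : k = (M i j : ℤ) * r + (h : ℤ) := by
    rw [hh] at hq ⊢
    push_cast at hq ⊢
    linarith
  have hdiv : M i j / 2 = h := by omega
  rw [hdiv, hk, hk2, zpow_add, zpow_mul, zpow_natCast, zpow_natCast, cs.simple_mul_simple_pow,
    one_zpow, one_mul]
end

section
/- Let (W,S) be a Coxeter system such that every subset T ⊆ S with |T| > 2 generates an infinite subgroup. Let s,t,a,b ∈ S and w,x ∈ W. Suppose m(s,t) is even, m(a,b) is finite, and w(st)^m w⁻¹ ∈ x W_{{a,b}} x⁻¹ where m = m(s,t)/2. Then w W_{{s,t}} w⁻¹ = x W_{{a,b}} x⁻¹ and {s,t} = {a,b}. -/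
set_option linter.unusedSectionVars false

namespace CoxAux

open Polynomial.Chebyshev

variable {B : Type*} {W : Type*} [Group W] {M : CoxeterMatrix B}

section Tits

variable [Fintype B] [DecidableEq B]

/-- The (doubled) Tits form on simple roots. -/
noncomputable def kf (M : CoxeterMatrix B) (i j : B) : ℝ := -2 * Real.cos (Real.pi / (M i j : ℝ))

/-- The coroot functional. -/
noncomputable def fn (M : CoxeterMatrix B) (i : B) : Module.Dual ℝ (B → ℝ) :=
  ∑ j, kf M i j • LinearMap.proj j

lemma fn_single (i j : B) : fn M i (Pi.single j 1) = kf M i j := by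
  simp [fn, Pi.single_apply]

lemma kf_symm (i j : B) : kf M i j = kf M j i := by
  simp [kf, M.symmetric i j]

lemma fn_self (i : B) : fn M i (Pi.single i 1) = 2 := by
  rw [fn_single]; simp [kf]

/-- The reflection attached to a generator. -/
noncomputable def rf (M : CoxeterMatrix B) (i : B) : (B → ℝ) ≃ₗ[ℝ] (B → ℝ) :=
  Module.reflection (fn_self (M := M) i)

lemma sin_ne {m : ℕ} (hm : 3 ≤ m) : Real.sin (2 * (Real.pi / m)) ≠ 0 := by
  have h3 : (3 : ℝ) ≤ m := by exact_mod_cast hm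
  have : 0 < Real.sin (2 * (Real.pi / m)) := by
    apply Real.sin_pos_of_pos_of_lt_pi
    · have := Real.pi_pos; positivity
    · rw [← mul_div_assoc, div_lt_iff₀ (by linarith)]
      nlinarith [Real.pi_pos]
  exact this.ne'

lemma tval (i j : B) : kf M i j * kf M j i - 2 = 2 * Real.cos (2 * (Real.pi / (M i j : ℝ))) := by
  rw [← kf_symm i j, kf, Real.cos_two_mul]; ring

lemma rel (i j : B) : (rf M i * rf M j) ^ M i j = 1 := by
  ext1 z
  by_cases hij : i = j
  · subst hij
    have := Module.involutive_reflection (fn_self (M := M) i) z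
    simp only [CoxeterMatrix.diagonal, pow_one]
    exact this
  by_cases h0 : M i j = 0
  · simp [h0]
  by_cases h2 : M i j = 2
  · rw [h2, rf, rf, Module.reflection_mul_reflection_pow_apply]
    have e1 : kf M i j = 0 := by simp [kf, h2]
    have e2 : kf M j i = 0 := by rw [kf_symm]; exact e1
    simp [fn_single, e1, e2]
    module
  have h1 : M i j ≠ 1 := M.off_diagonal i j hij
  have h3 : 3 ≤ M i j := by omega
  have hs := sin_ne h3
  have ht : 2 * Real.cos (2 * (Real.pi / (M i j : ℝ))) =
    fn M i (Pi.single j 1) * fn M j (Pi.single i 1) - 2 := by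
    rw [fn_single, fn_single, tval]
  rw [rf, rf, Module.reflection_mul_reflection_pow_apply _ _ _ _ _ ht]
  set φ := 2 * (Real.pi / (M i j : ℝ)) with hφ
  have hmφ : (M i j : ℝ) * φ = 2 * Real.pi := by
    rw [hφ]; field_simp
  rcases Nat.even_or_odd' (M i j) with ⟨k, hk | hk⟩
  · have hS : (S ℝ (k - 1)).eval (2 * Real.cos φ) = 0 := by
      have := S_two_mul_real_cos φ (k - 1)
      have hkφ : (k : ℝ) * φ = Real.pi := by
        rw [hk] at hmφ; push_cast at hmφ; linarith
      push_cast at this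
      rw [sub_add_cancel, hkφ, Real.sin_pi] at this
      exact (mul_eq_zero.1 this).resolve_right hs
    have e1 : ((M i j : ℤ) - 2) / 2 = k - 1 := by omega
    have e2 : ((M i j : ℤ) - 1) / 2 = k - 1 := by omega
    rw [e1, e2, hS]
    simp
  · have hS : (S ℝ k).eval (2 * Real.cos φ) + (S ℝ (k - 1)).eval (2 * Real.cos φ) = 0 := by
      have a1 := S_two_mul_real_cos φ (k - 1)
      have a2 := S_two_mul_real_cos φ k
      have hkφ : ((k : ℝ) + 1) * φ = 2 * Real.pi - k * φ := by
        rw [hk] at hmφ; push_cast at hmφ; linarith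
      push_cast at a1 a2
      rw [sub_add_cancel] at a1
      rw [hkφ, Real.sin_two_pi_sub] at a2
      have : ((S ℝ k).eval (2 * Real.cos φ) + (S ℝ (k - 1)).eval (2 * Real.cos φ)) *
        Real.sin φ = 0 := by rw [add_mul, a1, a2]; ring
      exact (mul_eq_zero.1 this).resolve_right hs
    have e1 : ((M i j : ℤ) - 2) / 2 = k - 1 := by omega
    have e2 : ((M i j : ℤ) - 1) / 2 = k := by omega
    have e3 : ((M i j : ℤ) - 3) / 2 = k - 1 := by omega
    have e4 : ((M i j : ℤ)) / 2 = k := by omega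
    rw [e1, e2, e3, e4, hS]
    simp

/-- The Tits representation. -/
noncomputable def tits (cs : CoxeterSystem M W) : W →* ((B → ℝ) ≃ₗ[ℝ] (B → ℝ)) :=
  cs.lift ⟨rf M, rel⟩

lemma tits_simple (cs : CoxeterSystem M W) (i : B) : tits cs (cs.simple i) = rf M i :=
  cs.lift_apply_simple rel i

lemma single_inj_aux {i j : B} (hij : i ≠ j) {p q : ℝ}
    (h : p • (Pi.single i 1 : B → ℝ) + q • (Pi.single j 1 : B → ℝ) = Pi.single i 1) :
    p = 1 ∧ q = 0 := by
  constructor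
  · have := congrFun h i
    simpa [Pi.single_apply, hij] using this
  · have := congrFun h j
    simpa [Pi.single_apply, hij.symm] using this

end Tits

lemma simple_inj [Finite B] (cs : CoxeterSystem M W) {i j : B} (h : cs.simple i = cs.simple j) :
    i = j := by
  classical
  have := Fintype.ofFinite B
  by_contra hij
  have h1 := congrArg (fun g => tits cs g (Pi.single i 1)) h
  simp only [tits_simple, rf] at h1
  rw [Module.reflection_apply_self, Module.reflection_apply] at h1
  have := congrFun h1 i
  simp [hij] at this
  linarith

lemma pow_ne [Finite B] (cs : CoxeterSystem M W) {i j : B} (hij : i ≠ j) {k : ℕ} (hk : 0 < k)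
    (hkM : k < M i j) : (cs.simple i * cs.simple j) ^ k ≠ 1 := by
  classical
  have := Fintype.ofFinite B
  intro h
  have h1 := congrArg (fun g => tits cs g (Pi.single i 1)) h
  simp only [map_pow, map_mul, tits_simple, rf, map_one] at h1
  have ht : 2 * Real.cos (2 * (Real.pi / (M i j : ℝ))) =
    fn M i (Pi.single j 1) * fn M j (Pi.single i 1) - 2 := by
    rw [fn_single, fn_single, tval]
  rw [Module.reflection_mul_reflection_pow_apply_self _ _ _ _ ht] at h1
  obtain ⟨p1, p2⟩ := single_inj_aux hij h1
  have hM1 : M i j ≠ 1 := M.off_diagonal i j hij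
  by_cases h2 : M i j = 2
  · have : k = 1 := by omega
    subst this
    have : 2 * (Real.pi / (2 : ℝ)) = Real.pi := by ring
    simp [h2, this] at p1
  have h3 : 3 ≤ M i j := by omega
  have hs := sin_ne h3
  have h3' : (3 : ℝ) ≤ M i j := by exact_mod_cast h3
  set φ := 2 * (Real.pi / (M i j : ℝ)) with hφ
  have hg : fn M j (Pi.single i 1) ≠ 0 := by
    rw [fn_single, kf_symm, kf]
    have : 0 < Real.cos (Real.pi / (M i j : ℝ)) := by
      apply Real.cos_pos_of_mem_Ioo
      have hp := Real.pi_pos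
      constructor
      · have : 0 < Real.pi / (M i j : ℝ) := by positivity
        linarith
      · rw [div_lt_div_iff₀ (by linarith) (by norm_num)]
        nlinarith
    simp [this.ne']
  have hS : (S ℝ (k - 1)).eval (2 * Real.cos φ) = 0 := by
    rcases mul_eq_zero.1 p2 with h | h
    · exact h
    · exact absurd (neg_eq_zero.1 h) hg
  rw [hS, add_zero] at p1
  have a1 := S_two_mul_real_cos φ (k - 1)
  have a2 := S_two_mul_real_cos φ k
  push_cast at a1 a2
  rw [hS, sub_add_cancel, zero_mul] at a1
  rw [p1, one_mul, add_mul, one_mul, Real.sin_add, ← a1, zero_mul, zero_add] at a2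
  have hc : Real.cos (k * φ) = 1 := by
    have : (Real.cos (k * φ) - 1) * Real.sin φ = 0 := by linarith
    linarith [(mul_eq_zero.1 this).resolve_right hs]
  have hk' : (k : ℝ) < M i j := by exact_mod_cast hkM
  have hk0 : (0 : ℝ) < k := by exact_mod_cast hk
  have hp := Real.pi_pos
  have hb : k * φ < 2 * Real.pi := by
    rw [hφ, ← mul_div_assoc, ← mul_div_assoc, div_lt_iff₀ (by linarith)]
    nlinarith
  have hb0 : 0 < k * φ := by rw [hφ]; positivity
  have := (Real.cos_eq_one_iff_of_lt_of_lt (by linarith) hb).1 hc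
  linarith


section Exchange

variable (cs : CoxeterSystem M W)

open Classical in
/-- The basic involution of the permutation representation. -/
noncomputable def sgf (i : B) (p : W × ZMod 2) : W × ZMod 2 :=
  (cs.simple i * p.1 * cs.simple i, p.2 + if p.1 = cs.simple i then 1 else 0)

lemma sgf_invol (i : B) : Function.Involutive (sgf cs i) := by
  intro p
  have h : cs.simple i * p.1 * cs.simple i = cs.simple i ↔ p.1 = cs.simple i := by
    constructor
    · intro h
      have h2 : cs.simple i * (cs.simple i * p.1 * cs.simple i) * cs.simple i =
        cs.simple i * cs.simple i * cs.simple i := by rw [h]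
      simpa [← mul_assoc] using h2
    · intro h; rw [h]; simp
  ext
  · simp [sgf, ← mul_assoc]
  · by_cases hp : p.1 = cs.simple i
    · have h2 : (sgf cs i p).1 = cs.simple i := h.2 hp
      have e1 : (sgf cs i p).2 = p.2 + 1 := by rw [sgf, if_pos hp]
      rw [sgf, if_pos h2, e1, add_assoc, CharTwo.add_self_eq_zero, add_zero]
    · have h2 : ¬ (sgf cs i p).1 = cs.simple i := fun h' => hp (h.1 h')
      have e1 : (sgf cs i p).2 = p.2 := by rw [sgf, if_neg hp, add_zero]
      rw [sgf, if_neg h2, e1, add_zero]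

/-- The basic permutation. -/
noncomputable def sg (i : B) : Equiv.Perm (W × ZMod 2) := (sgf_invol cs i).toPerm

lemma sg_apply (i : B) (p : W × ZMod 2) : sg cs i p = sgf cs i p := rfl

lemma simple_mul_pow_inv (i j : B) (l : ℕ) :
    ((cs.simple i * cs.simple j) ^ l)⁻¹ * cs.simple j =
      cs.simple j * (cs.simple i * cs.simple j) ^ l := by
  induction l with
  | zero => simp
  | succ l ih =>
    rw [pow_succ', mul_inv_rev, mul_assoc]
    have : (cs.simple i * cs.simple j)⁻¹ * cs.simple j =
      cs.simple j * (cs.simple i * cs.simple j) := by simp [mul_assoc]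
    rw [this, ← mul_assoc, ih, mul_assoc, ← pow_succ, ← pow_succ']

open Classical in
lemma sg_pow (i j : B) (k : ℕ) (x : W) (e : ZMod 2) :
    ((sg cs i * sg cs j) ^ k) (x, e) =
      ((cs.simple i * cs.simple j) ^ k * x * ((cs.simple i * cs.simple j) ^ k)⁻¹,
        e + ∑ n ∈ Finset.range (2 * k),
          if x = cs.simple j * (cs.simple i * cs.simple j) ^ n then 1 else 0) := by
  induction k with
  | zero => simp
  | succ k ih =>
    rw [pow_succ', Equiv.Perm.mul_apply, ih, Equiv.Perm.mul_apply, sg_apply, sg_apply]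
    set c := cs.simple i * cs.simple j with hc
    have hcj := simple_mul_pow_inv cs i j k
    rw [← hc] at hcj
    have h1 : c ^ k * x * (c ^ k)⁻¹ = cs.simple j ↔ x = cs.simple j * c ^ (2 * k) := by
      rw [two_mul, pow_add, ← mul_assoc, ← hcj]
      constructor
      · intro h; rw [← h]; group
      · intro h; rw [h]; group
    have h2 : cs.simple j * (c ^ k * x * (c ^ k)⁻¹) * cs.simple j = cs.simple i ↔
        x = cs.simple j * c ^ (2 * k + 1) := by
      have e1 : cs.simple j * c ^ (2 * k + 1) = (c ^ k)⁻¹ * (cs.simple j * c) * c ^ k := by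
        rw [← mul_assoc, hcj]
        rw [mul_assoc, mul_assoc, ← pow_succ', ← pow_add]; congr 2; omega
      rw [e1]
      have e2 : cs.simple j * c = cs.simple j * cs.simple i * cs.simple j := by
        rw [hc, mul_assoc]
      rw [e2]
      constructor
      · intro h; rw [← h]; simp only [mul_assoc, cs.simple_mul_simple_cancel_left, cs.simple_mul_simple_self]
        group
      · intro h; rw [h]; simp [mul_assoc]
    ext
    · simp [sgf, hc, pow_succ', mul_assoc]
    · simp only [sgf, h1, h2]
      rw [show 2 * (k + 1) = 2 * k + 1 + 1 by ring, Finset.sum_range_succ, Finset.sum_range_succ]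
      ring

lemma sg_rel (i j : B) : (sg cs i * sg cs j) ^ M i j = 1 := by
  classical
  ext1 ⟨x, e⟩
  rw [sg_pow, cs.simple_mul_simple_pow, two_mul, Finset.sum_range_add]
  simp only [pow_add, cs.simple_mul_simple_pow, one_mul]
  rw [CharTwo.add_self_eq_zero]
  simp

/-- The permutation representation. -/
noncomputable def psi : W →* Equiv.Perm (W × ZMod 2) := cs.lift ⟨sg cs, sg_rel cs⟩

lemma psi_simple (i : B) : psi cs (cs.simple i) = sg cs i := cs.lift_apply_simple (sg_rel cs) i

open Classical in
lemma psi_word (ω : List B) (x : W) (e : ZMod 2) :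
    psi cs (cs.wordProd ω) (x, e) =
      (cs.wordProd ω * x * (cs.wordProd ω)⁻¹, e + ((cs.rightInvSeq ω).count x : ZMod 2)) := by
  induction ω with
  | nil => simp
  | cons i ω ih =>
    rw [cs.wordProd_cons, map_mul, Equiv.Perm.mul_apply, ih, psi_simple, sg_apply]
    have h : cs.wordProd ω * x * (cs.wordProd ω)⁻¹ = cs.simple i ↔
        (cs.wordProd ω)⁻¹ * cs.simple i * cs.wordProd ω = x := by
      constructor
      · intro h; rw [← h]; group
      · intro h; rw [← h]; group
    ext
    · simp [sgf, mul_assoc]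
    · simp only [sgf, h, CoxeterSystem.rightInvSeq, List.count_cons, beq_iff_eq]
      push_cast
      ring

/-- If the parity is odd, then it is in every inversion sequence. -/
lemma mem_of_psi {ω : List B} {x : W} {e : ZMod 2}
    (h : (psi cs (cs.wordProd ω) (x, e)).2 = e + 1) : x ∈ cs.rightInvSeq ω := by
  classical
  rw [psi_word] at h
  by_contra hx
  rw [List.count_eq_zero_of_not_mem hx] at h
  simp at h

lemma lt_of_psi {w x : W} {e : ZMod 2} (h : (psi cs w (x, e)).2 = e + 1) :
    cs.length (w * x) < cs.length w := by
  obtain ⟨ω, hω, rfl⟩ := cs.exists_isReduced w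
  exact (cs.isRightInversion_of_mem_rightInvSeq hω (mem_of_psi cs h)).2

lemma psi_of_lt {w : W} {i : B} (h : cs.length (w * cs.simple i) < cs.length w) :
    (psi cs w (cs.simple i, 0)).2 = 0 + 1 := by
  by_contra h0
  have h0' : (psi cs w (cs.simple i, 0)).2 = 0 := by
    generalize (psi cs w (cs.simple i, 0)).2 = y at h0 ⊢
    revert h0; revert y; decide
  have h1 : (psi cs (w * cs.simple i) (cs.simple i, 1)).2 = 1 + 1 := by
    rw [map_mul, Equiv.Perm.mul_apply, psi_simple, sg_apply]
    have : sgf cs i (cs.simple i, 1) = (cs.simple i, 0) := by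
      simp [sgf]; decide
    rw [this, h0']; decide
  have := lt_of_psi cs h1
  simp at this
  omega

/-- Exchange (right version). -/
lemma exch_right {ω : List B} {i : B}
    (h : cs.length (cs.wordProd ω * cs.simple i) < cs.length (cs.wordProd ω)) :
    cs.simple i ∈ cs.rightInvSeq ω := mem_of_psi cs (psi_of_lt cs h)

lemma exch_left {ω : List B} {i : B}
    (h : cs.length (cs.simple i * cs.wordProd ω) < cs.length (cs.wordProd ω)) :
    ∃ n < ω.length, cs.simple i * cs.wordProd ω = cs.wordProd (ω.eraseIdx n) := by
  have h1 : cs.simple i ∈ cs.rightInvSeq ω.reverse := by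
    apply exch_right
    rw [cs.wordProd_reverse, cs.length_inv, ← cs.length_inv]
    simpa using h
  rw [cs.rightInvSeq_reverse, List.mem_reverse, List.mem_iff_getElem] at h1
  obtain ⟨n, hn, h2⟩ := h1
  refine ⟨n, by simpa using hn, ?_⟩
  rw [← cs.getD_leftInvSeq_mul_wordProd, List.getD_eq_getElem _ _ hn, h2]

/-- standard parabolic subgroup -/
def par (T : Set B) : Subgroup W := Subgroup.closure (cs.simple '' T)

lemma simple_mem {T : Set B} {i : B} (hi : i ∈ T) : cs.simple i ∈ par cs T :=
  Subgroup.subset_closure ⟨i, hi, rfl⟩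

lemma word_mem {T : Set B} {ω : List B} (h : ∀ i ∈ ω, i ∈ T) : cs.wordProd ω ∈ par cs T := by
  induction ω with
  | nil => simp [one_mem]
  | cons i ω ih =>
    rw [cs.wordProd_cons]
    exact mul_mem (simple_mem cs (h i (by simp))) (ih fun j hj => h j (by simp [hj]))

lemma exists_word {T : Set B} {u : W} (hu : u ∈ par cs T) :
    ∃ ω : List B, (∀ i ∈ ω, i ∈ T) ∧ cs.wordProd ω = u := by
  induction hu using Subgroup.closure_induction with
  | mem x hx =>
    obtain ⟨i, hi, rfl⟩ := hx
    exact ⟨[i], by simpa using hi, by simp⟩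
  | one => exact ⟨[], by simp, by simp⟩
  | mul x y _ _ hx hy =>
    obtain ⟨ω, h1, rfl⟩ := hx
    obtain ⟨ω', h2, rfl⟩ := hy
    refine ⟨ω ++ ω', ?_, cs.wordProd_append _ _⟩
    intro i hi
    rcases List.mem_append.1 hi with h | h
    · exact h1 i h
    · exact h2 i h
  | inv x _ hx =>
    obtain ⟨ω, h1, rfl⟩ := hx
    exact ⟨ω.reverse, by simpa using h1, cs.wordProd_reverse ω⟩

lemma exists_red_word_aux {T : Set B} (ω : List B) (h : ∀ i ∈ ω, i ∈ T) :
    ∃ ω' : List B, (∀ i ∈ ω', i ∈ T) ∧ cs.IsReduced ω' ∧ cs.wordProd ω' = cs.wordProd ω := by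
  induction ω with
  | nil => exact ⟨[], by simp, by simp [CoxeterSystem.IsReduced], rfl⟩
  | cons i ω ih =>
    obtain ⟨ω', h1, h2, h3⟩ := ih fun j hj => h j (by simp [hj])
    have h2' := h2.eq
    rcases cs.length_simple_mul (cs.wordProd ω') i with hl | hl
    · refine ⟨i :: ω', ?_, ?_, ?_⟩
      · intro j hj
        rcases List.mem_cons.1 hj with rfl | hj
        · exact h j (by simp)
        · exact h1 j hj
      · rw [CoxeterSystem.IsReduced, cs.wordProd_cons, hl, h2']; simp
      · rw [cs.wordProd_cons, cs.wordProd_cons, h3]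
    · obtain ⟨n, hn, he⟩ := exch_left cs (ω := ω') (i := i) (by omega)
      refine ⟨ω'.eraseIdx n, fun j hj => h1 j (List.mem_of_mem_eraseIdx hj), ?_, ?_⟩
      · rw [CoxeterSystem.IsReduced, ← he]
        have := List.length_eraseIdx_add_one hn
        omega
      · rw [← he, cs.wordProd_cons, h3]

lemma exists_red_word {T : Set B} {u : W} (hu : u ∈ par cs T) :
    ∃ ω : List B, (∀ i ∈ ω, i ∈ T) ∧ cs.IsReduced ω ∧ cs.wordProd ω = u := by
  obtain ⟨ω, h, rfl⟩ := exists_word cs hu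
  exact exists_red_word_aux cs ω h

lemma par_induction {T : Set B} {P : W → Prop} (h1 : P 1)
    (hs : ∀ i ∈ T, ∀ u ∈ par cs T, P u → cs.length (cs.simple i * u) = cs.length u + 1 →
      P (cs.simple i * u)) {u : W} (hu : u ∈ par cs T) : P u := by
  obtain ⟨ω, h, hr, rfl⟩ := exists_red_word cs hu
  clear hu
  induction ω with
  | nil => simpa using h1
  | cons i ω ih =>
    have hr' : cs.IsReduced ω := by simpa using hr.drop 1
    have hω : ∀ j ∈ ω, j ∈ T := fun j hj => h j (by simp [hj])
    rw [cs.wordProd_cons]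
    apply hs i (h i (by simp)) _ (word_mem cs hω) (ih hω hr')
    rw [← cs.wordProd_cons, hr.eq, hr'.eq]; simp

/-- Exchange for a product. -/
lemma split {T : Set B} {i : B} {u v : W} (hv : v ∈ par cs T)
    (h : cs.length (cs.simple i * (u * v)) < cs.length (u * v)) :
    cs.length (cs.simple i * u) < cs.length u ∨
      ∃ v' ∈ par cs T, cs.length v' < cs.length v ∧ cs.simple i * (u * v) = u * v' := by
  obtain ⟨ω, h1, h2, rfl⟩ := exists_red_word cs hv
  obtain ⟨ν, h3, rfl⟩ := cs.exists_isReduced u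
  rw [← cs.wordProd_append] at h
  obtain ⟨n, hn, he⟩ := exch_left cs h
  have h2' := h2.eq
  have h3' := h3.eq
  by_cases hnν : n < ν.length
  · left
    rw [List.eraseIdx_append_of_lt_length hnν, cs.wordProd_append, cs.wordProd_append,
      ← mul_assoc] at he
    rw [mul_right_cancel he]
    have := cs.length_wordProd_le (ν.eraseIdx n)
    have := List.length_eraseIdx_add_one hnν
    omega
  · right
    rw [List.eraseIdx_append_of_length_le (by omega), cs.wordProd_append, cs.wordProd_append] at he
    refine ⟨_, word_mem cs fun j hj => h1 j (List.mem_of_mem_eraseIdx hj), ?_, he⟩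
    have := cs.length_wordProd_le (ω.eraseIdx (n - ν.length))
    rw [List.length_append] at hn
    have := List.length_eraseIdx_add_one (l := ω) (i := n - ν.length) (by omega)
    omega

lemma mem_univ (u : W) : u ∈ par cs Set.univ := by
  rw [par, Set.image_univ, cs.subgroup_closure_range_simple]; trivial

lemma add_left {T : Set B} {d : W} (hd : ∀ u ∈ par cs T, cs.length d ≤ cs.length (u * d))
    {u : W} (hu : u ∈ par cs T) : cs.length (u * d) = cs.length u + cs.length d := by
  refine par_induction cs (P := fun u => cs.length (u * d) = cs.length u + cs.length d) ?_ ?_ hu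
  · simp
  · intro i hi u hu ih hl
    rw [mul_assoc, hl]
    rcases cs.length_simple_mul (u * d) i with h | h
    · omega
    · exfalso
      rcases split cs (mem_univ cs d) (i := i) (u := u) (by omega) with h' | ⟨v, -, hv, he⟩
      · omega
      · have := hd (u⁻¹ * cs.simple i * u) (mul_mem (mul_mem (inv_mem hu) (simple_mem cs hi)) hu)
        rw [mul_assoc, mul_assoc, he, inv_mul_cancel_left] at this
        omega

lemma add_right {T : Set B} {d : W} (hd : ∀ u ∈ par cs T, cs.length d ≤ cs.length (d * u))
    {u : W} (hu : u ∈ par cs T) : cs.length (d * u) = cs.length d + cs.length u := by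
  have := add_left cs (T := T) (d := d⁻¹) (fun u hu => by
    have := hd _ (inv_mem hu)
    rw [cs.length_inv, ← cs.length_inv (u * d⁻¹)]; simpa using this) (inv_mem hu)
  rw [← mul_inv_rev, cs.length_inv, cs.length_inv, cs.length_inv] at this
  omega

lemma finite_of_descents [Finite B] {T : Set B} {z : W}
    (hz : ∀ i ∈ T, cs.length (cs.simple i * z) < cs.length z) :
    (par cs T : Set W).Finite := by
  have key : ∀ u ∈ par cs T, cs.length z = cs.length u + cs.length (u⁻¹ * z) := by
    intro u hu
    refine par_induction cs
      (P := fun u => cs.length z = cs.length u + cs.length (u⁻¹ * z)) ?_ ?_ hu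
    · simp
    · intro i hi u hu ih hl
      have hzi := hz i hi
      have hzz : u * (u⁻¹ * z) = z := by group
      rcases split cs (mem_univ cs (u⁻¹ * z)) (i := i) (u := u) (by rwa [hzz]) with
        h' | ⟨v, -, hv, he⟩
      · omega
      · have hv' : (cs.simple i * u)⁻¹ * z = v := by
          rw [hzz] at he
          rw [mul_inv_rev, cs.inv_simple, mul_assoc, he]; group
        have hzv : z = cs.simple i * u * v := by rw [← hv']; group
        have := cs.length_mul_le (cs.simple i * u) v
        rw [← hzv] at this
        rw [hv']
        omega
  have hf := (List.finite_length_le B (cs.length z)).image cs.wordProd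
  apply hf.subset
  intro u hu
  obtain ⟨ω, h1, rfl⟩ := cs.exists_isReduced u
  refine ⟨ω, ?_, rfl⟩
  have := key _ hu
  have := h1.eq
  simp only [Set.mem_ofPred_eq]
  omega

end Exchange

section Main

variable [Finite B] (cs : CoxeterSystem M W)

lemma longest_desc {s t : B} (hst : s ≠ t) {m : ℕ} (hm : M s t = 2 * m) (hm0 : m ≠ 0) :
    cs.length ((cs.simple s * cs.simple t) ^ m * cs.simple s) <
      cs.length ((cs.simple s * cs.simple t) ^ m) ∧
    cs.length ((cs.simple s * cs.simple t) ^ m * cs.simple t) <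
      cs.length ((cs.simple s * cs.simple t) ^ m) := by
  classical
  have hc : (cs.simple s * cs.simple t) ^ (2 * m) = 1 := by
    rw [← hm]; exact cs.simple_mul_simple_pow s t
  have hne : ∀ k, 0 < k → k < 2 * m → (cs.simple s * cs.simple t) ^ k ≠ 1 :=
    fun k h1 h2 => pow_ne cs hst h1 (by omega)
  constructor
  · apply lt_of_psi cs (e := 0)
    rw [map_pow, map_mul, psi_simple, psi_simple, sg_pow]
    have hiff : ∀ n, cs.simple s = cs.simple t * (cs.simple s * cs.simple t) ^ n ↔
        (cs.simple s * cs.simple t) ^ (n + 1) = 1 := by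
      intro n
      rw [pow_succ']
      constructor
      · intro h
        rw [mul_assoc, ← h]; simp
      · intro h
        rw [mul_assoc] at h
        have := congrArg (fun y => cs.simple s * y) h
        simpa using this.symm
    simp only [hiff]
    rw [Finset.sum_eq_single (2 * m - 1)]
    · rw [Nat.sub_add_cancel (by omega), if_pos hc]
    · intro n hn hn'
      rw [Finset.mem_range] at hn
      exact if_neg (hne _ (by omega) (by omega))
    · intro h; exact absurd (Finset.mem_range.2 (by omega)) h
  · apply lt_of_psi cs (e := 0)
    rw [map_pow, map_mul, psi_simple, psi_simple, sg_pow]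
    rw [Finset.sum_eq_single 0]
    · simp
    · intro n hn hn'
      rw [Finset.mem_range] at hn
      apply if_neg
      intro h
      exact hne n (by omega) hn (mul_eq_left.1 h.symm)
    · intro h; exact absurd (Finset.mem_range.2 (by omega)) h

lemma longest_comm {s t : B} {m : ℕ} (hm : M s t = 2 * m) :
    ∀ u ∈ par cs {s, t}, u * (cs.simple s * cs.simple t) ^ m =
      (cs.simple s * cs.simple t) ^ m * u := by
  have hc : ((cs.simple s * cs.simple t) ^ m)⁻¹ = (cs.simple s * cs.simple t) ^ m := by
    rw [inv_eq_iff_mul_eq_one, ← pow_add, ← two_mul, ← hm]; exact cs.simple_mul_simple_pow s t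
  have ht := simple_mul_pow_inv cs s t m
  rw [hc] at ht
  have hs : cs.simple s * (cs.simple s * cs.simple t) ^ m =
      (cs.simple s * cs.simple t) ^ m * cs.simple s := by
    have h1 : cs.simple s = (cs.simple s * cs.simple t) * cs.simple t := by simp
    have h2 : (cs.simple s * cs.simple t) ^ m * cs.simple s =
      (cs.simple s * cs.simple t) ^ m * ((cs.simple s * cs.simple t) * cs.simple t) := by
      rw [← h1]
    rw [h2, ← mul_assoc, ← pow_succ, pow_succ', mul_assoc, ht, ← mul_assoc, ← h1]
  intro u hu
  have hle : par cs {s, t} ≤ Subgroup.centralizer {(cs.simple s * cs.simple t) ^ m} := by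
    rw [par, Subgroup.closure_le]
    rintro _ ⟨i, hi, rfl⟩
    rw [SetLike.mem_coe, Subgroup.mem_centralizer_singleton_iff]
    rcases hi with rfl | rfl
    · exact hs
    · exact ht.symm
  exact Subgroup.mem_centralizer_singleton_iff.1 (hle hu)

/-- Given a double coset minimal `d`, generators in the first pair are conjugated to generators. -/
lemma conj_simple {T U : Set B} {d w0 v : W}
    (hl : ∀ u ∈ par cs T, cs.length d ≤ cs.length (u * d))
    (hr : ∀ u ∈ par cs U, cs.length d ≤ cs.length (d * u))
    (hw0 : w0 ∈ par cs T) (hv : v ∈ par cs U) (he : w0 * d = d * v)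
    {i : B} (hi : i ∈ T) (hdesc : cs.length (cs.simple i * w0) < cs.length w0) :
    ∃ j ∈ U, cs.simple i * d = d * cs.simple j := by
  have hil := simple_mem cs hi
  have e1 := add_left cs hl hw0
  have e2 := add_left cs hl (mul_mem hil hw0)
  have e3 := add_left cs hl hil
  rw [cs.length_simple] at e3
  have hlt : cs.length (cs.simple i * (d * v)) < cs.length (d * v) := by
    rw [← he, ← mul_assoc]; omega
  rcases split cs hv hlt with h | ⟨v', hv', -, h⟩
  · omega
  · have hr' : v' * v⁻¹ ∈ par cs U := mul_mem hv' (inv_mem hv)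
    have hd : cs.simple i * d = d * (v' * v⁻¹) := by
      rw [← mul_assoc, ← h]; group
    have e4 := add_right cs hr hr'
    rw [← hd, e3] at e4
    obtain ⟨ω, h1, h2, h3⟩ := exists_red_word cs hr'
    have h2' := h2.eq
    rw [h3] at h2'
    have hlen : ω.length = 1 := by omega
    obtain ⟨j, rfl⟩ := List.length_eq_one_iff.1 hlen
    refine ⟨j, h1 j (by simp), ?_⟩
    rw [hd, ← h3]; simp

lemma main (hdim : ∀ T : Set B, 2 < T.ncard →
      (Subgroup.closure (cs.simple '' T) : Set W).Infinite)
    {s t a b : B} (hst : s ≠ t) (hab : a ≠ b) {m : ℕ} (hm : M s t = 2 * m) (hm0 : m ≠ 0)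
    {g : W} (hg : g⁻¹ * (cs.simple s * cs.simple t) ^ m * g ∈ par cs {a, b}) :
    ({s, t} : Set B) = {a, b} ∧ g ∈ par cs {a, b} := by
  classical
  set w0 := (cs.simple s * cs.simple t) ^ m with hw0
  have hs : s ∈ ({s, t} : Set B) := by simp
  have ht : t ∈ ({s, t} : Set B) := by simp
  have hw0m : w0 ∈ par cs {s, t} :=
    pow_mem (mul_mem (simple_mem cs hs) (simple_mem cs ht)) m
  have hcomm := longest_comm cs hm
  rw [← hw0] at hcomm
  obtain ⟨ds, dt⟩ := longest_desc cs hst hm hm0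
  rw [← hw0] at ds dt
  -- a minimal element of the double coset
  let D : Set W := {d | ∃ p ∈ par cs {s, t}, ∃ q ∈ par cs {a, b}, d = p * g * q}
  have hD : D.Nonempty := ⟨g, 1, one_mem _, 1, one_mem _, by simp⟩
  obtain ⟨d, hdD, hmin⟩ := exists_minimalFor_of_wellFoundedLT (· ∈ D) cs.length hD
  have hmin' : ∀ y ∈ D, cs.length d ≤ cs.length y := by
    intro y hy
    by_contra hlt
    have := hmin hy (by omega)
    omega
  obtain ⟨p, hp, q, hq, hd⟩ := hdD
  have hl : ∀ u ∈ par cs {s, t}, cs.length d ≤ cs.length (u * d) := fun u hu =>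
    hmin' _ ⟨u * p, mul_mem hu hp, q, hq, by rw [hd]; group⟩
  have hr : ∀ u ∈ par cs {a, b}, cs.length d ≤ cs.length (d * u) := fun u hu =>
    hmin' _ ⟨p, hp, q * u, mul_mem hq hu, by rw [hd]; group⟩
  have hv : d⁻¹ * w0 * d ∈ par cs {a, b} := by
    have : d⁻¹ * w0 * d = q⁻¹ * (g⁻¹ * w0 * g) * q := by
      have h1 : p⁻¹ * w0 * p = w0 := by rw [hcomm _ (inv_mem hp)]; group
      calc d⁻¹ * w0 * d = q⁻¹ * (g⁻¹ * (p⁻¹ * w0 * p) * g) * q := by rw [hd]; group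
        _ = _ := by rw [h1]
    rw [this]
    exact mul_mem (mul_mem (inv_mem hq) hg) hq
  have he : w0 * d = d * (d⁻¹ * w0 * d) := by group
  have ds' : cs.length (cs.simple s * w0) < cs.length w0 := by
    rw [hcomm _ (simple_mem cs hs)]; exact ds
  have dt' : cs.length (cs.simple t * w0) < cs.length w0 := by
    rw [hcomm _ (simple_mem cs ht)]; exact dt
  obtain ⟨a', ha', hsa⟩ := conj_simple cs hl hr hw0m hv he hs ds'
  obtain ⟨b', hb', htb⟩ := conj_simple cs hl hr hw0m hv he ht dt'
  have hab' : a' ≠ b' := by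
    rintro rfl
    rw [← htb] at hsa
    exact hst (simple_inj cs (mul_right_cancel hsa))
  have e1 := add_left cs hl hw0m
  have hd1 : d = 1 := by
    by_contra hne
    obtain ⟨r, hrd⟩ := cs.exists_rightDescent_of_ne_one hne
    rw [CoxeterSystem.IsRightDescent] at hrd
    have hra : r ≠ a' := by
      rintro rfl
      rw [← hsa, add_left cs hl (simple_mem cs hs)] at hrd
      omega
    have hrb : r ≠ b' := by
      rintro rfl
      rw [← htb, add_left cs hl (simple_mem cs ht)] at hrd
      omega
    have hdesc : ∀ i ∈ ({a', b', r} : Set B),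
        cs.length (cs.simple i * (w0 * d)⁻¹) < cs.length (w0 * d)⁻¹ := by
      intro i hi
      rw [cs.length_inv, ← cs.length_inv (cs.simple i * (w0 * d)⁻¹), mul_inv_rev, inv_inv,
        cs.inv_simple, mul_assoc]
      rcases hi with rfl | rfl | rfl
      · rw [← hsa, ← mul_assoc, add_left cs hl (mul_mem hw0m (simple_mem cs hs))]
        omega
      · rw [← htb, ← mul_assoc, add_left cs hl (mul_mem hw0m (simple_mem cs ht))]
        omega
      · have := cs.length_mul_le w0 (d * cs.simple i)
        omega
    refine hdim {a', b', r} ?_ (finite_of_descents cs hdesc)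
    rw [Set.ncard_eq_three.2 ⟨a', b', r, hab', hra.symm, hrb.symm, rfl⟩]
    omega
  rw [hd1, mul_one, one_mul] at hsa htb
  obtain rfl := simple_inj cs hsa
  obtain rfl := simple_inj cs htb
  have hset : ({s, t} : Set B) = {a, b} := by
    rcases ha' with rfl | rfl <;> rcases hb' with rfl | rfl
    · exact absurd rfl hst
    · rfl
    · exact Set.pair_comm _ _
    · exact absurd rfl hst
  refine ⟨hset, ?_⟩
  rw [hset] at hp
  have : g = p⁻¹ * q⁻¹ := by
    rw [hd1] at hd
    have : g = p⁻¹ * (p * g * q) * q⁻¹ := by group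
    rw [this, ← hd]; group
  rw [this]
  exact mul_mem (inv_mem hp) (inv_mem hq)

end Main

end CoxAux

/-- Lemma 3.2 of the paper: in a Coxeter system with two-dimensional Davis–Vinberg complex,
if `m(s,t)` is even, `m(a,b)` is finite and `w(st)^m w⁻¹ ∈ x W_{{a,b}} x⁻¹` where
`m = m(s,t)/2`, then `w W_{{s,t}} w⁻¹ = x W_{{a,b}} x⁻¹` and `{s,t} = {a,b}`. -/
theorem stmt_15 {B : Type*} {W : Type*} [Group W] [Finite B] {M : CoxeterMatrix B}
    (cs : CoxeterSystem M W)
    (hdim : ∀ T : Set B, 2 < T.ncard → (Subgroup.closure (cs.simple '' T) : Set W).Infinite)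
    (s t a b : B) (w x : W) (hst : s ≠ t) (hab : a ≠ b)
    (heven : Even (M s t)) (hfin : M s t ≠ 0) (hfin' : M a b ≠ 0)
    (h : w * (cs.simple s * cs.simple t) ^ (M s t / 2) * w⁻¹ ∈
      (Subgroup.closure (cs.simple '' {a, b})).map (MulAut.conj x).toMonoidHom) :
    (Subgroup.closure (cs.simple '' {s, t})).map (MulAut.conj w).toMonoidHom =
      (Subgroup.closure (cs.simple '' {a, b})).map (MulAut.conj x).toMonoidHom ∧
    ({s, t} : Set B) = {a, b} := by
  obtain ⟨k, hk⟩ := heven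
  have hm : M s t = 2 * k := by omega
  have hk2 : M s t / 2 = k := by omega
  rw [hk2] at h
  obtain ⟨u, hu, hue⟩ := Subgroup.mem_map.1 h
  have hue' : x * u * x⁻¹ = w * (cs.simple s * cs.simple t) ^ k * w⁻¹ := by
    simpa using hue
  have hg : (w⁻¹ * x)⁻¹ * (cs.simple s * cs.simple t) ^ k * (w⁻¹ * x) ∈ CoxAux.par cs {a, b} := by
    have : (w⁻¹ * x)⁻¹ * (cs.simple s * cs.simple t) ^ k * (w⁻¹ * x) =
        x⁻¹ * (w * (cs.simple s * cs.simple t) ^ k * w⁻¹) * x := by group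
    rw [this, ← hue']
    have h2 : x⁻¹ * (x * u * x⁻¹) * x = u := by group
    rw [h2]
    exact hu
  obtain ⟨h1, h2⟩ := CoxAux.main cs hdim hst hab hm (by omega) hg
  refine ⟨?_, h1⟩
  rw [h1]
  change (CoxAux.par cs {a, b}).map _ = (CoxAux.par cs {a, b}).map _
  ext y
  simp only [Subgroup.mem_map, MulEquiv.coe_toMonoidHom, MulAut.conj_apply]
  constructor
  · rintro ⟨z, hz, rfl⟩
    exact ⟨(w⁻¹ * x)⁻¹ * z * (w⁻¹ * x), mul_mem (mul_mem (inv_mem h2) hz) h2, by group⟩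
  · rintro ⟨z, hz, rfl⟩
    exact ⟨(w⁻¹ * x) * z * (w⁻¹ * x)⁻¹, mul_mem (mul_mem h2 hz) (inv_mem h2), by group⟩
end

section
/- Let (W,S) and (W',S') be Coxeter systems whose parabolic subgroups on any subset of more than 2 generators are infinite (two-dimensional Davis–Vinberg complexes), and let φ: W → W' be a group isomorphism. If s ∈ S and φ(s) is not a reflection of (W',S'), then there exist unique t ∈ S and s',t' ∈ S' and some w' ∈ W' such that: m(s,t) = 2; m(s,u) = ∞ for all u ∈ S \ {s,t}; φ(W_{{s,t}}) = w' W'_{{s',t'}} (w')⁻¹; m'(s',t') = 2; m'(s',u') = ∞ for all u' ∈ S' \ {s',t'}; φ(s) = w' s't' (w')⁻¹; and φ(t) = w' t' (w')⁻¹. -/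
namespace Cox17
open CoxeterSystem

section
variable {B W : Type*} [Group W] {M : CoxeterMatrix B} (cs : CoxeterSystem M W)

/-! ### The sign representation and the exchange property -/

open Classical in
/-- The action of a simple reflection on `W × ZMod 2`. -/
noncomputable def sgn (i : B) : Function.End (W × ZMod 2) := fun p =>
  (cs.simple i * p.1 * cs.simple i, p.2 + if p.1 = cs.simple i then 1 else 0)

open Classical in
theorem sgn_pow (i j : B) (k : ℕ) (t : W) (e : ZMod 2) :
    ((sgn cs i * sgn cs j) ^ k) (t, e) =
      ((cs.simple i * cs.simple j) ^ k * t * ((cs.simple i * cs.simple j) ^ k)⁻¹,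
        e + ∑ n ∈ Finset.range (2 * k),
          if t = cs.simple j * (cs.simple i * cs.simple j) ^ n then 1 else 0) := by
  have key : ∀ k : ℕ, ((cs.simple i * cs.simple j) ^ k)⁻¹ * cs.simple j =
      cs.simple j * (cs.simple i * cs.simple j) ^ k := by
    intro k
    induction k with
    | zero => simp
    | succ k ih =>
      rw [pow_succ, mul_inv_rev, mul_assoc, ih, ← pow_succ, pow_succ']
      simp [mul_assoc]
  induction k with
  | zero => simp; rfl
  | succ k ih =>
    rw [pow_succ']
    change sgn cs i (sgn cs j (((sgn cs i * sgn cs j) ^ k) (t, e))) = _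
    rw [ih]
    set x := cs.simple i * cs.simple j with hx
    have h1 : (x ^ k * t * (x ^ k)⁻¹ = cs.simple j) ↔ t = cs.simple j * x ^ (2 * k) := by
      rw [two_mul, pow_add, ← mul_assoc, ← key k]
      constructor
      · intro h; rw [← h]; group
      · intro h; rw [h]; group
    have h2 : (cs.simple j * (x ^ k * t * (x ^ k)⁻¹) * cs.simple j = cs.simple i) ↔
        t = cs.simple j * x ^ (2 * k + 1) := by
      have : cs.simple j * x ^ (2 * k + 1) =
          (x ^ k)⁻¹ * (cs.simple j * cs.simple i * cs.simple j) * x ^ k := by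
        have e1 : 2 * k + 1 = k + 1 + k := by omega
        rw [e1, pow_add, pow_succ, ← mul_assoc, ← mul_assoc, ← key k, hx]
        simp only [mul_assoc]
      rw [this]
      constructor
      · intro h; rw [← h]; simp [mul_assoc]
      · intro h; rw [h]; simp [mul_assoc]
    simp only [sgn]
    ext
    · simp only [pow_succ', mul_inv_rev, hx, mul_assoc, inv_simple]
    · simp only [h1, h2]
      rw [show 2 * (k + 1) = 2 * k + 1 + 1 by ring, Finset.sum_range_succ, Finset.sum_range_succ]
      ring

theorem sgn_liftable : M.IsLiftable (sgn cs) := by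
  classical
  intro i j
  funext p
  obtain ⟨t, e⟩ := p
  rw [sgn_pow, two_mul, Finset.sum_range_add]
  simp only [pow_add, simple_mul_simple_pow, one_mul, inv_one, mul_one]
  rw [← two_mul, show (2 : ZMod 2) = 0 from rfl]
  simp; rfl

/-- The sign representation. -/
noncomputable def sgnHom : W →* Function.End (W × ZMod 2) := cs.lift ⟨sgn cs, sgn_liftable cs⟩

open Classical in
theorem sgnHom_wordProd (ω : List B) (t : W) (e : ZMod 2) :
    sgnHom cs (cs.wordProd ω) (t, e) =
      (cs.wordProd ω * t * (cs.wordProd ω)⁻¹, e + ((cs.rightInvSeq ω).count t : ZMod 2)) := by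
  induction ω with
  | nil => simp; rfl
  | cons i ω ih =>
    rw [wordProd_cons, map_mul]
    change sgnHom cs (cs.simple i) (sgnHom cs (cs.wordProd ω) (t, e)) = _
    rw [ih]
    have : sgnHom cs (cs.simple i) = sgn cs i := cs.lift_apply_simple (sgn_liftable cs) i
    rw [this]
    simp only [sgn, rightInvSeq, List.count_cons]
    ext
    · simp [mul_assoc]
    · have : (cs.wordProd ω * t * (cs.wordProd ω)⁻¹ = cs.simple i) ↔
        (cs.wordProd ω)⁻¹ * cs.simple i * cs.wordProd ω = t := by
        constructor
        · intro h; rw [← h]; group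
        · intro h; rw [← h]; group
      simp only [this, beq_iff_eq]
      push_cast
      ring

theorem exchange (ω : List B) (r : B)
    (h : cs.length (cs.wordProd ω * cs.simple r) < cs.length (cs.wordProd ω)) :
    ∃ j < ω.length, cs.wordProd ω * cs.simple r = cs.wordProd (ω.eraseIdx j) := by
  classical
  obtain ⟨ω', hred, hω'⟩ := cs.exists_isReduced (cs.wordProd ω * cs.simple r)
  have hprod : cs.wordProd (ω' ++ [r]) = cs.wordProd ω := by
    rw [wordProd_append, ← hω']; simp
  have hred2 : cs.IsReduced (ω' ++ [r]) := by
    have h1 := cs.length_mul_simple (cs.wordProd ω) r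
    have h2 : cs.length (cs.wordProd ω') = ω'.length := hred
    rw [CoxeterSystem.IsReduced, hprod]
    rw [← hω'] at h2
    simp
    omega
  have hmem : cs.simple r ∈ cs.rightInvSeq (ω' ++ [r]) := by
    have := cs.rightInvSeq_concat ω' r
    rw [List.concat_eq_append] at this
    rw [this]; simp
  have hc : (cs.rightInvSeq (ω' ++ [r])).count (cs.simple r) = 1 :=
    List.count_eq_one_of_mem hred2.nodup_rightInvSeq hmem
  have e1 := sgnHom_wordProd cs (ω' ++ [r]) (cs.simple r) 0
  have e2 := sgnHom_wordProd cs ω (cs.simple r) 0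
  rw [hprod, e2, hc] at e1
  have e3 := congrArg Prod.snd e1
  have hm : cs.simple r ∈ cs.rightInvSeq ω := by
    by_contra hn
    rw [List.count_eq_zero_of_not_mem hn] at e3
    simp at e3
  obtain ⟨j, hj, hj2⟩ := List.getElem_of_mem hm
  refine ⟨j, by simpa using hj, ?_⟩
  rw [← cs.wordProd_mul_getD_rightInvSeq, List.getD_eq_getElem _ _ hj, hj2]

theorem exch (a b : W) (r : B) (h : cs.length (a * b * cs.simple r) < cs.length (a * b)) :
    cs.length (b * cs.simple r) < cs.length b ∨
      ∃ a', a * b * cs.simple r = a' * b ∧ cs.length a' < cs.length a := by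
  obtain ⟨α, ha, rfl⟩ := cs.exists_isReduced a
  obtain ⟨β, hb, rfl⟩ := cs.exists_isReduced b
  rw [← wordProd_append] at h
  obtain ⟨j, hj, he⟩ := exchange cs _ r h
  rw [ha.eq, hb.eq]
  by_cases hja : j < α.length
  · right
    rw [List.eraseIdx_append_of_lt_length hja, wordProd_append, wordProd_append] at he
    refine ⟨_, he, ?_⟩
    have := cs.length_wordProd_le (α.eraseIdx j)
    rw [List.length_eraseIdx_of_lt hja] at this
    omega
  · left
    rw [List.eraseIdx_append_of_length_le (by omega), wordProd_append, wordProd_append, mul_assoc,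
      mul_right_inj] at he
    rw [he]
    have hj2 : j - α.length < β.length := by simp at hj; omega
    have := cs.length_wordProd_le (β.eraseIdx (j - α.length))
    rw [List.length_eraseIdx_of_lt hj2] at this
    omega
end


section
variable {B W : Type*} [Group W] {M : CoxeterMatrix B} (cs : CoxeterSystem M W)

/-! ### The geometric representation and orders of products of two generators -/

/-- Coroot functionals of the geometric representation. -/
noncomputable def coroot (M : CoxeterMatrix B) (i : B) : Module.Dual ℝ (B →₀ ℝ) :=
  Finsupp.linearCombination ℝ (fun j => -2 * Real.cos (Real.pi / M i j))

theorem coroot_single (M : CoxeterMatrix B) (i j : B) :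
    coroot M i (Finsupp.single j 1) = -2 * Real.cos (Real.pi / M i j) := by
  simp [coroot]

theorem coroot_self (M : CoxeterMatrix B) (i : B) : coroot M i (Finsupp.single i 1) = 2 := by
  rw [coroot_single]; simp

/-- Reflections of the geometric representation. -/
noncomputable def refl (M : CoxeterMatrix B) (i : B) : (B →₀ ℝ) ≃ₗ[ℝ] (B →₀ ℝ) :=
  Module.reflection (coroot_self M i)

theorem trace_eq (M : CoxeterMatrix B) (i j : B) :
    2 * Real.cos (2 * (Real.pi / M i j)) =
      coroot M i (Finsupp.single j 1) * coroot M j (Finsupp.single i 1) - 2 := by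
  rw [coroot_single, coroot_single, M.symmetric j i, Real.cos_two_mul]
  ring

theorem refl_liftable (M : CoxeterMatrix B) : M.IsLiftable (refl M) := by
  intro i j
  by_cases hij : i = j
  · subst hij
    simp only [CoxeterMatrix.diagonal, pow_one]
    ext1 z
    exact Module.involutive_reflection (coroot_self M i) z
  by_cases h0 : M i j = 0
  · simp [h0]
  have h1 : M i j ≠ 1 := M.off_diagonal i j hij
  apply LinearEquiv.toLinearMap_injective
  rw [refl, refl, Module.reflection_mul_reflection_pow (coroot_self M i) (coroot_self M j) (M i j)
    (2 * Real.cos (2 * (Real.pi / M i j))) (trace_eq M i j)]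
  by_cases h2 : M i j = 2
  · have e : (2 * Real.cos (2 * (Real.pi / M i j))) = -2 := by
      rw [h2, show 2 * (Real.pi / (2 : ℕ)) = Real.pi by push_cast; ring]; simp
    have e1 : coroot M i (Finsupp.single j 1) = 0 := by
      rw [coroot_single, h2]; simp
    have e2 : coroot M j (Finsupp.single i 1) = 0 := by
      rw [coroot_single, M.symmetric j i, h2]; simp
    rw [e, e1, e2, h2]
    norm_num
    refine LinearMap.ext fun z => ?_
    simp
    abel
  have h3 : 3 ≤ M i j := by omega
  have h3' : (3 : ℝ) ≤ M i j := by exact_mod_cast h3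
  set m := M i j with hm
  set θ := 2 * (Real.pi / m) with hθ
  have hmθ : (m : ℝ) * θ = 2 * Real.pi := by
    rw [hθ]; field_simp
  have hsin : Real.sin θ ≠ 0 := by
    apply ne_of_gt
    apply Real.sin_pos_of_pos_of_lt_pi
    · have := Real.pi_pos; positivity
    · have := Real.pi_pos
      nlinarith
  have hS : ∀ n : ℤ, (Polynomial.Chebyshev.S ℝ n).eval (2 * Real.cos θ) =
      Real.sin ((n + 1) * θ) / Real.sin θ := by
    intro n
    rw [eq_div_iff hsin, Polynomial.Chebyshev.S_two_mul_real_cos]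
  rcases Nat.even_or_odd m with ⟨k, hk⟩ | ⟨k, hk⟩
  · have hz : (Polynomial.Chebyshev.S ℝ ((k : ℤ) - 1)).eval (2 * Real.cos θ) = 0 := by
      rw [hS]
      have : (((k : ℤ) - 1 : ℤ) + 1 : ℝ) * θ = Real.pi := by
        push_cast
        rw [hk] at hmθ; push_cast at hmθ; linarith
      rw [this]; simp
    have a1 : ((m : ℤ) - 2) / 2 = (k : ℤ) - 1 := by omega
    have a2 : ((m : ℤ) - 1) / 2 = (k : ℤ) - 1 := by omega
    rw [a1, a2, hz]
    ext1 z
    simp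
  · have hz : (Polynomial.Chebyshev.S ℝ (k : ℤ)).eval (2 * Real.cos θ) +
        (Polynomial.Chebyshev.S ℝ ((k : ℤ) - 1)).eval (2 * Real.cos θ) = 0 := by
      rw [hS, hS]
      have : (((k : ℤ) : ℝ) + 1) * θ = 2 * Real.pi - k * θ := by
        push_cast
        rw [hk] at hmθ; push_cast at hmθ; linarith
      rw [this, Real.sin_two_pi_sub]; push_cast; ring_nf
    have a1 : ((m : ℤ) - 2) / 2 = (k : ℤ) - 1 := by omega
    have a2 : ((m : ℤ) - 1) / 2 = (k : ℤ) := by omega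
    have a3 : ((m : ℤ) - 3) / 2 = (k : ℤ) - 1 := by omega
    have a4 : (m : ℤ) / 2 = (k : ℤ) := by omega
    rw [a1, a2, a3, a4, hz]
    ext1 z
    simp

theorem pow_consequence (i j : B) (hij : i ≠ j) (k : ℕ)
    (h : (cs.simple i * cs.simple j) ^ k = 1) :
    (Polynomial.Chebyshev.S ℝ (k - 1)).eval (2 * Real.cos (2 * (Real.pi / M i j))) *
      Real.cos (Real.pi / M i j) = 0 ∧
    (Polynomial.Chebyshev.S ℝ k).eval (2 * Real.cos (2 * (Real.pi / M i j))) +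
    (Polynomial.Chebyshev.S ℝ (k - 1)).eval (2 * Real.cos (2 * (Real.pi / M i j))) = 1 := by
  have h1 := congrArg (cs.lift ⟨refl M, refl_liftable M⟩) h
  rw [map_pow, map_mul, map_one, lift_apply_simple, lift_apply_simple] at h1
  have h2 := Module.reflection_mul_reflection_pow_apply_self (coroot_self M i) (coroot_self M j) k
    (2 * Real.cos (2 * (Real.pi / M i j))) (trace_eq M i j)
  change ((refl M i * refl M j) ^ k) _ = _ at h2
  rw [h1] at h2
  have hi := DFunLike.congr_fun h2 i
  have hj := DFunLike.congr_fun h2 j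
  simp [hij, hij.symm, coroot_single, M.symmetric j i] at hi hj
  refine ⟨?_, hi.symm⟩
  rcases hj with hj | hj <;> simp [hj]

theorem ne_zero_of_pow (i j : B) (hij : i ≠ j) (k : ℕ) (hk : k ≠ 0)
    (h : (cs.simple i * cs.simple j) ^ k = 1) : M i j ≠ 0 := by
  intro h0
  have := (pow_consequence cs i j hij k h).1
  rw [h0] at this
  simp at this
  exact hk this

theorem eq_two_of_commute (i j : B) (hij : i ≠ j)
    (h : cs.simple i * cs.simple j = cs.simple j * cs.simple i) : M i j = 2 := by
  have h2 : (cs.simple i * cs.simple j) ^ 2 = 1 := by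
    rw [pow_two]; nth_rewrite 2 [h]; simp [mul_assoc]
  have h0 := ne_zero_of_pow cs i j hij 2 (by norm_num) h2
  have h1 : M i j ≠ 1 := M.off_diagonal i j hij
  by_contra hne
  have h3 : 3 ≤ M i j := by omega
  have h3' : (3 : ℝ) ≤ M i j := by exact_mod_cast h3
  obtain ⟨e1, e2⟩ := pow_consequence cs i j hij 2 h2
  have hcos : Real.cos (Real.pi / M i j) ≠ 0 := by
    apply ne_of_gt
    apply Real.cos_pos_of_mem_Ioo
    have := Real.pi_pos
    constructor
    · have : 0 < Real.pi / M i j := by positivity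
      linarith
    · rw [div_lt_div_iff_of_pos_left] <;> linarith
  norm_num [hcos] at e1 e2
  rw [e1, Polynomial.Chebyshev.S_two] at e2
  norm_num at e2
end


section
variable {B W : Type*} [Group W] {M : CoxeterMatrix B} (cs : CoxeterSystem M W)

/-! ### Parabolic subgroups -/

/-- The standard parabolic subgroup. -/
def Par (D : Set B) : Subgroup W := Subgroup.closure (cs.simple '' D)

/-- The right descent set. -/
def desc (g : W) : Set B := {d | cs.length (g * cs.simple d) < cs.length g}

theorem simple_mem {D : Set B} {d : B} (h : d ∈ D) : cs.simple d ∈ Par cs D :=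
  Subgroup.subset_closure ⟨d, h, rfl⟩

theorem par_induction {D : Set B} {P : W → Prop} (h1 : P 1)
    (hm : ∀ x ∈ Par cs D, ∀ d ∈ D, P x → P (x * cs.simple d)) {x : W} (hx : x ∈ Par cs D) : P x := by
  induction hx using Subgroup.closure_induction_right with
  | one => exact h1
  | mul_right x hx y hy ih =>
    obtain ⟨d, hd, rfl⟩ := hy
    exact hm x hx d hd ih
  | mul_inv_cancel x hx y hy ih =>
    obtain ⟨d, hd, rfl⟩ := hy
    rw [inv_simple]
    exact hm x hx d hd ih

theorem exists_word {D : Set B} {x : W} (hx : x ∈ Par cs D) :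
    ∃ ω : List B, cs.IsReduced ω ∧ (∀ d ∈ ω, d ∈ D) ∧ cs.wordProd ω = x := by
  refine par_induction cs (P := fun x => ∃ ω : List B, cs.IsReduced ω ∧ (∀ d ∈ ω, d ∈ D) ∧
    cs.wordProd ω = x) ⟨[], by simp [CoxeterSystem.IsReduced]⟩ ?_ hx
  rintro x - d hd ⟨ω, hr, hD, rfl⟩
  rcases cs.length_mul_simple (cs.wordProd ω) d with h | h
  · refine ⟨ω ++ [d], ?_, ?_, ?_⟩
    · rw [CoxeterSystem.IsReduced, wordProd_append]
      simp [h, hr.eq]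
    · intro e he
      simp at he
      rcases he with he | rfl
      · exact hD e he
      · exact hd
    · simp [wordProd_append]
  · obtain ⟨j, hj, he⟩ := exchange cs ω d (by omega)
    refine ⟨ω.eraseIdx j, ?_, fun e he' => hD e (List.mem_of_mem_eraseIdx he'), he.symm⟩
    rw [CoxeterSystem.IsReduced, ← he, List.length_eraseIdx_of_lt hj]
    rw [hr.eq] at h
    omega

theorem desc_factor {D : Set B} {g : W} (hg : D ⊆ desc cs g) {x : W} (hx : x ∈ Par cs D) :
    ∃ a, g = a * x ∧ cs.length g = cs.length a + cs.length x := by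
  obtain ⟨ω, hr, hD, rfl⟩ := exists_word cs hx
  clear hx
  induction ω using List.reverseRecOn with
  | nil => exact ⟨g, by simp⟩
  | append_singleton ω d ih =>
    have hr' : cs.IsReduced ω := by
      have := hr.take ω.length
      simpa using this
    obtain ⟨a, h1, h2⟩ := ih hr' (fun e he => hD e (by simp [he]))
    have hd : cs.length (g * cs.simple d) < cs.length g := hg (hD d (by simp))
    have hlen := hr.eq
    rw [wordProd_append, wordProd_singleton] at hlen ⊢
    simp at hlen
    have hd' := hd
    rw [h1] at hd
    rcases exch cs a _ d hd with h | ⟨a', ha', hl⟩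
    · rw [hr'.eq] at h; omega
    · refine ⟨a', ?_, ?_⟩
      · rw [← mul_assoc, ← ha', ← h1]; simp
      · have : g = a' * (cs.wordProd ω * cs.simple d) := by
          rw [← mul_assoc, ← ha', ← h1]; simp
        have h3 := cs.length_mul_le a' (cs.wordProd ω * cs.simple d)
        rw [← this] at h3
        rw [hr'.eq] at h2
        omega

theorem length_le_of_desc {D : Set B} {g : W} (hg : D ⊆ desc cs g) {x : W} (hx : x ∈ Par cs D) :
    cs.length x ≤ cs.length g := by
  obtain ⟨a, -, h⟩ := desc_factor cs hg hx
  omega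

theorem finite_length_le [Finite B] (N : ℕ) : {x : W | cs.length x ≤ N}.Finite := by
  apply ((List.finite_length_le B N).image cs.wordProd).subset
  intro x hx
  obtain ⟨ω, hr, rfl⟩ := cs.exists_isReduced x
  refine ⟨ω, ?_, rfl⟩
  have h := hr.eq
  simp only [Set.mem_ofPred_eq] at hx ⊢
  omega

theorem par_finite [Finite B] {D : Set B} {g : W} (hg : D ⊆ desc cs g) :
    (Par cs D : Set W).Finite :=
  (finite_length_le cs (cs.length g)).subset fun _ hx => length_le_of_desc cs hg hx

theorem add_right {D : Set B} {v : W} (hv : ∀ u ∈ Par cs D, cs.length v ≤ cs.length (v * u))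
    {u : W} (hu : u ∈ Par cs D) : cs.length (v * u) = cs.length v + cs.length u := by
  refine par_induction cs (P := fun u => cs.length (v * u) = cs.length v + cs.length u) (by simp)
    ?_ hu
  intro u hu d hd ih
  rw [← mul_assoc]
  have h1 := cs.length_mul_simple (v * u) d
  have h2 := cs.length_mul_simple u d
  have h3 := cs.length_mul_le v (u * cs.simple d)
  rw [← mul_assoc] at h3
  rcases h2 with h2 | h2
  · rcases h1 with h1 | h1
    · omega
    · rcases exch cs v u d (by omega) with h | ⟨a', ha, hl⟩
      · omega
      · have : a' = v * (u * cs.simple d * u⁻¹) := by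
          rw [← mul_assoc, ← mul_assoc, ha]; simp
        have h4 := hv (u * cs.simple d * u⁻¹)
          (mul_mem (mul_mem hu (simple_mem cs hd)) (inv_mem hu))
        rw [← this] at h4
        omega
  · omega

theorem add_left {D : Set B} {v : W} (hv : ∀ u ∈ Par cs D, cs.length v ≤ cs.length (u * v))
    {u : W} (hu : u ∈ Par cs D) : cs.length (u * v) = cs.length u + cs.length v := by
  have := add_right cs (D := D) (v := v⁻¹) (fun u hu => by
    have := hv u⁻¹ (inv_mem hu)
    rw [length_inv, ← cs.length_inv (v⁻¹ * u)]
    simpa using this) (inv_mem hu)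
  rw [← mul_inv_rev, length_inv, length_inv, length_inv] at this
  omega

/-- There is a shortest element in any nonempty set. -/
theorem exists_shortest {S : Set W} (h : S.Nonempty) :
    ∃ v ∈ S, ∀ u ∈ S, cs.length v ≤ cs.length u := by
  have := WellFounded.has_min (measure cs.length).wf S h
  obtain ⟨v, hv, hm⟩ := this
  exact ⟨v, hv, fun u hu => not_lt.1 (hm u hu)⟩

/-! ### Involutions -/

/-- Involutions commuting with all their descents. -/
def CT (c : W) : Prop := c * c = 1 ∧ ∀ d ∈ desc cs c, c * cs.simple d = cs.simple d * c

theorem CT.comm {c : W} (hc : CT cs c) {x : W} (hx : x ∈ Par cs (desc cs c)) : c * x = x * c := by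
  refine par_induction cs (P := fun x => c * x = x * c) (by simp) ?_ hx
  intro x _ d hd ih
  rw [← mul_assoc, ih, mul_assoc, hc.2 d hd, mul_assoc]

theorem desc_of_left {c : W} (hc : c * c = 1) {r : B}
    (h : cs.length (cs.simple r * c) < cs.length c) : r ∈ desc cs c := by
  have hi : c⁻¹ = c := inv_eq_of_mul_eq_one_left hc
  rw [← cs.length_inv] at h
  simpa [desc, hi] using h

theorem CT.mem {c : W} (hc : CT cs c) : c ∈ Par cs (desc cs c) := by
  obtain ⟨v, ⟨u, hu, rfl⟩, hm⟩ := exists_shortest cs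
    (S := {v | ∃ u ∈ Par cs (desc cs c), v = c * u}) ⟨c, 1, one_mem _, by simp⟩
  have hm' : ∀ x ∈ Par cs (desc cs c), cs.length (c * u) ≤ cs.length (c * u * x) :=
    fun x hx => hm _ ⟨u * x, mul_mem hu hx, by rw [mul_assoc]⟩
  by_cases h1 : c * u = 1
  · have hu' := inv_mem hu
    rwa [← mul_eq_one_iff_eq_inv.1 h1] at hu'
  exfalso
  obtain ⟨r, hr⟩ := cs.exists_leftDescent_of_ne_one h1
  have hr : cs.length (cs.simple r * (c * u)) < cs.length (c * u) := hr
  have hadd := add_right cs hm' (inv_mem hu)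
  rw [mul_inv_cancel_right] at hadd
  have hrd : r ∈ desc cs c := by
    apply desc_of_left cs hc.1
    have := cs.length_mul_le (cs.simple r * (c * u)) u⁻¹
    rw [show cs.simple r * (c * u) * u⁻¹ = cs.simple r * c by group] at this
    omega
  have hsr := simple_mem cs hrd
  have h2 := hm' (cs.simple r * 1) (by simpa using hsr)
  have h3 : cs.simple r * (c * u) = c * (cs.simple r * u) := by
    rw [← mul_assoc, ← mul_assoc, hc.2 r hrd]
  have h4 := hm _ ⟨cs.simple r * u, mul_mem hsr hu, h3⟩
  omega

theorem richardson_step {x : W} (hx : x * x = 1) {d : B} (hd : d ∈ desc cs x)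
    (hne : x * cs.simple d ≠ cs.simple d * x) :
    cs.length (cs.simple d * x * cs.simple d) + 2 ≤ cs.length x := by
  have hi : x⁻¹ = x := inv_eq_of_mul_eq_one_left hx
  have h1 : cs.length (cs.simple d * x) = cs.length (x * cs.simple d) := by
    rw [← cs.length_inv (cs.simple d * x)]; simp [hi]
  have hd' : cs.length (x * cs.simple d) < cs.length x := hd
  rcases exch cs (cs.simple d) (cs.simple d * x) d (by simpa using hd') with h | ⟨a, ha, hl⟩
  · omega
  · rw [length_simple] at hl
    have : a = 1 := by rw [← cs.length_eq_zero_iff]; omega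
    subst this
    simp at ha
    exact absurd ha hne

theorem richardson (n : ℕ) : ∀ x : W, cs.length x ≤ n → x * x = 1 →
    ∃ y c, x = y⁻¹ * c * y ∧ CT cs c ∧ 2 * cs.length y + cs.length c ≤ cs.length x := by
  induction n with
  | zero =>
    intro x hx _
    have : x = 1 := by rw [← cs.length_eq_zero_iff]; omega
    subst this
    refine ⟨1, 1, by simp, ⟨by simp, fun d hd => by simp⟩, by simp⟩
  | succ n ih =>
    intro x hx hxx
    by_cases h : ∀ d ∈ desc cs x, x * cs.simple d = cs.simple d * x
    · exact ⟨1, x, by simp, ⟨hxx, h⟩, by simp⟩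
    push Not at h
    obtain ⟨d, hd, hne⟩ := h
    have h2 := richardson_step cs hxx hd hne
    obtain ⟨y, c, h3, hc, h4⟩ := ih (cs.simple d * x * cs.simple d) (by omega) (by
      simp [mul_assoc]
      rw [← mul_assoc x, hxx]; simp)
    refine ⟨y * cs.simple d, c, ?_, hc, ?_⟩
    · have : x = cs.simple d * (cs.simple d * x * cs.simple d) * cs.simple d := by simp [mul_assoc]
      rw [this, h3]
      simp [mul_assoc]
    · have := cs.length_mul_le y (cs.simple d)
      rw [length_simple] at this
      omega

/-! ### Consequences of two-dimensionality -/

/-- Nontrivial, nonreflection involutions commuting with all their descents. -/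
def Dih (c : W) : Prop := CT cs c ∧ c ≠ 1 ∧ ¬ cs.IsReflection c

/-- Every parabolic subgroup on more than two generators is infinite. -/
def Dim2 : Prop := ∀ T : Set B, 2 < T.ncard → (Subgroup.closure (cs.simple '' T) : Set W).Infinite

variable [Finite B] {cs}

theorem desc_ncard_le (hdim : Dim2 cs) (g : W) : (desc cs g).ncard ≤ 2 := by
  by_contra h
  exact hdim _ (by omega) (par_finite cs (D := desc cs g) (g := g) subset_rfl)

theorem Dih.ncard (hdim : Dim2 cs) {c : W} (hc : Dih cs c) : (desc cs c).ncard = 2 := by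
  have h := desc_ncard_le hdim c
  have hmem := hc.1.mem
  have h0 : (desc cs c).ncard ≠ 0 := by
    intro h0
    rw [Set.ncard_eq_zero] at h0
    rw [h0, Par] at hmem
    simp at hmem
    exact hc.2.1 hmem
  have h1 : (desc cs c).ncard ≠ 1 := by
    intro h1
    obtain ⟨d, hd⟩ := Set.ncard_eq_one.1 h1
    rw [hd] at hmem
    have : c = 1 ∨ c = cs.simple d := by
      refine par_induction cs (P := fun c => c = 1 ∨ c = cs.simple d) (by simp) ?_ hmem
      rintro x - e rfl (rfl | rfl) <;> simp
    rcases this with h | h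
    · exact hc.2.1 h
    · exact hc.2.2 (h ▸ cs.isReflection_simple d)
  omega

theorem eq_one_of_min (hdim : Dim2 cs) {c c' w : W} (hc : Dih cs c) (hc' : CT cs c') (hw : w * c = c' * w)
    (hr : ∀ u ∈ Par cs (desc cs c), cs.length w ≤ cs.length (w * u))
    (hl : ∀ u ∈ Par cs (desc cs c'), cs.length w ≤ cs.length (u * w)) : w = 1 := by
  by_contra h1
  obtain ⟨r, hrw⟩ := cs.exists_rightDescent_of_ne_one h1
  have hrw : cs.length (w * cs.simple r) < cs.length w := hrw
  have hrn : r ∉ desc cs c := fun h => by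
    have := hr _ (simple_mem cs h)
    omega
  have e1 := add_right cs hr hc.1.mem
  have e2 := add_left cs hl hc'.mem
  have hsub : insert r (desc cs c) ⊆ desc cs (w * c) := by
    rintro d (rfl | hd)
    · change cs.length _ < cs.length _
      have := cs.length_mul_le c' (w * cs.simple d)
      rw [← mul_assoc] at this
      rw [hw]
      omega
    · have hd' : cs.length (c * cs.simple d) < cs.length c := hd
      change cs.length _ < cs.length _
      have := cs.length_mul_le w (c * cs.simple d)
      rw [← mul_assoc] at this
      omega
  have h2 := Set.ncard_le_ncard hsub (Set.toFinite _)
  rw [Set.ncard_insert_of_notMem hrn (Set.toFinite _), hc.ncard hdim] at h2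
  have := desc_ncard_le hdim (w * c)
  omega

theorem conj_unique (hdim : Dim2 cs) {c c' g : W} (hc : Dih cs c) (hc' : CT cs c') (hg : g * c = c' * g) :
    c = c' ∧ g ∈ Par cs (desc cs c) := by
  have h1 : c = c' := by
    obtain ⟨w, hw, hm⟩ := exists_shortest cs (S := {w | w * c = c' * w}) ⟨g, hg⟩
    have : w = 1 := by
      refine eq_one_of_min hdim hc hc' hw (fun u hu => hm _ ?_) (fun u hu => hm _ ?_)
      · have hw' : w * c = c' * w := hw
        change w * u * c = c' * (w * u)
        rw [mul_assoc, ← hc.1.comm cs hu, ← mul_assoc, hw', mul_assoc]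
      · have hw' : w * c = c' * w := hw
        change u * w * c = c' * (u * w)
        rw [mul_assoc, hw', ← mul_assoc, ← hc'.comm cs hu, mul_assoc]
    subst this
    simpa using hw
  subst h1
  refine ⟨rfl, ?_⟩
  obtain ⟨w, ⟨a, ha, b, hb, rfl⟩, hm⟩ := exists_shortest cs
    (S := {w | ∃ a ∈ Par cs (desc cs c), ∃ b ∈ Par cs (desc cs c), w = a * g * b})
    ⟨g, 1, one_mem _, 1, one_mem _, by simp⟩
  have hw : a * g * b = 1 := by
    refine eq_one_of_min hdim hc hc' ?_ (fun u hu => hm _ ⟨a, ha, b * u, mul_mem hb hu, ?_⟩)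
      (fun u hu => hm _ ⟨u * a, mul_mem hu ha, b, hb, ?_⟩)
    · rw [mul_assoc, ← hc.1.comm cs hb, ← mul_assoc, mul_assoc a g c, hg, ← mul_assoc,
        ← hc.1.comm cs ha]
      simp only [mul_assoc]
    · simp only [mul_assoc]
    · simp only [mul_assoc]
  have : g = a⁻¹ * b⁻¹ := by
    rw [eq_inv_mul_iff_mul_eq, eq_inv_iff_mul_eq_one, hw]
  rw [this]
  exact mul_mem (inv_mem ha) (inv_mem hb)

theorem exists_dih {x : W} (hx : x * x = 1) (h1 : x ≠ 1) (hr : ¬ cs.IsReflection x) :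
    ∃ y c, x = y⁻¹ * c * y ∧ Dih cs c ∧ 2 * cs.length y + cs.length c ≤ cs.length x := by
  obtain ⟨y, c, h, hc, hl⟩ := richardson cs _ x le_rfl hx
  refine ⟨y, c, h, ⟨hc, ?_, ?_⟩, hl⟩
  · rintro rfl; simp at h; exact h1 h
  · intro hcr
    apply hr
    have := hcr.conj (w := y⁻¹)
    rw [h]
    simpa using this

theorem length_conj (hdim : Dim2 cs) {c y : W} (hc : Dih cs c)
    (hy : ∀ u ∈ Par cs (desc cs c), cs.length y ≤ cs.length (u * y)) :
    2 * cs.length y + cs.length c ≤ cs.length (y⁻¹ * c * y) := by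
  obtain ⟨z, c', h, hc', hl⟩ := exists_dih (cs := cs) (x := y⁻¹ * c * y)
    (by rw [show y⁻¹ * c * y * (y⁻¹ * c * y) = y⁻¹ * (c * c) * y by group, hc.1.1]; simp)
    (by
      intro h
      apply hc.2.1
      rw [show c = y * (y⁻¹ * c * y) * y⁻¹ by group, h]; simp)
    (by
      intro h
      apply hc.2.2
      have := h.conj (w := y)
      rwa [show y * (y⁻¹ * c * y) * y⁻¹ = c by group] at this)
  have hg : (z * y⁻¹) * c = c' * (z * y⁻¹) := by
    have h5 : z * (y⁻¹ * c * y) * y⁻¹ = z * (z⁻¹ * c' * z) * y⁻¹ := by rw [h]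
    simpa [mul_assoc] using h5
  obtain ⟨rfl, hm⟩ := conj_unique hdim hc hc'.1 hg
  have := hy _ hm
  rw [inv_mul_cancel_right] at this
  omega

theorem finite_sub_of_dih (hdim : Dim2 cs) {c : W} (hc : Dih cs c) (F : Subgroup W) (hF : (F : Set W).Finite)
    (hcF : c ∈ F) : F ≤ Par cs (desc cs c) := by
  have key : ∀ f ∈ F, ∃ u ∈ Par cs (desc cs c), ∃ y, f = u * y ∧ cs.length f ≤
      cs.length c + cs.length y ∧
      2 * cs.length y + cs.length c ≤ cs.length (f⁻¹ * c * f) := by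
    intro f _
    obtain ⟨y, ⟨a, ha, rfl⟩, hm⟩ := exists_shortest cs
      (S := {w | ∃ a ∈ Par cs (desc cs c), w = a * f}) ⟨f, 1, one_mem _, by simp⟩
    have hm' : ∀ u ∈ Par cs (desc cs c), cs.length (a * f) ≤ cs.length (u * (a * f)) :=
      fun u hu => hm _ ⟨u * a, mul_mem hu ha, by rw [mul_assoc]⟩
    refine ⟨a⁻¹, inv_mem ha, a * f, by simp, ?_, ?_⟩
    · have h1 := cs.length_mul_le a⁻¹ (a * f)
      have h2 := length_le_of_desc cs (g := c) subset_rfl (inv_mem ha)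
      rw [inv_mul_cancel_left] at h1
      omega
    · have := length_conj hdim hc hm'
      have e : (a * f)⁻¹ * c * (a * f) = f⁻¹ * c * f := by
        have h3 := hc.1.comm cs ha
        rw [mul_inv_rev, mul_assoc, ← mul_assoc c a f, h3]
        group
      rwa [e] at this
  obtain ⟨f, hf, hmax⟩ := Set.exists_max_image (F : Set W) cs.length hF ⟨1, one_mem F⟩
  have hb : ∀ g ∈ F, cs.length g ≤ cs.length c := by
    obtain ⟨u, hu, y, h1, h2, h3⟩ := key f hf
    have h4 := hmax (f⁻¹ * c * f) (mul_mem (mul_mem (inv_mem hf) hcF) hf)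
    intro g hg
    have := hmax g hg
    omega
  intro g hg
  obtain ⟨u, hu, y, h1, h2, h3⟩ := key g hg
  have h4 := hb (g⁻¹ * c * g) (mul_mem (mul_mem (inv_mem hg) hcF) hg)
  have : y = 1 := by rw [← cs.length_eq_zero_iff]; omega
  subst this
  rw [h1]; simpa using hu

/-- A nonreflection involution is central in any finite subgroup containing it. -/
theorem finite_comm (hdim : Dim2 cs) {x : W} (hx : x * x = 1) (h1 : x ≠ 1) (hr : ¬ cs.IsReflection x)
    (F : Subgroup W) (hF : (F : Set W).Finite) (hxF : x ∈ F) {f : W} (hf : f ∈ F) :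
    x * f = f * x := by
  obtain ⟨y, c, rfl, hc, -⟩ := exists_dih hx h1 hr
  have h2 := finite_sub_of_dih hdim hc (F.map (MulAut.conj y).toMonoidHom)
    (by rw [Subgroup.coe_map]; exact hF.image _)
    ⟨_, hxF, by simp [mul_assoc]⟩
  have h3 : y * f * y⁻¹ ∈ Par cs (desc cs c) := h2 ⟨f, hf, by simp⟩
  have h4 := hc.1.comm cs h3
  have h5 : y⁻¹ * (c * (y * f * y⁻¹)) * y = y⁻¹ * (y * f * y⁻¹ * c) * y := by rw [h4]
  simpa [mul_assoc] using h5
end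


section
variable {B W : Type*} [Group W] {M : CoxeterMatrix B} (cs : CoxeterSystem M W)

/-! ### Auxiliary facts -/

theorem simple_inj {a b : B} (hab : a ≠ b) : cs.simple a ≠ cs.simple b := by
  intro h
  obtain ⟨e1, e2⟩ := pow_consequence cs a b hab 1 (by simp [h])
  norm_num at e1 e2
  rw [Real.cos_two_mul, e1] at e2
  norm_num at e2

theorem exists_eta (s : B) (h : ∀ u, u ≠ s → M s u = 2 ∨ M s u = 0) :
    ∃ η : W →* Multiplicative (ZMod 2), η (cs.simple s) = Multiplicative.ofAdd 1 ∧
      ∀ u, u ≠ s → η (cs.simple u) = 1 := by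
  classical
  have hl : M.IsLiftable (fun u => if u = s then Multiplicative.ofAdd (1 : ZMod 2) else 1) := by
    intro i j
    have h2 : (Multiplicative.ofAdd (1 : ZMod 2)) ^ 2 = 1 := rfl
    by_cases hi : i = s
    · subst hi
      by_cases hj : j = i
      · subst hj
        simp only [if_true, CoxeterMatrix.diagonal, pow_one, ← pow_two]
        exact h2
      · rcases h j hj with e | e
        · simp [hj, e, h2]
        · simp [e]
    · by_cases hj : j = s
      · subst hj
        rw [M.symmetric i j]
        rcases h i hi with e | e
        · simp [hi, e, h2]
        · simp [e]
      · simp [hi, hj]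
  refine ⟨cs.lift ⟨_, hl⟩, ?_, ?_⟩
  · rw [lift_apply_simple]; simp
  · intro u hu
    rw [lift_apply_simple]; simp [hu]

theorem eta_ne : (Multiplicative.ofAdd (1 : ZMod 2)) ≠ 1 := by decide

theorem comm_of_two {a b : B} (h : M a b = 2) :
    cs.simple a * cs.simple b = cs.simple b * cs.simple a := by
  have h1 := cs.simple_mul_simple_pow a b
  rw [h, pow_two] at h1
  have := inv_eq_of_mul_eq_one_left h1
  rw [← this]; simp

theorem par_pair {a b : B} (h : cs.simple a * cs.simple b = cs.simple b * cs.simple a) {x : W}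
    (hx : x ∈ Par cs {a, b}) :
    x = 1 ∨ x = cs.simple a ∨ x = cs.simple b ∨ x = cs.simple a * cs.simple b := by
  refine par_induction cs (P := fun x => x = 1 ∨ x = cs.simple a ∨ x = cs.simple b ∨
    x = cs.simple a * cs.simple b) (by simp) ?_ hx
  rintro x - d (rfl | rfl) (rfl | rfl | rfl | rfl)
  · simp
  · simp
  · simp [h]
  · rw [h]; simp
  · simp
  · simp
  · simp
  · simp

theorem par_pair_finite {a b : B} (h : M a b ≠ 0) : (Par cs {a, b} : Set W).Finite := by
  have hf : (Subgroup.zpowers (cs.simple a * cs.simple b) : Set W).Finite := by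
    rw [finite_zpowers, isOfFinOrder_iff_pow_eq_one]
    exact ⟨M a b, Nat.pos_of_ne_zero h, cs.simple_mul_simple_pow a b⟩
  apply (hf.union (hf.image (· * cs.simple a))).subset
  intro x hx
  refine par_induction cs (P := fun x => x ∈ (Subgroup.zpowers (cs.simple a * cs.simple b) : Set W) ∪
    (· * cs.simple a) '' (Subgroup.zpowers (cs.simple a * cs.simple b) : Set W)) ?_ ?_ hx
  · left; exact one_mem _
  · rintro x - d hd (hx | ⟨z, hz, rfl⟩)
    · rcases hd with rfl | rfl
      · right; exact ⟨x, hx, rfl⟩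
      · right
        refine ⟨x * (cs.simple a * cs.simple d)⁻¹, mul_mem hx (inv_mem (Subgroup.mem_zpowers _)), ?_⟩
        simp [mul_assoc]
    · rcases hd with rfl | rfl
      · left; simpa using hz
      · left
        change z * cs.simple a * cs.simple d ∈ Subgroup.zpowers _
        rw [mul_assoc]
        exact mul_mem hz (Subgroup.mem_zpowers _)

theorem not_refl_of_even {x : W} (h : Even (cs.length x)) : ¬ cs.IsReflection x := fun hr =>
  (Nat.not_even_iff_odd.2 hr.odd_length) h

variable [Finite B] {cs}

theorem cent_mem (hdim : Dim2 cs) {c y g : W} (hc : Dih cs c)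
    (hg : (y⁻¹ * c * y) * g = g * (y⁻¹ * c * y)) : y * g * y⁻¹ ∈ Par cs (desc cs c) := by
  refine (conj_unique hdim hc hc.1 ?_).2
  have : y * ((y⁻¹ * c * y) * g) * y⁻¹ = y * (g * (y⁻¹ * c * y)) * y⁻¹ := by rw [hg]
  simpa [mul_assoc] using this.symm

theorem cent_finite (hdim : Dim2 cs) {x : W} (hx : x * x = 1) (h1 : x ≠ 1)
    (hr : ¬ cs.IsReflection x) : {g : W | x * g = g * x}.Finite := by
  obtain ⟨y, c, rfl, hc, -⟩ := exists_dih hx h1 hr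
  apply ((par_finite cs (g := c) subset_rfl).image (fun p => y⁻¹ * p * y)).subset
  intro g hg
  exact ⟨_, cent_mem hdim hc hg, by simp [mul_assoc]⟩
end

section
variable {B B' : Type*} {W W' : Type*} [Group W] [Group W'] [Finite B] [Finite B']
    {M : CoxeterMatrix B} {M' : CoxeterMatrix B'}
    {cs : CoxeterSystem M W} {cs' : CoxeterSystem M' W'}

theorem img_invol (φ : W ≃* W') (s : B) :
    φ (cs.simple s) * φ (cs.simple s) = 1 ∧ φ (cs.simple s) ≠ 1 := by
  constructor
  · rw [← map_mul]; simp
  · intro h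
    rw [map_eq_one_iff φ φ.injective, ← cs.length_eq_zero_iff, length_simple] at h
    omega

theorem step1 (hdim' : Dim2 cs') (φ : W ≃* W') (s : B)
    (hs : ¬ cs'.IsReflection (φ (cs.simple s))) (u : B) (hu : u ≠ s) :
    M s u = 2 ∨ M s u = 0 := by
  by_cases h0 : M s u = 0
  · exact Or.inr h0
  left
  have hF : (((Par cs {s, u}).map φ.toMonoidHom : Subgroup W') : Set W').Finite := by
    rw [Subgroup.coe_map]
    exact (par_pair_finite cs h0).image _
  have := finite_comm hdim' (img_invol φ s).1 (img_invol φ s).2 hs _ hF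
    ⟨_, simple_mem cs (by simp), rfl⟩ (f := φ (cs.simple u)) ⟨_, simple_mem cs (by simp), rfl⟩
  rw [← map_mul, ← map_mul] at this
  exact eq_two_of_commute cs s u hu.symm (φ.injective this)

theorem centS_finite (hdim' : Dim2 cs') (φ : W ≃* W') (s : B)
    (hs : ¬ cs'.IsReflection (φ (cs.simple s))) :
    (Subgroup.centralizer {cs.simple s} : Set W).Finite := by
  have h := cent_finite hdim' (img_invol φ s).1 (img_invol φ s).2 hs
  apply (h.preimage (f := φ) φ.injective.injOn).subset
  intro g hg
  have hg' : g ∈ Subgroup.centralizer {cs.simple s} := hg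
  rw [Subgroup.mem_centralizer_singleton_iff] at hg'
  change φ (cs.simple s) * φ g = φ g * φ (cs.simple s)
  rw [← map_mul, ← map_mul, hg']

theorem step2 (hdim : Dim2 cs) (hdim' : Dim2 cs') (φ : W ≃* W') (s : B)
    (hs : ¬ cs'.IsReflection (φ (cs.simple s))) (u v : B) (hu : u ≠ s) (hv : v ≠ s) (huv : u ≠ v)
    (h2 : M s u = 2) : M s v = 0 := by
  rcases step1 hdim' φ s hs v hv with h | h
  swap
  · exact h
  exfalso
  refine hdim {s, u, v} ?_ ((centS_finite hdim' φ s hs).subset ?_)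
  · rw [Set.ncard_eq_three.2 ⟨s, u, v, hu.symm, hv.symm, huv, rfl⟩]; norm_num
  · change Subgroup.closure _ ≤ Subgroup.centralizer _
    rw [Subgroup.closure_le]
    rintro _ ⟨d, hd, rfl⟩
    change _ ∈ Subgroup.centralizer _
    rw [Subgroup.mem_centralizer_singleton_iff]
    rcases hd with rfl | rfl | rfl
    · rfl
    · exact (comm_of_two cs h2).symm
    · exact (comm_of_two cs h).symm

theorem step3 (hdim : Dim2 cs) (hdim' : Dim2 cs') (φ : W ≃* W') (s : B)
    (hs : ¬ cs'.IsReflection (φ (cs.simple s))) : ∃ t, t ≠ s ∧ M s t = 2 := by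
  obtain ⟨y, c, hx, hc, -⟩ := exists_dih (img_invol φ s).1 (img_invol φ s).2 hs
  have hne : (desc cs' c).Nonempty := by
    rw [← Set.ncard_pos (Set.toFinite _), hc.ncard hdim']; norm_num
  obtain ⟨a, ha⟩ := hne
  set α := φ.symm (y⁻¹ * cs'.simple a * y) with hα
  have hφα : φ α = y⁻¹ * cs'.simple a * y := by simp [hα]
  have hαs : cs.simple s * α = α * cs.simple s := by
    apply φ.injective
    rw [map_mul, map_mul, hφα, hx]
    have := hc.1.2 a ha
    rw [show y⁻¹ * c * y * (y⁻¹ * cs'.simple a * y) = y⁻¹ * (c * cs'.simple a) * y by group, this]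
    group
  have hαα : α * α = 1 := by
    apply φ.injective
    rw [map_mul, hφα]; simp [mul_assoc]
  have hrα : cs'.IsReflection (φ α) := by
    rw [hφα]
    have := (cs'.isReflection_simple a).conj (w := y⁻¹)
    simpa using this
  have hα1 : α ≠ 1 := by
    rintro h
    rw [h, map_one] at hrα
    have := hrα.odd_length
    simp at this
  have hαs' : cs.simple s * α ≠ 1 := by
    intro h
    have : α = cs.simple s := by rw [← inv_eq_of_mul_eq_one_right h]; simp
    rw [this] at hrα
    exact hs hrα
  obtain ⟨z, hz1, hzz, hzs, hze⟩ : ∃ z : W, z ≠ 1 ∧ z * z = 1 ∧ z * cs.simple s = cs.simple s * z ∧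
      Even (cs.length z) := by
    rcases Nat.even_or_odd (cs.length α) with h | h
    · exact ⟨α, hα1, hαα, hαs.symm, h⟩
    · refine ⟨cs.simple s * α, hαs', ?_, ?_, ?_⟩
      · nth_rewrite 1 [hαs]
        rw [mul_assoc, simple_mul_simple_cancel_left, hαα]
      · rw [mul_assoc, ← hαs]
      · have := cs.length_mul_mod_two (cs.simple s) α
        rw [length_simple] at this
        rw [Nat.even_iff]
        rw [Nat.odd_iff] at h
        omega
  obtain ⟨v, c₁, rfl, hc₁, -⟩ := exists_dih hzz hz1 (not_refl_of_even cs hze)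
  have hm := cent_mem hdim hc₁ hzs
  obtain ⟨η, h1, h2⟩ := exists_eta cs s (step1 hdim' φ s hs)
  have hsd : s ∈ desc cs c₁ := by
    by_contra hn
    have h3 : ∀ x ∈ Par cs (desc cs c₁), η x = 1 := by
      intro x hx
      refine par_induction cs (P := fun x => η x = 1) (by simp) ?_ hx
      intro x _ d hd ih
      rw [map_mul, ih, h2 d (by rintro rfl; exact hn hd), mul_one]
    have := h3 _ hm
    rw [map_mul, map_mul, map_inv, h1, mul_comm, inv_mul_cancel_left] at this
    exact eta_ne this
  obtain ⟨b, hb, hbs⟩ : ∃ b ∈ desc cs c₁, b ≠ s :=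
    Set.exists_ne_of_one_lt_ncard (by rw [hc₁.ncard hdim]; norm_num) s
  refine ⟨b, hbs, ?_⟩
  rcases step1 hdim' φ s hs b hbs with h | h
  · exact h
  exfalso
  have hfin : (Subgroup.zpowers (cs.simple s * cs.simple b) : Set W).Finite := by
    refine (par_finite cs (g := c₁) subset_rfl).subset ?_
    change Subgroup.zpowers _ ≤ Par cs _
    rw [Subgroup.zpowers_le]
    exact mul_mem (simple_mem cs hsd) (simple_mem cs hb)
  rw [finite_zpowers, isOfFinOrder_iff_pow_eq_one] at hfin
  obtain ⟨n, hn, hpow⟩ := hfin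
  exact ne_zero_of_pow cs s b hbs.symm n (by omega) hpow h

theorem length_two {s t : B} (hts : t ≠ s) : cs.length (cs.simple s * cs.simple t) = 2 := by
  have h1 := cs.length_mul_simple (cs.simple s) t
  rw [length_simple] at h1
  rcases h1 with h1 | h1
  · exact h1
  · have : cs.length (cs.simple s * cs.simple t) = 0 := by omega
    rw [cs.length_eq_zero_iff] at this
    have h2 := inv_eq_of_mul_eq_one_right this
    rw [inv_simple] at h2
    exact absurd h2 (simple_inj cs hts.symm)

theorem step4 (hdim : Dim2 cs) (hdim' : Dim2 cs') (φ : W ≃* W') (s t : B)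
    (hs : ¬ cs'.IsReflection (φ (cs.simple s))) (hts : t ≠ s) (hM : M s t = 2) {f : W}
    (hf : cs.simple s * f = f * cs.simple s) : f ∈ Par cs {s, t} := by
  have hl := length_two (cs := cs) hts
  have hcomm := comm_of_two cs hM
  have hne : cs.simple s * cs.simple t ≠ 1 := by
    intro h; rw [h] at hl; simp at hl
  have hnr := not_refl_of_even cs (x := cs.simple s * cs.simple t) (by rw [hl]; decide)
  have hsq : cs.simple s * cs.simple t * (cs.simple s * cs.simple t) = 1 := by
    nth_rewrite 2 [hcomm]; simp [mul_assoc]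
  have hcm : cs.simple s * cs.simple t * f = f * (cs.simple s * cs.simple t) := by
    refine finite_comm hdim hsq hne hnr _ (centS_finite hdim' φ s hs) ?_ ?_
    · rw [Subgroup.mem_centralizer_singleton_iff]
      nth_rewrite 2 [hcomm]
      simp [mul_assoc]
    · rw [Subgroup.mem_centralizer_singleton_iff, hf]
  have hdesc : desc cs (cs.simple s * cs.simple t) = {s, t} := by
    symm
    apply Set.eq_of_subset_of_ncard_le
    · rintro d (rfl | rfl)
      · change cs.length _ < cs.length _
        rw [hl, hcomm]; simp
      · change cs.length _ < cs.length _
        rw [hl]; simp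
    · rw [Set.ncard_pair hts.symm]
      exact desc_ncard_le hdim _
    · exact Set.toFinite _
  have hD : Dih cs (cs.simple s * cs.simple t) := by
    refine ⟨⟨hsq, ?_⟩, hne, hnr⟩
    rw [hdesc]
    rintro d (rfl | rfl)
    · nth_rewrite 1 [hcomm]; rw [mul_assoc]; simp
    · nth_rewrite 2 [hcomm]; simp
  have := (conj_unique hdim hD hD.1 hcm.symm).2
  rwa [hdesc] at this

/-- The list of properties in the main theorem. -/
def Good (cs : CoxeterSystem M W) (cs' : CoxeterSystem M' W') (φ : W ≃* W') (s : B)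
    (p : B × B' × B') (w' : W') : Prop :=
      M s p.1 = 2 ∧
      (∀ u : B, u ≠ s → u ≠ p.1 → M s u = 0) ∧
      (Subgroup.closure (cs.simple '' {s, p.1})).map φ.toMonoidHom =
        (Subgroup.closure (cs'.simple '' {p.2.1, p.2.2})).map (MulAut.conj w').toMonoidHom ∧
      M' p.2.1 p.2.2 = 2 ∧
      (∀ u' : B', u' ≠ p.2.1 → u' ≠ p.2.2 → M' p.2.1 u' = 0) ∧
      φ (cs.simple s) = w' * (cs'.simple p.2.1 * cs'.simple p.2.2) * w'⁻¹ ∧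
      φ (cs.simple p.1) = w' * cs'.simple p.2.2 * w'⁻¹

theorem step5 (hdim : Dim2 cs) (hdim' : Dim2 cs') (φ : W ≃* W') (s t : B)
    (hs : ¬ cs'.IsReflection (φ (cs.simple s))) (hts : t ≠ s) (hM : M s t = 2) (a b : B')
    (hab : a ≠ b) (hM' : M' a b = 2) (w : W')
    (h1 : φ (cs.simple s) = w * (cs'.simple a * cs'.simple b) * w⁻¹)
    (h2 : φ (cs.simple t) = w * cs'.simple b * w⁻¹) : Good cs cs' φ s (t, a, b) w := by
  have h3 : φ (cs.simple s * cs.simple t) = w * cs'.simple a * w⁻¹ := by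
    rw [map_mul, h1, h2]; simp [mul_assoc]
  have hs' : ¬ cs.IsReflection (φ.symm (cs'.simple a)) := by
    have : cs'.simple a = w⁻¹ * φ (cs.simple s * cs.simple t) * w := by rw [h3]; simp [mul_assoc]
    rw [this, map_mul, map_mul, MulEquiv.symm_apply_apply, map_inv]
    intro h
    have h4 := h.conj (w := φ.symm w)
    rw [show φ.symm w * ((φ.symm w)⁻¹ * (cs.simple s * cs.simple t) * φ.symm w) * (φ.symm w)⁻¹ =
      cs.simple s * cs.simple t by group] at h4
    exact not_refl_of_even cs (by rw [length_two hts]; decide) h4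
  refine ⟨hM, fun u hu hut => step2 hdim hdim' φ s hs t u hts hu (Ne.symm hut) hM, ?_, hM',
    fun u hu hub => step2 hdim' hdim φ.symm a hs' b u hab.symm hu (Ne.symm hub) hM', h1, h2⟩
  rw [MonoidHom.map_closure, MonoidHom.map_closure]
  simp only [Set.image_pair]
  change Subgroup.closure {φ (cs.simple s), φ (cs.simple t)} =
    Subgroup.closure {w * cs'.simple a * w⁻¹, w * cs'.simple b * w⁻¹}
  apply le_antisymm
  · rw [Subgroup.closure_le]
    have hb : w * cs'.simple b * w⁻¹ ∈
      Subgroup.closure {w * cs'.simple a * w⁻¹, w * cs'.simple b * w⁻¹} :=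
      Subgroup.subset_closure (by simp)
    have ha : w * cs'.simple a * w⁻¹ ∈
      Subgroup.closure {w * cs'.simple a * w⁻¹, w * cs'.simple b * w⁻¹} :=
      Subgroup.subset_closure (by simp)
    rintro _ (rfl | rfl)
    · have := mul_mem ha hb
      rw [show w * cs'.simple a * w⁻¹ * (w * cs'.simple b * w⁻¹) =
        w * (cs'.simple a * cs'.simple b) * w⁻¹ by group, ← h1] at this
      exact this
    · rw [h2]; exact hb
  · rw [Subgroup.closure_le]
    have hb : φ (cs.simple t) ∈ Subgroup.closure {φ (cs.simple s), φ (cs.simple t)} :=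
      Subgroup.subset_closure (by simp)
    have ha : φ (cs.simple s) ∈ Subgroup.closure {φ (cs.simple s), φ (cs.simple t)} :=
      Subgroup.subset_closure (by simp)
    rintro _ (rfl | rfl)
    · rw [← h3, map_mul]; exact mul_mem ha hb
    · rw [← h2]; exact hb

theorem existence (hdim : Dim2 cs) (hdim' : Dim2 cs') (φ : W ≃* W') (s : B)
    (hs : ¬ cs'.IsReflection (φ (cs.simple s))) : ∃ p w, Good cs cs' φ s p w := by
  obtain ⟨t, hts, hM⟩ := step3 hdim hdim' φ s hs
  have hcomm := comm_of_two cs hM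
  obtain ⟨y, c, hx, hc, -⟩ := exists_dih (img_invol φ s).1 (img_invol φ s).2 hs
  obtain ⟨a, b, hab, hd⟩ := Set.ncard_eq_two.1 (hc.ncard hdim')
  have key : ∀ d ∈ desc cs' c, φ.symm (y⁻¹ * cs'.simple d * y) ∈ Par cs {s, t} := by
    intro d hd
    apply step4 hdim hdim' φ s t hs hts hM
    apply φ.injective
    rw [map_mul φ, map_mul φ, MulEquiv.apply_symm_apply, hx]
    have := hc.1.2 d hd
    rw [show y⁻¹ * c * y * (y⁻¹ * cs'.simple d * y) = y⁻¹ * (c * cs'.simple d) * y by group, this]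
    group
  have hcom : ∀ x ∈ Par cs {s, t}, ∀ z ∈ Par cs {s, t}, x * z = z * x := by
    intro x hx z hz
    have hst : cs.simple s * (cs.simple s * cs.simple t) = cs.simple s * cs.simple t * cs.simple s := by
      rw [mul_assoc, ← hcomm]
    have htt : cs.simple t * (cs.simple s * cs.simple t) = cs.simple s * cs.simple t * cs.simple t := by
      rw [← mul_assoc, hcomm]
    rcases par_pair cs hcomm hx with rfl | rfl | rfl | rfl <;>
    rcases par_pair cs hcomm hz with rfl | rfl | rfl | rfl <;>
    first
      | rfl
      | (simp only [one_mul, mul_one]; done)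
      | exact hcomm
      | exact hcomm.symm
      | exact hst
      | exact hst.symm
      | exact htt
      | exact htt.symm
  have hab' : cs'.simple a * cs'.simple b = cs'.simple b * cs'.simple a := by
    have h1 := hcom _ (key a (by simp [hd])) _ (key b (by simp [hd]))
    rw [← map_mul, ← map_mul] at h1
    have h2 := φ.symm.injective h1
    have h3 : y * (y⁻¹ * cs'.simple a * y * (y⁻¹ * cs'.simple b * y)) * y⁻¹ =
      y * (y⁻¹ * cs'.simple b * y * (y⁻¹ * cs'.simple a * y)) * y⁻¹ := by rw [h2]
    simpa [mul_assoc] using h3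
  have hM' := eq_two_of_commute cs' a b hab hab'
  have hcab : c = cs'.simple a * cs'.simple b := by
    have h1 := hc.1.mem
    rw [hd] at h1
    rcases par_pair cs' hab' h1 with h | h | h | h
    · exact absurd h hc.2.1
    · exact absurd (h ▸ cs'.isReflection_simple a) hc.2.2
    · exact absurd (h ▸ cs'.isReflection_simple b) hc.2.2
    · exact h
  have ht : y * φ (cs.simple t) * y⁻¹ ∈ Par cs' {a, b} := by
    rw [← hd]
    apply cent_mem hdim' hc
    rw [← hx, ← map_mul, ← map_mul, hcomm]
  have hback : ∀ g, y * φ (cs.simple t) * y⁻¹ = g → φ (cs.simple t) = y⁻¹ * g * (y⁻¹)⁻¹ := by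
    rintro g rfl; simp [mul_assoc]
  have hx' : φ (cs.simple s) = y⁻¹ * (cs'.simple a * cs'.simple b) * (y⁻¹)⁻¹ := by
    rw [hx, hcab, inv_inv]
  rcases par_pair cs' hab' ht with h | h | h | h
  · have := hback _ h
    simp only [mul_one, mul_inv_cancel] at this
    exact absurd this (img_invol φ t).2
  · refine ⟨(t, b, a), y⁻¹, step5 hdim hdim' φ s t hs hts hM b a hab.symm ?_ _ ?_ (hback _ h)⟩
    · rw [M'.symmetric b a]; exact hM'
    · rw [hx', hab']
  · exact ⟨(t, a, b), y⁻¹, step5 hdim hdim' φ s t hs hts hM a b hab hM' _ hx' (hback _ h)⟩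
  · have := hback _ h
    rw [← hx'] at this
    exact absurd (φ.injective this) (simple_inj cs hts)

theorem uniqueness (φ : W ≃* W') (s : B) {p q : B × B' × B'} {w v : W'}
    (hp : Good cs cs' φ s p w) (hq : Good cs cs' φ s q v) : q = p := by
  obtain ⟨t, a, b⟩ := p
  obtain ⟨t₂, a₂, b₂⟩ := q
  obtain ⟨p1, p2, -, p4, p5, p6, p7⟩ := hp
  obtain ⟨q1, q2, -, q4, q5, q6, q7⟩ := hq
  simp only at p1 p2 p4 p5 p6 p7 q1 q2 q4 q5 q6 q7
  have ht : t₂ = t := by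
    by_contra h
    have hne : t₂ ≠ s := by
      rintro rfl
      rw [M.diagonal] at q1
      omega
    have := p2 t₂ hne h
    omega
  subst ht
  have hba : b ≠ a := by
    rintro rfl
    rw [M'.diagonal] at p4
    omega
  obtain ⟨η, h1, h2⟩ := exists_eta cs' a (fun u hu => by
    by_cases hub : u = b
    · subst hub; exact Or.inl p4
    · exact Or.inr (p5 u hu hub))
  have conjη : ∀ g x : W', η (g * x * g⁻¹) = η x := by
    intro g x
    rw [map_mul, map_mul, map_inv, mul_comm, inv_mul_cancel_left]
  have e1 := congrArg η (p6.symm.trans q6)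
  have e2 := congrArg η (p7.symm.trans q7)
  rw [conjη, conjη] at e1 e2
  rw [map_mul, map_mul, ← e2, h1, h2 b hba, mul_one, mul_one] at e1
  have ha : a₂ = a := by
    by_contra h
    rw [h2 a₂ h] at e1
    exact eta_ne e1
  subst ha
  have hb : b₂ = b := by
    by_contra h
    have hne : b₂ ≠ a₂ := by
      rintro rfl
      rw [M'.diagonal] at q4
      omega
    have := p5 b₂ hne h
    omega
  subst hb
  rfl
end

end Cox17


/-- Main Theorem 1 of the paper. Let `(W,S)`, `(W',S')` be Coxeter systems with
two-dimensional Davis–Vinberg complexes and `φ : W ≃* W'`. If `φ(s)` is not a reflection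
of `(W',S')`, then there exist unique `t ∈ S` and `s',t' ∈ S'` and some `w' ∈ W'` with:
`m(s,t) = 2`; `m(s,u) = ∞` for `u ∉ {s,t}`; `φ(W_{{s,t}}) = w' W'_{{s',t'}} w'⁻¹`;
`m'(s',t') = 2`; `m'(s',u') = ∞` for `u' ∉ {s',t'}`; `φ(s) = w' s' t' w'⁻¹`; and
`φ(t) = w' t' w'⁻¹`. -/
theorem stmt_17 {B B' : Type*} {W W' : Type*} [Group W] [Group W'] [Finite B] [Finite B']
    {M : CoxeterMatrix B} {M' : CoxeterMatrix B'}
    (cs : CoxeterSystem M W) (cs' : CoxeterSystem M' W')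
    (hdim : ∀ T : Set B, 2 < T.ncard → (Subgroup.closure (cs.simple '' T) : Set W).Infinite)
    (hdim' : ∀ T' : Set B', 2 < T'.ncard →
      (Subgroup.closure (cs'.simple '' T') : Set W').Infinite)
    (φ : W ≃* W') (s : B) (hs : ¬ cs'.IsReflection (φ (cs.simple s))) :
    ∃! p : B × B' × B', ∃ w' : W',
      M s p.1 = 2 ∧
      (∀ u : B, u ≠ s → u ≠ p.1 → M s u = 0) ∧
      (Subgroup.closure (cs.simple '' {s, p.1})).map φ.toMonoidHom =
        (Subgroup.closure (cs'.simple '' {p.2.1, p.2.2})).map (MulAut.conj w').toMonoidHom ∧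
      M' p.2.1 p.2.2 = 2 ∧
      (∀ u' : B', u' ≠ p.2.1 → u' ≠ p.2.2 → M' p.2.1 u' = 0) ∧
      φ (cs.simple s) = w' * (cs'.simple p.2.1 * cs'.simple p.2.2) * w'⁻¹ ∧
      φ (cs.simple p.1) = w' * cs'.simple p.2.2 * w'⁻¹ := by
  obtain ⟨p, w, h⟩ := Cox17.existence (cs := cs) (cs' := cs') hdim hdim' φ s hs
  refine ⟨p, ⟨w, h⟩, ?_⟩
  rintro q ⟨v, hv⟩
  exact Cox17.uniqueness (cs := cs) (cs' := cs') φ s h hv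
end

section
/- Let W be a group admitting two Coxeter generating sets S and S' such that in both systems every subset of more than 2 generators generates an infinite subgroup. Then there exists S'' ⊆ W such that (W,S'') is a Coxeter system isomorphic to (W,S) and the set of reflections of (W,S'') equals the set of reflections of (W,S'). -/
namespace Cox

open CoxeterSystem

variable {B : Type*} {W : Type*} [Group W] [Fintype B] [DecidableEq B]
  {M : CoxeterMatrix B}

noncomputable section

/-- The matrix `-2 cos (π / m)`; the convention `π / 0 = 0` handles `m = ∞`. -/
def K (M : CoxeterMatrix B) : Matrix B B ℝ :=
  Matrix.of fun i j => -2 * Real.cos (Real.pi / (M i j : ℝ))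

/-- (Twice) the canonical bilinear form. -/
def Q (M : CoxeterMatrix B) : LinearMap.BilinForm ℝ (B → ℝ) := Matrix.toBilin' (K M)

/-- Simple roots. -/
def e (i : B) : B → ℝ := Pi.single i 1

theorem Q_e (i j : B) : Q M (e i) (e j) = -2 * Real.cos (Real.pi / (M i j : ℝ)) := by
  simp [Q, e, K, Matrix.toBilin'_single]

theorem Q_self (i : B) : Q M (e i) (e i) = 2 := by
  rw [Q_e]; simp

theorem Q_symm (v w : B → ℝ) : Q M v w = Q M w v := by
  simp only [Q, Matrix.toBilin'_apply]
  rw [Finset.sum_comm]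
  refine Finset.sum_congr rfl fun i _ => Finset.sum_congr rfl fun j _ => ?_
  simp only [K, Matrix.of_apply, M.symmetric i j]
  ring

/-- Simple reflections in the geometric representation. -/
def sig (M : CoxeterMatrix B) (i : B) : Module.End ℝ (B → ℝ) :=
  LinearMap.id - (Q M (e i)).smulRight (e i)

theorem sig_apply (i : B) (v : B → ℝ) : sig M i v = v - Q M (e i) v • e i := by
  simp [sig]

theorem sig_e (i : B) : sig M i (e i) = - e i := by
  rw [sig_apply, Q_self]; module

theorem sig_sig (i : B) (v : B → ℝ) : sig M i (sig M i v) = v := by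
  rw [sig_apply, sig_apply]
  simp only [map_sub, map_smul, Q_self, smul_eq_mul]
  module

theorem Q_sig (i : B) (v w : B → ℝ) : Q M (sig M i v) (sig M i w) = Q M v w := by
  simp only [sig_apply, map_sub, map_smul, LinearMap.sub_apply, LinearMap.smul_apply, Q_self,
    smul_eq_mul, Q_symm v (e i)]
  ring

theorem sin_ne {m : ℕ} (hm : 2 ≤ m) : Real.sin (Real.pi / m) ≠ 0 := by
  have h2 : (2 : ℝ) ≤ m := by exact_mod_cast hm
  apply ne_of_gt
  apply Real.sin_pos_of_pos_of_lt_pi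
  · positivity
  · rw [div_lt_iff₀ (by linarith)]
    nlinarith [Real.pi_pos]

theorem pow_e {i j : B} (hm : 2 ≤ M i j) (k : ℕ) :
    Real.sin (Real.pi / M i j) • ((sig M i * sig M j) ^ k) (e i) =
        Real.sin ((2 * k + 1) * (Real.pi / M i j)) • e i
          + Real.sin ((2 * k) * (Real.pi / M i j)) • e j ∧
    Real.sin (Real.pi / M i j) • ((sig M i * sig M j) ^ k) (e j) =
        -Real.sin ((2 * k) * (Real.pi / M i j)) • e i
          - Real.sin ((2 * k - 1) * (Real.pi / M i j)) • e j := by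
  set θ := Real.pi / M i j with hθ
  have hs : Real.sin θ ≠ 0 := sin_ne hm
  have hij : Q M (e i) (e j) = -2 * Real.cos θ := by rw [Q_e]
  have hji : Q M (e j) (e i) = -2 * Real.cos θ := by rw [Q_symm, Q_e]
  induction k with
  | zero => simp
  | succ k ih =>
    have h1 : ∀ x : ℝ, Real.sin (x + θ) = 2 * Real.cos θ * Real.sin x - Real.sin (x - θ) := by
      intro x; rw [Real.sin_add, Real.sin_sub]; ring
    have a1 := h1 ((2 * k + 1) * θ)
    have a2 := h1 ((2 * k + 2) * θ)
    have a0 := h1 ((2 * k) * θ)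
    rw [show (2 * (k:ℝ) + 1) * θ + θ = (2 * k + 2) * θ by ring,
      show (2 * (k:ℝ) + 1) * θ - θ = (2 * k) * θ by ring] at a1
    rw [show (2 * (k:ℝ) + 2) * θ + θ = (2 * k + 3) * θ by ring,
      show (2 * (k:ℝ) + 2) * θ - θ = (2 * k + 1) * θ by ring] at a2
    rw [show (2 * (k:ℝ)) * θ + θ = (2 * k + 1) * θ by ring,
      show (2 * (k:ℝ)) * θ - θ = (2 * k - 1) * θ by ring] at a0
    obtain ⟨ih1, ih2⟩ := ih
    have hstep : ∀ x, Real.sin θ • ((sig M i * sig M j) ^ (k + 1)) x =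
        sig M i (sig M j (Real.sin θ • ((sig M i * sig M j) ^ k) x)) := by
      intro x
      rw [pow_succ', Module.End.mul_apply, Module.End.mul_apply, map_smul, map_smul]
    rw [hstep, hstep, ih1, ih2]
    push_cast
    rw [show (2 * ((k:ℝ) + 1) + 1) * θ = (2 * k + 3) * θ by ring,
      show (2 * ((k:ℝ) + 1)) * θ = (2 * k + 2) * θ by ring,
      show (2 * ((k:ℝ) + 1) - 1) * θ = (2 * k + 1) * θ by ring, a2, a1, a0]
    simp only [sig_apply, map_add, map_sub, map_smul, hij, hji, Q_self,
      smul_eq_mul, map_neg]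
    constructor
    · module
    · module

theorem liftable (M : CoxeterMatrix B) : M.IsLiftable (sig M) := by
  intro i j
  by_cases hij : i = j
  · subst hij
    simp only [CoxeterMatrix.diagonal, pow_one]
    ext1 v
    ext1
    simp [sig_sig]
  by_cases h0 : M i j = 0
  · rw [h0, pow_zero]
  have hm : 2 ≤ M i j := by
    have := M.off_diagonal i j hij
    change M i j ≠ 1 at this
    omega
  set θ := Real.pi / M i j with hθ
  have hs : Real.sin θ ≠ 0 := sin_ne hm
  have hmθ : (M i j : ℝ) * θ = Real.pi := by
    rw [hθ]; field_simp
  obtain ⟨h1, h2⟩ := pow_e hm (M i j)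
  rw [← hθ] at h1 h2
  have e1 : (2 * (M i j : ℝ)) * θ = 2 * Real.pi := by rw [mul_assoc, hmθ]
  have e2 : (2 * (M i j : ℝ) + 1) * θ = θ + 2 * Real.pi := by rw [add_mul, e1]; ring
  have e3 : (2 * (M i j : ℝ) - 1) * θ = -θ + 2 * Real.pi := by rw [sub_mul, e1]; ring
  rw [e1, e2, Real.sin_add_two_pi, Real.sin_two_pi] at h1
  rw [e1, e3, Real.sin_add_two_pi, Real.sin_two_pi, Real.sin_neg] at h2
  have g1 : ((sig M i * sig M j) ^ (M i j)) (e i) = e i := by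
    apply smul_right_injective _ hs
    simpa using h1
  have g2 : ((sig M i * sig M j) ^ (M i j)) (e j) = e j := by
    apply smul_right_injective _ hs
    simpa using h2
  have hQij : Q M (e i) (e j) = -2 * Real.cos θ := by rw [Q_e]
  have hQji : Q M (e j) (e i) = -2 * Real.cos θ := by rw [Q_symm, Q_e]
  have hsc := Real.sin_sq_add_cos_sq θ
  apply LinearMap.ext
  intro z
  obtain ⟨p, q, hp, hq⟩ : ∃ p q : ℝ, Q M (e i) (z - p • e i - q • e j) = 0 ∧
      Q M (e j) (z - p • e i - q • e j) = 0 := by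
    refine ⟨(Q M (e i) z + Real.cos θ * Q M (e j) z) / (2 * Real.sin θ ^ 2),
      (Q M (e j) z + Real.cos θ * Q M (e i) z) / (2 * Real.sin θ ^ 2), ?_, ?_⟩
    · simp only [map_sub, map_smul, Q_self, hQij, smul_eq_mul]
      field_simp
      linear_combination (Q M (e i) z) * hsc
    · simp only [map_sub, map_smul, Q_self, hQji, smul_eq_mul]
      field_simp
      linear_combination (Q M (e j) z) * hsc
  have hz : ∀ k : ℕ, ((sig M i * sig M j) ^ k) (z - p • e i - q • e j) =
      z - p • e i - q • e j := by
    intro k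
    induction k with
    | zero => simp
    | succ k ih =>
      rw [pow_succ', Module.End.mul_apply, ih, Module.End.mul_apply, sig_apply j, hq, zero_smul,
        sub_zero, sig_apply i, hp, zero_smul, sub_zero]
  have := hz (M i j)
  simp only [map_sub, map_smul, g1, g2] at this
  simpa using this

variable (cs : CoxeterSystem M W)

/-- The geometric representation. -/
def rep : W →* Module.End ℝ (B → ℝ) := cs.lift ⟨sig M, liftable M⟩

theorem rep_simple (i : B) : rep cs (cs.simple i) = sig M i := by
  simp [rep]

theorem rep_mul (v w : W) (x : B → ℝ) : rep cs (v * w) x = rep cs v (rep cs w x) := by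
  rw [map_mul, Module.End.mul_apply]

theorem rep_inv_rep (v : W) (x : B → ℝ) : rep cs v⁻¹ (rep cs v x) = x := by
  rw [← rep_mul]; simp

theorem rep_rep_inv (v : W) (x : B → ℝ) : rep cs v (rep cs v⁻¹ x) = x := by
  rw [← rep_mul]; simp

theorem Q_rep (g : W) (v w : B → ℝ) : Q M (rep cs g v) (rep cs g w) = Q M v w := by
  induction g using cs.simple_induction_left generalizing v w with
  | one => simp
  | mul_simple_left g i ih => rw [rep_mul, rep_mul, rep_simple, Q_sig, ih]

/-- Chebyshev-type sequence. -/
def U (c : ℝ) : ℕ → ℝ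
  | 0 => 0
  | 1 => 1
  | (n + 2) => c * U c (n + 1) - U c n

theorem U_sin (θ : ℝ) (n : ℕ) : U (2 * Real.cos θ) n * Real.sin θ = Real.sin (n * θ) := by
  induction n using Nat.twoStepInduction with
  | zero => simp [U]
  | one => simp [U]
  | more n h0 h1 =>
    rw [U, sub_mul, mul_assoc, h1, h0]
    push_cast
    rw [show ((n : ℝ) + 2) * θ = (n + 1) * θ + θ by ring, Real.sin_add,
      show (n : ℝ) * θ = (n + 1) * θ - θ by ring, Real.sin_sub]
    ring

theorem U_two (n : ℕ) : U 2 n = n := by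
  induction n using Nat.twoStepInduction with
  | zero => simp [U]
  | one => simp [U]
  | more n h0 h1 => rw [U, h0, h1]; push_cast; ring

theorem U_nonneg {m : ℕ} (hm : m ≠ 1) {n : ℕ} (hn : m = 0 ∨ n ≤ m) :
    0 ≤ U (2 * Real.cos (Real.pi / m)) n := by
  by_cases h0 : m = 0
  · subst h0; simp [U_two]
  have hm2 : 2 ≤ m := by omega
  have hn : n ≤ m := by omega
  have hs := sin_ne hm2
  have hmp : (0 : ℝ) < m := by positivity
  have hle : Real.pi / m ≤ Real.pi := by
    apply div_le_self Real.pi_pos.le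
    exact_mod_cast (by omega : 1 ≤ m)
  have hs' : 0 < Real.sin (Real.pi / m) :=
    lt_of_le_of_ne (Real.sin_nonneg_of_nonneg_of_le_pi (by positivity) hle) hs.symm
  have := U_sin (Real.pi / m) n
  have h2 : 0 ≤ Real.sin (n * (Real.pi / m)) := by
    apply Real.sin_nonneg_of_nonneg_of_le_pi (by positivity)
    rw [mul_div_assoc', div_le_iff₀ hmp, mul_comm]
    have : (n : ℝ) ≤ m := by exact_mod_cast hn
    gcongr
  rw [← this] at h2
  exact nonneg_of_mul_nonneg_left h2 hs'

theorem rep_alt (i j : B) (n : ℕ) :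
    rep cs (cs.wordProd (alternatingWord i j n)) (e i) =
      if Even n then U (2 * Real.cos (Real.pi / M i j)) (n + 1) • e i
          + U (2 * Real.cos (Real.pi / M i j)) n • e j
      else U (2 * Real.cos (Real.pi / M i j)) n • e i
          + U (2 * Real.cos (Real.pi / M i j)) (n + 1) • e j := by
  have hQij : Q M (e i) (e j) = -2 * Real.cos (Real.pi / M i j) := by rw [Q_e]
  have hQji : Q M (e j) (e i) = -2 * Real.cos (Real.pi / M i j) := by rw [Q_symm, Q_e]
  induction n with
  | zero => simp [alternatingWord, U]
  | succ n ih =>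
    rw [alternatingWord_succ', wordProd_cons, rep_mul, ih]
    by_cases h : Even n
    · have h' : ¬ Even (n + 1) := by simpa [Nat.even_add_one] using h
      simp only [h, h', if_true, if_false, rep_simple, sig_apply, map_add, map_smul, Q_self, hQji, U]
      module
    · have h' : Even (n + 1) := by simpa [Nat.even_add_one] using h
      simp only [h, h', if_true, if_false, rep_simple, sig_apply, map_add, map_smul, Q_self, hQij, U]
      module

end

end Cox

namespace Cox

open CoxeterSystem

variable {B : Type*} {W : Type*} [Group W] [Fintype B] [DecidableEq B]
  {M : CoxeterMatrix B} (cs : CoxeterSystem M W)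

theorem length_alt_le (i j : B) (n : ℕ) : cs.length (cs.wordProd (alternatingWord i j n)) ≤ n := by
  simpa using cs.length_wordProd_le (alternatingWord i j n)

/-- The fundamental positivity theorem. -/
theorem rep_nonneg (w : W) (i : B) (h : ¬ cs.IsRightDescent w i) : 0 ≤ rep cs w (e i) := by
  induction hn : cs.length w using Nat.strong_induction_on generalizing w i with
  | _ N ih =>
  subst hn
  by_cases hw : w = 1
  · subst hw
    simp [e]
  obtain ⟨j, hj⟩ := cs.exists_rightDescent_of_ne_one hw
  have hij : i ≠ j := by rintro rfl; exact h hj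
  let P : ℕ → Prop := fun n => ∃ v, w = v * cs.wordProd (alternatingWord i j n) ∧
    cs.length v + n = cs.length w
  have hP1 : P 1 := by
    refine ⟨w * cs.simple j, ?_, ?_⟩
    · simp [alternatingWord]
    · exact cs.isRightDescent_iff.1 hj
  have hdown : ∀ n, P (n + 1) → P n := by
    rintro n ⟨v, hv, hl⟩
    rw [alternatingWord_succ', wordProd_cons, ← mul_assoc] at hv
    refine ⟨_, hv, ?_⟩
    have h1 := cs.length_mul_le v (cs.simple (if Even n then j else i))
    rw [length_simple] at h1
    have h2 := cs.length_mul_le (v * cs.simple (if Even n then j else i))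
      (cs.wordProd (alternatingWord i j n))
    rw [← hv] at h2
    have h3 := length_alt_le cs i j n
    omega
  have hdown' : ∀ n m, m ≤ n → P n → P m := by
    intro n m hmn
    induction hmn with
    | refl => exact id
    | step _ ih => exact fun h => ih (hdown _ h)
  obtain ⟨n, hPn, hPn1⟩ : ∃ n, P (n + 1) ∧ ¬ P (n + 2) := by
    by_contra hcon
    push Not at hcon
    have : ∀ n, P (n + 1) := by
      intro n
      induction n with
      | zero => exact hP1
      | succ n ih => exact hcon n ih
    obtain ⟨v, _, hl⟩ := this (cs.length w)
    omega
  have hbound : M i j = 0 ∨ n + 1 < M i j := by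
    by_contra hcon
    push Not at hcon
    obtain ⟨hm0, hle⟩ := hcon
    obtain ⟨m', hm'⟩ := Nat.exists_eq_succ_of_ne_zero hm0
    obtain ⟨u, hu, hl⟩ := hdown' _ _ hle hPn
    have hb := cs.wordProd_braidWord_eq i j
    simp only [braidWord, M.symmetric j i] at hb
    rw [hb, hm', Nat.succ_eq_add_one, alternatingWord_succ, wordProd_concat] at hu
    apply h
    have h3 := length_alt_le cs i j m'
    have h4 := cs.length_mul_le u (cs.wordProd (alternatingWord i j m'))
    have : w * cs.simple i = u * cs.wordProd (alternatingWord i j m') := by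
      rw [hu, ← mul_assoc, simple_mul_simple_cancel_right]
    rw [IsRightDescent, this]
    omega
  obtain ⟨v, hv, hl⟩ := hPn
  have hd1 : ¬ cs.IsRightDescent v (if Even (n + 1) then j else i) := by
    intro hd
    apply hPn1
    refine ⟨v * cs.simple (if Even (n + 1) then j else i), ?_, ?_⟩
    · rw [alternatingWord_succ' i j (n + 1), wordProd_cons, ← mul_assoc,
        simple_mul_simple_cancel_right, ← hv]
    · have := cs.isRightDescent_iff.1 hd
      omega
  have hd2 : ¬ cs.IsRightDescent v (if Even n then j else i) := by
    intro hd
    have := cs.isRightDescent_iff.1 hd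
    rw [alternatingWord_succ', wordProd_cons, ← mul_assoc] at hv
    have h2 := cs.length_mul_le (v * cs.simple (if Even n then j else i))
      (cs.wordProd (alternatingWord i j n))
    rw [← hv] at h2
    have h3 := length_alt_le cs i j n
    omega
  have hdi : ¬ cs.IsRightDescent v i ∧ ¬ cs.IsRightDescent v j := by
    by_cases hev : Even n
    · have h' : ¬ Even (n + 1) := by simpa [Nat.even_add_one] using hev
      simp only [hev, h', if_true, if_false] at hd1 hd2
      exact ⟨hd1, hd2⟩
    · have h' : Even (n + 1) := by simpa [Nat.even_add_one] using hev
      simp only [hev, h', if_true, if_false] at hd1 hd2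
      exact ⟨hd2, hd1⟩
  have hvi := ih _ (by omega) v i hdi.1 rfl
  have hvj := ih _ (by omega) v j hdi.2 rfl
  have hm1 : M i j ≠ 1 := M.off_diagonal i j hij
  have hU1 := U_nonneg hm1 (n := n + 1) (by omega)
  have hU2 := U_nonneg hm1 (n := n + 1 + 1) (by omega)
  rw [hv, rep_mul, rep_alt]
  split_ifs
  · rw [map_add, map_smul, map_smul]
    exact add_nonneg (smul_nonneg hU2 hvi) (smul_nonneg hU1 hvj)
  · rw [map_add, map_smul, map_smul]
    exact add_nonneg (smul_nonneg hU1 hvi) (smul_nonneg hU2 hvj)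

theorem rep_nonpos (w : W) (i : B) (h : cs.IsRightDescent w i) : rep cs w (e i) ≤ 0 := by
  have := rep_nonneg cs (w * cs.simple i) i (by
    rw [← cs.isRightDescent_iff_not_isRightDescent_mul]; exact h)
  rw [rep_mul, rep_simple, sig_e, map_neg] at this
  exact neg_nonneg.1 this

/-- Roots. -/
def IsRoot (β : B → ℝ) : Prop := ∃ w i, β = rep cs w (e i)

variable {cs}

theorem isRoot_e (i : B) : IsRoot cs (e i) := ⟨1, i, by simp⟩

theorem IsRoot.rep {β : B → ℝ} (h : IsRoot cs β) (g : W) : IsRoot cs (rep cs g β) := by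
  obtain ⟨w, i, rfl⟩ := h
  exact ⟨g * w, i, by rw [rep_mul]⟩

theorem IsRoot.neg {β : B → ℝ} (h : IsRoot cs β) : IsRoot cs (-β) := by
  obtain ⟨w, i, rfl⟩ := h
  exact ⟨w * cs.simple i, i, by rw [rep_mul, rep_simple, sig_e, map_neg]⟩

theorem IsRoot.Q_self {β : B → ℝ} (h : IsRoot cs β) : Q M β β = 2 := by
  obtain ⟨w, i, rfl⟩ := h
  rw [Q_rep, Cox.Q_self]

theorem IsRoot.ne_zero {β : B → ℝ} (h : IsRoot cs β) : β ≠ 0 := by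
  rintro rfl
  have := h.Q_self
  simp at this

theorem IsRoot.nonneg_or {β : B → ℝ} (h : IsRoot cs β) : 0 ≤ β ∨ β ≤ 0 := by
  obtain ⟨w, i, rfl⟩ := h
  by_cases hd : cs.IsRightDescent w i
  · exact Or.inr (rep_nonpos cs w i hd)
  · exact Or.inl (rep_nonneg cs w i hd)

theorem e_nonneg (i : B) : (0 : B → ℝ) ≤ e i := by simp [e]

theorem IsRoot.not_both {β : B → ℝ} (h : IsRoot cs β) (h1 : 0 ≤ β) (h2 : β ≤ 0) : False :=
  h.ne_zero (le_antisymm h2 h1)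

theorem e_apply_ne {i j : B} (h : j ≠ i) : (e i : B → ℝ) j = 0 := by simp [e, h]

theorem e_apply_self (i : B) : (e i : B → ℝ) i = 1 := by simp [e]

/-- A positive root supported on `i` only is `e i`. -/
theorem IsRoot.eq_e {β : B → ℝ} (h : IsRoot cs β) (h0 : 0 ≤ β) {i : B}
    (hs : ∀ j, j ≠ i → β j = 0) : β = e i := by
  have hβ : β = β i • e i := by
    funext j
    by_cases hj : j = i
    · subst hj; simp [e]
    · simp [e, hj, hs j hj]
  have hq := h.Q_self
  rw [hβ] at hq
  simp only [map_smul, LinearMap.smul_apply, Cox.Q_self, smul_eq_mul] at hq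
  have h0i : 0 ≤ β i := h0 i
  have : β i = 1 := by nlinarith
  rw [hβ, this, one_smul]

/-- A simple reflection permutes the positive roots other than its own. -/
theorem IsRoot.sig_nonneg {β : B → ℝ} (h : IsRoot cs β) (h0 : 0 ≤ β) {i : B} (hne : β ≠ e i) :
    0 ≤ sig M i β := by
  obtain ⟨j, hji, hj⟩ : ∃ j, j ≠ i ∧ β j ≠ 0 := by
    by_contra hcon
    push Not at hcon
    exact hne (h.eq_e h0 hcon)
  have hr : IsRoot cs (sig M i β) := by rw [← rep_simple cs]; exact h.rep _
  rcases hr.nonneg_or with h1 | h1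
  · exact h1
  · exfalso
    have h2 := h1 j
    rw [sig_apply] at h2
    simp only [Pi.sub_apply, Pi.smul_apply, e_apply_ne hji, smul_zero, sub_zero,
      Pi.zero_apply] at h2
    exact hj (le_antisymm h2 (h0 j))

variable (cs)

/-- Positive roots made negative by `g`. -/
def Inv (g : W) : Set (B → ℝ) := {β | IsRoot cs β ∧ 0 ≤ β ∧ rep cs g β ≤ 0}

theorem Inv_finite (g : W) : (Inv cs g).Finite := by
  induction g using cs.simple_induction_right with
  | one =>
    convert Set.finite_empty
    ext β
    simp only [Inv, Set.mem_ofPred_eq, Set.mem_empty_iff_false, iff_false]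
    rintro ⟨h, h1, h2⟩
    exact h.not_both h1 (by simpa using h2)
  | mul_simple_right g i ih =>
    apply ((Set.finite_singleton (e i)).union (ih.image (sig M i))).subset
    rintro β ⟨h, h1, h2⟩
    by_cases hne : β = e i
    · left; exact hne
    · right
      refine ⟨sig M i β, ⟨?_, h.sig_nonneg h1 hne, ?_⟩, sig_sig i β⟩
      · rw [← rep_simple cs]; exact h.rep _
      · rwa [rep_mul, rep_simple] at h2

theorem exists_neg {g : W} (hg : g ≠ 1) : ∃ i, rep cs g (e i) ≤ 0 := by
  obtain ⟨i, hi⟩ := cs.exists_rightDescent_of_ne_one hg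
  exact ⟨i, rep_nonpos cs g i hi⟩

theorem rep_faithful {g : W} (hg : ∀ v, rep cs g v = v) : g = 1 := by
  by_contra hne
  obtain ⟨i, hi⟩ := exists_neg cs hne
  rw [hg] at hi
  exact (isRoot_e (cs := cs) i).not_both (e_nonneg i) hi

theorem Inv_subset {g g' : W} (h : Inv cs g = Inv cs g') : g = g' := by
  by_contra hne
  have hne' : g * g'⁻¹ ≠ 1 := by rwa [Ne, mul_inv_eq_one]
  obtain ⟨i, hi⟩ := exists_neg cs hne'
  rw [rep_mul] at hi
  have hr : IsRoot cs (rep cs g'⁻¹ (e i)) := (isRoot_e i).rep _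
  have hr2 : IsRoot cs (rep cs g (rep cs g'⁻¹ (e i))) := hr.rep _
  rcases hr.nonneg_or with h1 | h1
  · have : rep cs g'⁻¹ (e i) ∈ Inv cs g' := h ▸ ⟨hr, h1, hi⟩
    have h2 := this.2.2
    rw [rep_rep_inv] at h2
    exact (isRoot_e (cs := cs) i).not_both (e_nonneg i) h2
  · have : -rep cs g'⁻¹ (e i) ∈ Inv cs g := by
      rw [h]
      refine ⟨hr.neg, neg_nonneg.2 h1, ?_⟩
      rw [map_neg, rep_rep_inv]
      exact neg_nonpos.2 (e_nonneg i)
    have h2 := this.2.2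
    rw [map_neg] at h2
    exact hr2.not_both (neg_nonpos.1 h2) hi

theorem sum_pos {v : B → ℝ} (h0 : 0 ≤ v) (hne : v ≠ 0) : 0 < ∑ i, v i := by
  apply lt_of_le_of_ne (Finset.sum_nonneg fun i _ => h0 i)
  intro h
  apply hne
  funext i
  exact (Finset.sum_eq_zero_iff_of_nonneg fun i _ => h0 i).1 h.symm i (Finset.mem_univ i)

/-- Every finite subgroup is conjugate into a finite standard parabolic subgroup. -/
theorem finite_subgroup (H : Subgroup W) [Finite H] :
    ∃ (w : W) (T : Set B), (Subgroup.closure (cs.simple '' T) : Set W).Finite ∧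
      ∀ h ∈ H, w⁻¹ * h * w ∈ Subgroup.closure (cs.simple '' T) := by
  classical
  have := Fintype.ofFinite H
  let ρ : (B → ℝ) →ₗ[ℝ] ℝ := ∑ i, LinearMap.proj i
  have hρ : ∀ v, ρ v = ∑ i, v i := by intro v; simp [ρ]
  let x : (B → ℝ) →ₗ[ℝ] ℝ := ∑ h : H, ρ ∘ₗ (rep cs (h : W))
  have hx : ∀ v, x v = ∑ h : H, ∑ i, rep cs (h : W) v i := by
    intro v; simp [x, hρ]
  have hxH : ∀ h ∈ H, ∀ v, x (rep cs h v) = x v := by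
    intro h hh v
    rw [hx, hx]
    apply Fintype.sum_equiv (Equiv.mulRight (⟨h, hh⟩ : H))
    intro k
    simp [rep_mul]
  have hkey : ∀ w : W, ∀ β, IsRoot cs β → 0 ≤ β → x (rep cs w β) ≤ 0 →
      ∃ h : H, β ∈ Inv cs ((h : W) * w) := by
    intro w β hβ h0 hle
    by_contra hcon
    push Not at hcon
    apply not_lt.2 hle
    rw [hx]
    apply Finset.sum_pos _ Finset.univ_nonempty
    intro h _
    have hr : IsRoot cs (rep cs ((h : W) * w) β) := hβ.rep _
    rw [← rep_mul]
    rcases hr.nonneg_or with h1 | h1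
    · exact sum_pos h1 hr.ne_zero
    · exact absurd ⟨hβ, h0, h1⟩ (hcon h)
  let Neg : W → Set (B → ℝ) := fun w => {β | IsRoot cs β ∧ 0 ≤ β ∧ x (rep cs w β) < 0}
  have hfin : ∀ w, (⋃ h : H, Inv cs ((h : W) * w)).Finite := fun w =>
    Set.finite_iUnion fun h => Inv_finite cs _
  have hNeg : ∀ w, (Neg w).Finite := by
    intro w
    apply (hfin w).subset
    rintro β ⟨h1, h2, h3⟩
    exact Set.mem_iUnion.2 (hkey w β h1 h2 h3.le)
  obtain ⟨w, hw⟩ : ∃ w, ∀ w', (Neg w).ncard ≤ (Neg w').ncard := by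
    obtain ⟨w, -, hw⟩ := WellFounded.has_min (measure fun w => (Neg w).ncard).wf
      (Set.univ : Set W) ⟨1, trivial⟩
    exact ⟨w, fun w' => not_lt.1 (hw w' trivial)⟩
  have hdom : ∀ i, 0 ≤ x (rep cs w (e i)) := by
    intro i
    by_contra hneg
    push Not at hneg
    apply not_lt.2 (hw (w * cs.simple i))
    have hinj : Function.Injective (sig M i) := Function.LeftInverse.injective (sig_sig i)
    rw [← Set.ncard_image_of_injective _ hinj]
    apply Set.ncard_lt_ncard _ (hNeg w)
    have hsub : sig M i '' Neg (w * cs.simple i) ⊆ Neg w := by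
      rintro _ ⟨β, ⟨h1, h2, h3⟩, rfl⟩
      rw [rep_mul, rep_simple] at h3
      have hne : β ≠ e i := by
        rintro rfl
        rw [sig_e, map_neg, map_neg] at h3
        linarith
      refine ⟨?_, h1.sig_nonneg h2 hne, h3⟩
      rw [← rep_simple cs]; exact h1.rep _
    refine Set.ssubset_iff_subset_ne.2 ⟨hsub, fun heq => ?_⟩
    have hmem : e i ∈ Neg w := ⟨isRoot_e i, e_nonneg i, hneg⟩
    rw [← heq] at hmem
    obtain ⟨β, ⟨h1, h2, h3⟩, h4⟩ := hmem
    have : β = - e i := by rw [← sig_e (M := M) i, ← h4, sig_sig]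
    rw [this] at h2
    exact (isRoot_e (cs := cs) i).not_both (e_nonneg i) (neg_nonneg.1 h2)
  let y : (B → ℝ) →ₗ[ℝ] ℝ := x ∘ₗ rep cs w
  have hy : ∀ v, y v = x (rep cs w v) := fun v => rfl
  have hynn : ∀ v : B → ℝ, 0 ≤ v → 0 ≤ y v := by
    intro v hv
    have : v = ∑ i, v i • e i := by
      funext j
      simp [e, Finset.sum_apply, Pi.single_apply]
    rw [this, map_sum]
    refine Finset.sum_nonneg fun i _ => ?_
    rw [map_smul]
    exact mul_nonneg (hv i) (hdom i)
  have hynp : ∀ v : B → ℝ, v ≤ 0 → y v ≤ 0 := by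
    intro v hv
    have := hynn (-v) (neg_nonneg.2 hv)
    rw [map_neg] at this
    linarith
  let T : Set B := {i | y (e i) = 0}
  have hT : ∀ i ∈ T, ∀ v, y (sig M i v) = y v := by
    intro i hi v
    have hi : y (e i) = 0 := hi
    rw [sig_apply, map_sub, map_smul, hi, smul_zero, sub_zero]
  refine ⟨w, T, ?_, ?_⟩
  · have hstab : ∀ g ∈ Subgroup.closure (cs.simple '' T), ∀ v, y (rep cs g v) = y v := by
      intro g hg
      induction hg using Subgroup.closure_induction with
      | mem g hg =>
        obtain ⟨i, hi, rfl⟩ := hg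
        intro v
        rw [rep_simple, hT i hi]
      | one => simp
      | mul a b _ _ ha hb => intro v; rw [rep_mul, ha, hb]
      | inv a _ ha => intro v; rw [← ha, rep_rep_inv]
    have hpow : (𝒫 (⋃ h : H, Inv cs ((h : W) * w))).Finite := (hfin w).finite_subsets
    apply Set.Finite.of_finite_image (f := Inv cs) _ (fun a _ b _ hab => Inv_subset cs hab)
    apply hpow.subset
    rintro _ ⟨g, hg, rfl⟩
    rintro β ⟨h1, h2, h3⟩
    apply Set.mem_iUnion.2
    apply hkey w β h1 h2
    rw [← hy, ← hstab g hg]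
    exact hynp _ h3
  · have hmem : ∀ n, ∀ g, cs.length g = n → (∀ v, y (rep cs g v) = y v) →
        g ∈ Subgroup.closure (cs.simple '' T) := by
      intro n
      induction n with
      | zero =>
        intro g hg _
        rw [cs.length_eq_zero_iff] at hg
        subst hg
        exact one_mem _
      | succ n ih =>
        intro g hg hst
        have hne : g ≠ 1 := by
          rintro rfl
          simp at hg
        obtain ⟨i, hi⟩ := cs.exists_rightDescent_of_ne_one hne
        have h1 := hynp _ (rep_nonpos cs g i hi)
        rw [hst] at h1
        have hiT : i ∈ T := le_antisymm h1 (hdom i)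
        have h2 := ih (g * cs.simple i) (by have := cs.isRightDescent_iff.1 hi; omega) (by
          intro v; rw [rep_mul, rep_simple, hst, hT i hiT])
        have h3 := mul_mem h2 (Subgroup.subset_closure (Set.mem_image_of_mem cs.simple hiT))
        rwa [simple_mul_simple_cancel_right] at h3
    intro h hh
    apply hmem _ _ rfl
    intro v
    rw [hy, hy, rep_mul, rep_mul, rep_rep_inv, hxH h hh]

end Cox

namespace Cox

open CoxeterSystem

section Dihedral

variable {W : Type*} [Group W]

theorem dihedral_mem {p q x : W} (hp : p * p = 1) (hq : q * q = 1)
    (hx : x ∈ Subgroup.closure ({p, q} : Set W)) :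
    ∃ k : ℤ, x = (p * q) ^ k ∨ x = (p * q) ^ k * p := by
  have hpi : p⁻¹ = p := inv_eq_of_mul_eq_one_left hp
  have hqi : q⁻¹ = q := inv_eq_of_mul_eq_one_left hq
  have hc : ∀ l : ℤ, p * (p * q) ^ l = (p * q) ^ (-l) * p := by
    intro l
    have h1 : p * (p * q) * p⁻¹ = (p * q)⁻¹ := by
      rw [mul_inv_rev, hpi, hqi, ← mul_assoc, hp, one_mul]
    have h2 : (p * (p * q) * p⁻¹) ^ l = p * (p * q) ^ l * p⁻¹ := conj_zpow
    rw [h1, inv_zpow'] at h2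
    rw [h2, inv_mul_cancel_right]
  induction hx using Subgroup.closure_induction with
  | mem x hx =>
    rcases hx with rfl | rfl
    · exact ⟨0, Or.inr (by simp)⟩
    · refine ⟨-1, Or.inr ?_⟩
      rw [zpow_neg_one, mul_inv_rev, inv_mul_cancel_right, hqi]
  | one => exact ⟨0, Or.inl (by simp)⟩
  | mul a b _ _ ha hb =>
    obtain ⟨k, rfl | rfl⟩ := ha <;> obtain ⟨l, rfl | rfl⟩ := hb
    · exact ⟨k + l, Or.inl (zpow_add _ _ _).symm⟩
    · exact ⟨k + l, Or.inr (by rw [zpow_add, mul_assoc])⟩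
    · exact ⟨k + -l, Or.inr (by rw [zpow_add, mul_assoc, hc, mul_assoc])⟩
    · refine ⟨k + -l, Or.inl ?_⟩
      rw [zpow_add, mul_assoc, ← mul_assoc p, hc, mul_assoc _ p p, hp, mul_one]
  | inv a _ ha =>
    obtain ⟨k, rfl | rfl⟩ := ha
    · exact ⟨-k, Or.inl (zpow_neg _ _).symm⟩
    · refine ⟨k, Or.inr ?_⟩
      rw [mul_inv_rev, hpi, ← zpow_neg, hc, neg_neg]

theorem dihedral_cases {p q x : W} (hp : p * p = 1) (hq : q * q = 1)
    (hx : x ∈ Subgroup.closure ({p, q} : Set W)) :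
    (∃ k : ℤ, x = (p * q) ^ k) ∨ (∃ g, x = g * p * g⁻¹) ∨ (∃ g, x = g * q * g⁻¹) := by
  have hpi : p⁻¹ = p := inv_eq_of_mul_eq_one_left hp
  have hqi : q⁻¹ = q := inv_eq_of_mul_eq_one_left hq
  have hc : ∀ l : ℤ, p * ((p * q) ^ l)⁻¹ = (p * q) ^ l * p := by
    intro l
    have h1 : p * (p * q) * p⁻¹ = (p * q)⁻¹ := by
      rw [mul_inv_rev, hpi, hqi, ← mul_assoc, hp, one_mul]
    have h2 : (p * (p * q) * p⁻¹) ^ (-l) = p * (p * q) ^ (-l) * p⁻¹ := conj_zpow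
    rw [h1, inv_zpow', neg_neg, zpow_neg] at h2
    exact mul_inv_eq_iff_eq_mul.1 h2.symm
  obtain ⟨k, rfl | rfl⟩ := dihedral_mem hp hq hx
  · exact Or.inl ⟨k, rfl⟩
  · right
    obtain ⟨j, rfl | rfl⟩ := Int.even_or_odd' k
    · left
      refine ⟨(p * q) ^ j, ?_⟩
      rw [mul_assoc, hc, ← mul_assoc, ← zpow_add, two_mul]
    · right
      refine ⟨(p * q) ^ j * p, ?_⟩
      rw [mul_inv_rev, hpi, mul_assoc _ p q, mul_assoc, hc, ← mul_assoc,
        mul_assoc _ (p * q) _, ← mul_assoc (p * q), ← zpow_one_add, ← mul_assoc, ← zpow_add]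
      congr 2
      ring

theorem klein_cases {p q x : W} (hp : p * p = 1) (hq : q * q = 1) (hpq : p * q = q * p)
    (hx : x ∈ Subgroup.closure ({p, q} : Set W)) :
    x = 1 ∨ x = p ∨ x = q ∨ x = p * q := by
  have h2 : (p * q) ^ (2 : ℤ) = 1 := by
    rw [zpow_two]
    nth_rw 1 [hpq]
    rw [mul_assoc, ← mul_assoc p, hp, one_mul, hq]
  obtain ⟨k, hk⟩ := dihedral_mem hp hq hx
  have hk' : (p * q) ^ k = 1 ∨ (p * q) ^ k = p * q := by
    obtain ⟨j, rfl | rfl⟩ := Int.even_or_odd' k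
    · left; rw [zpow_mul, h2, one_zpow]
    · right; rw [zpow_add, zpow_mul, h2, one_zpow, one_mul, zpow_one]
  rcases hk' with h | h <;> rw [h] at hk
  · rcases hk with rfl | rfl
    · simp
    · simp
  · rcases hk with rfl | rfl
    · simp
    · right; right; left
      rw [hpq, mul_assoc, hp, mul_one]

theorem dihedral_finite {p q : W} (hp : p * p = 1) (hq : q * q = 1) (h : IsOfFinOrder (p * q)) :
    Finite (Subgroup.closure ({p, q} : Set W)) := by
  have hz : (Subgroup.zpowers (p * q) : Set W).Finite := finite_zpowers.2 h
  have : (Subgroup.closure ({p, q} : Set W) : Set W).Finite := by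
    apply (hz.union (hz.image (· * p))).subset
    intro x hx
    obtain ⟨k, rfl | rfl⟩ := dihedral_mem hp hq hx
    · left; exact ⟨k, rfl⟩
    · right; exact ⟨_, ⟨k, rfl⟩, rfl⟩
  exact this.to_subtype

theorem commute_of {p q : W} (hp : p * p = 1) (hq : q * q = 1) (h : (p * q) * (p * q) = 1) :
    p * q = q * p := by
  have hpi : p⁻¹ = p := inv_eq_of_mul_eq_one_left hp
  have hqi : q⁻¹ = q := inv_eq_of_mul_eq_one_left hq
  have := inv_eq_of_mul_eq_one_left h
  rw [mul_inv_rev, hpi, hqi] at this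
  exact this.symm

end Dihedral

section Roots

variable {B : Type*} {W : Type*} [Group W] [Fintype B] [DecidableEq B]
  {M : CoxeterMatrix B} (cs : CoxeterSystem M W)

theorem simple_injective : Function.Injective cs.simple := by
  intro i j h
  by_contra hne
  have h1 := congrArg (fun w => rep cs w (e i) i) h
  simp only [rep_simple] at h1
  rw [sig_e, sig_apply] at h1
  simp only [Pi.neg_apply, Pi.sub_apply, Pi.smul_apply, e_apply_ne hne, e_apply_self, smul_zero] at h1
  norm_num at h1

theorem M_eq_two {i j : B} (hne : i ≠ j)
    (h : cs.simple i * cs.simple j = cs.simple j * cs.simple i) : M i j = 2 := by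
  have h1 := congrArg (fun w => rep cs w (e i) j) h
  simp only [rep_mul, rep_simple] at h1
  rw [sig_e, sig_apply j, sig_apply j] at h1
  simp only [map_sub, map_smul, map_neg, sig_e, sig_apply, Pi.neg_apply, Pi.sub_apply, Pi.smul_apply,
    e_apply_ne hne.symm, e_apply_self, smul_zero, smul_eq_mul, mul_one, mul_zero] at h1
  rw [Q_symm, Q_e] at h1
  have hc : Real.cos (Real.pi / (M i j : ℝ)) = 0 := by linarith
  have hm1 : M i j ≠ 1 := M.off_diagonal i j hne
  by_contra hm2
  rcases Nat.eq_zero_or_pos (M i j) with h0 | h0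
  · rw [h0] at hc; simp at hc
  have h3 : 3 ≤ M i j := by omega
  have h3' : (3 : ℝ) ≤ M i j := by exact_mod_cast h3
  have : 0 < Real.cos (Real.pi / (M i j : ℝ)) := by
    have hpos : 0 < Real.pi / (M i j : ℝ) := by positivity
    apply Real.cos_pos_of_mem_Ioo
    constructor
    · linarith [Real.pi_pos]
    · rw [div_lt_div_iff₀ (by linarith) (by norm_num)]
      nlinarith [Real.pi_pos]
  linarith

theorem Q_zero {i j : B} (h : M i j = 2) : Q M (e i) (e j) = 0 := by
  rw [Q_e, h]; simp

theorem reflection_root {t : W} (ht : cs.IsReflection t) :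
    ∃ γ, IsRoot cs γ ∧ 0 ≤ γ ∧ ∀ v, rep cs t v = v - Q M γ v • γ := by
  obtain ⟨w, i, rfl⟩ := ht
  have hr : IsRoot cs (rep cs w (e i)) := ⟨w, i, rfl⟩
  have hf : ∀ v, rep cs (w * cs.simple i * w⁻¹) v =
      v - Q M (rep cs w (e i)) v • rep cs w (e i) := by
    intro v
    rw [rep_mul, rep_mul, rep_simple, sig_apply, map_sub, rep_rep_inv, map_smul,
      ← Q_rep cs w (e i), rep_rep_inv]
  rcases hr.nonneg_or with h | h
  · exact ⟨_, hr, h, hf⟩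
  · refine ⟨_, hr.neg, neg_nonneg.2 h, fun v => ?_⟩
    rw [hf, map_neg, LinearMap.neg_apply]
    module

theorem rep_inj {g h : W} (hgh : ∀ v, rep cs g v = rep cs h v) : g = h := by
  rw [← inv_mul_eq_one]
  have : h⁻¹ * g = 1 := by
    apply rep_faithful cs
    intro v
    rw [rep_mul, hgh, rep_inv_rep]
  rw [← inv_mul_eq_one] at this
  simpa [mul_inv_eq_one, inv_mul_eq_one, eq_comm] using this

theorem root_lemma_aux {a b : B} (hab : a ≠ b)
    (hcomm : cs.simple a * cs.simple b = cs.simple b * cs.simple a)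
    {R₁ R₂ : W} (h1 : cs.IsReflection R₁) (h2 : cs.IsReflection R₂)
    (hR : R₁ * R₂ = R₂ * R₁) (hne : R₁ ≠ R₂)
    (heq : cs.simple a * cs.simple b = R₁ * R₂) : R₁ = cs.simple a ∨ R₁ = cs.simple b := by
  have hQ := Q_zero (M_eq_two cs hab hcomm)
  have hQ' : Q M (e b) (e a) = 0 := by rw [Q_symm, hQ]
  obtain ⟨γ, hγ, hγ0, hγf⟩ := reflection_root cs h1
  obtain ⟨δ, hδ, hδ0, hδf⟩ := reflection_root cs h2
  have hq : Q M δ γ = 0 := by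
    by_contra hq
    have h3 := congrArg (fun w => rep cs w γ) hR
    simp only [rep_mul, hγf, hδf, map_sub, map_smul, hγ.Q_self, hδ.Q_self, smul_eq_mul] at h3
    rw [Q_symm γ δ] at h3
    set q := Q M δ γ
    have h4 : q • (q • γ) = q • ((2 : ℝ) • δ) := by
      rw [← sub_eq_zero] at h3 ⊢
      rw [← h3]
      module
    have h5 : q • γ = (2 : ℝ) • δ := smul_right_injective _ hq h4
    have h6 : δ = (q / 2) • γ := by
      rw [div_eq_inv_mul, mul_smul, h5, smul_smul]; norm_num
    have h7 := hδ.Q_self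
    rw [h6] at h7
    simp only [map_smul, LinearMap.smul_apply, hγ.Q_self, smul_eq_mul] at h7
    apply hne
    apply rep_inj cs
    intro v
    rw [hγf, hδf, h6]
    simp only [map_smul, LinearMap.smul_apply, smul_eq_mul, smul_smul]
    congr 2
    linear_combination (-(Q M γ v) / 2) * h7
  have h3 := congrArg (fun w => rep cs w γ) heq
  simp only [rep_mul, rep_simple, hδf, hq, zero_smul, sub_zero, hγf, hγ.Q_self] at h3
  simp only [sig_apply, map_sub, map_smul, hQ, smul_zero, sub_zero] at h3
  have hγe : γ = (Q M (e a) γ / 2) • e a + (Q M (e b) γ / 2) • e b := by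
    have : (2 : ℝ) • γ = Q M (e a) γ • e a + Q M (e b) γ • e b := by
      rw [← sub_eq_zero] at h3 ⊢
      rw [← h3]
      module
    rw [div_eq_inv_mul, div_eq_inv_mul, mul_smul, mul_smul, ← smul_add, ← this, smul_smul]
    norm_num
  set x := Q M (e a) γ / 2 with hx
  set y := Q M (e b) γ / 2 with hy
  have hγa : γ a = x := by
    rw [hγe]; simp [e_apply_ne hab, e_apply_self]
  have hγb : γ b = y := by
    rw [hγe]; simp [e_apply_ne hab.symm, e_apply_self]
  have hγc : ∀ c, c ≠ a → c ≠ b → γ c = 0 := by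
    intro c ha hb
    rw [hγe]; simp [e_apply_ne ha, e_apply_ne hb]
  by_cases hx0 : x = 0
  · right
    have : γ = e b := hγ.eq_e hγ0 (fun j hj => by
      by_cases hja : j = a
      · rw [hja, hγa, hx0]
      · exact hγc j hja hj)
    apply rep_inj cs
    intro v
    rw [hγf, rep_simple, sig_apply, this]
  by_cases hy0 : y = 0
  · left
    have : γ = e a := hγ.eq_e hγ0 (fun j hj => by
      by_cases hjb : j = b
      · rw [hjb, hγb, hy0]
      · exact hγc j hj hjb)
    apply rep_inj cs
    intro v
    rw [hγf, rep_simple, sig_apply, this]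
  exfalso
  have hxp : 0 < x := lt_of_le_of_ne (hγa ▸ hγ0 a) (Ne.symm hx0)
  have hne2 : γ ≠ e a := by
    intro h
    rw [h, e_apply_ne hab.symm] at hγb
    exact hy0 hγb.symm
  have h4 := hγ.sig_nonneg hγ0 hne2 a
  rw [sig_apply] at h4
  simp only [Pi.sub_apply, Pi.smul_apply, e_apply_self, smul_eq_mul, mul_one, hγa, Pi.zero_apply] at h4
  linarith

end Roots

section Main

variable {B : Type*} {W : Type*} [Group W] [Finite B]
  {M : CoxeterMatrix B} (cs : CoxeterSystem M W)

/-- A pair of simultaneously conjugate simple reflections. -/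
def SimPair (P R : W) : Prop := ∃ w i j, P = w * cs.simple i * w⁻¹ ∧ R = w * cs.simple j * w⁻¹

variable {cs} in
theorem SimPair.left {P R : W} (h : SimPair cs P R) : cs.IsReflection P := by
  obtain ⟨w, i, j, h1, h2⟩ := h
  exact ⟨w, i, h1⟩

variable {cs} in
theorem SimPair.right {P R : W} (h : SimPair cs P R) : cs.IsReflection R := by
  obtain ⟨w, i, j, h1, h2⟩ := h
  exact ⟨w, j, h2⟩

variable {cs} in
theorem SimPair.symm {P R : W} (h : SimPair cs P R) : SimPair cs R P := by
  obtain ⟨w, i, j, h1, h2⟩ := h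
  exact ⟨w, j, i, h2, h1⟩

theorem root_lemma {P R : W} (hPR : SimPair cs P R) (hne' : P ≠ R) (hcomm : P * R = R * P)
    {R₁ R₂ : W} (h1 : cs.IsReflection R₁) (h2 : cs.IsReflection R₂)
    (hR : R₁ * R₂ = R₂ * R₁) (hne : R₁ ≠ R₂)
    (heq : P * R = R₁ * R₂) : R₁ = P ∨ R₁ = R := by
  classical
  have := Fintype.ofFinite B
  obtain ⟨w, a, b, rfl, rfl⟩ := hPR
  have key := root_lemma_aux cs (a := a) (b := b) (by rintro rfl; exact hne' rfl)
    (by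
      have := congrArg (fun x => w⁻¹ * x * w) hcomm
      simpa [mul_assoc] using this)
    (R₁ := w⁻¹ * R₁ * w) (R₂ := w⁻¹ * R₂ * w)
    (by simpa using h1.conj w⁻¹) (by simpa using h2.conj w⁻¹)
    (by
      have := congrArg (fun x => w⁻¹ * x * w) hR
      simpa [mul_assoc] using this)
    (by
      intro h
      apply hne
      have := congrArg (fun x => w * x * w⁻¹) h
      simpa [mul_assoc] using this)
    (by
      have := congrArg (fun x => w⁻¹ * x * w) heq
      simpa [mul_assoc] using this)
  rcases key with h | h
  · left; rw [← h]; group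
  · right; rw [← h]; group

theorem parity_reflection {t : W} (ht : cs.IsReflection t) : cs.lengthParity t ≠ 1 := by
  obtain ⟨w, i, rfl⟩ := ht
  rw [map_mul, map_mul, map_inv, mul_comm (cs.lengthParity w), mul_inv_cancel_right,
    cs.lengthParity_simple]
  decide

theorem parity_zmod : ∀ a b : Multiplicative (ZMod 2), a * b ≠ 1 → (a = 1 ∧ b ≠ 1) ∨ (a ≠ 1 ∧ b = 1) := by
  decide

theorem parity_zmod' : ∀ a b : Multiplicative (ZMod 2), a ≠ 1 → b ≠ 1 → a * b = 1 := by
  decide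

variable (hdim : ∀ T : Set B, 2 < T.ncard →
  (Subgroup.closure (cs.simple '' T) : Set W).Infinite)

include hdim in
theorem finite_subgroup_two (H : Subgroup W) [Finite H] (hH : ∃ h ∈ H, h ≠ 1) :
    ∃ P R, SimPair cs P R ∧ IsOfFinOrder (P * R) ∧ H ≤ Subgroup.closure ({P, R} : Set W) := by
  classical
  have := Fintype.ofFinite B
  obtain ⟨w, T, hfin, hmem⟩ := finite_subgroup cs H
  have hT2 : T.ncard ≤ 2 := by
    by_contra hcon
    exact hdim T (by omega) hfin
  obtain ⟨i, j, rfl⟩ : ∃ i j, T = {i, j} := by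
    have hcases : T.ncard = 0 ∨ T.ncard = 1 ∨ T.ncard = 2 := by omega
    rcases hcases with h | h | h
    · exfalso
      rw [Set.ncard_eq_zero] at h
      obtain ⟨x, hx, hx1⟩ := hH
      have := hmem x hx
      rw [h] at this
      simp only [Set.image_empty, Subgroup.closure_empty, Subgroup.mem_bot] at this
      apply hx1
      have h2 := congrArg (fun z => w * z * w⁻¹) this
      simpa [mul_assoc] using h2
    · obtain ⟨i, rfl⟩ := Set.ncard_eq_one.1 h
      exact ⟨i, i, by simp⟩
    · obtain ⟨i, j, -, rfl⟩ := Set.ncard_eq_two.1 h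
      exact ⟨i, j, rfl⟩
  rw [Set.image_pair] at hfin hmem
  refine ⟨w * cs.simple i * w⁻¹, w * cs.simple j * w⁻¹, ⟨w, i, j, rfl, rfl⟩, ?_, ?_⟩
  · have : Finite (Subgroup.closure ({cs.simple i, cs.simple j} : Set W)) := hfin.to_subtype
    have hx : cs.simple i * cs.simple j ∈
        Subgroup.closure ({cs.simple i, cs.simple j} : Set W) :=
      mul_mem (Subgroup.subset_closure (by simp)) (Subgroup.subset_closure (by simp))
    have h1 := isOfFinOrder_of_finite
      (⟨_, hx⟩ : Subgroup.closure ({cs.simple i, cs.simple j} : Set W))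
    have h2 : IsOfFinOrder (cs.simple i * cs.simple j) := by
      rwa [← Submonoid.isOfFinOrder_coe] at h1
    have h3 := (MulAut.conj w).toMonoidHom.isOfFinOrder h2
    convert h3 using 1
    simp [MulAut.conj_apply, mul_assoc]
  · intro h hh
    have h1 := Subgroup.mem_map_of_mem (MulAut.conj w).toMonoidHom (hmem h hh)
    rw [MonoidHom.map_closure, Set.image_pair] at h1
    simpa [MulAut.conj_apply, mul_assoc] using h1

include hdim in
theorem torsion {x : W} (hx : IsOfFinOrder x) : cs.IsReflection x ∨ cs.lengthParity x = 1 := by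
  by_cases h1 : x = 1
  · right; rw [h1, map_one]
  have : Finite (Subgroup.zpowers x) := (finite_zpowers.2 hx).to_subtype
  obtain ⟨P, R, hPR, -, hle⟩ := finite_subgroup_two cs hdim (Subgroup.zpowers x)
    ⟨x, Subgroup.mem_zpowers x, h1⟩
  have hmem := hle (Subgroup.mem_zpowers x)
  rcases dihedral_cases hPR.left.mul_self hPR.right.mul_self hmem with ⟨k, rfl⟩ | ⟨g, rfl⟩ | ⟨g, rfl⟩
  · right
    rw [map_zpow, map_mul, parity_zmod' _ _ (parity_reflection cs hPR.left)
      (parity_reflection cs hPR.right), one_zpow]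
  · left; exact hPR.left.conj g
  · left; exact hPR.right.conj g

include hdim in
theorem torsion_zpow {x : W} (hx : IsOfFinOrder x) (k : ℤ) (hk : cs.lengthParity (x ^ k) ≠ 1) :
    cs.IsReflection x ∧ x ^ k = x := by
  have h1 : cs.IsReflection x := by
    rcases torsion cs hdim hx with h | h
    · exact h
    · rw [map_zpow, h, one_zpow] at hk
      exact absurd rfl hk
  refine ⟨h1, ?_⟩
  have h2 : x ^ (2 : ℤ) = 1 := by rw [zpow_two]; exact h1.mul_self
  obtain ⟨j, rfl | rfl⟩ := Int.even_or_odd' k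
  · rw [zpow_mul, h2, one_zpow, map_one] at hk
    exact absurd rfl hk
  · rw [zpow_add, zpow_mul, h2, one_zpow, one_mul, zpow_one]

variable {B' : Type*} [Finite B'] {M' : CoxeterMatrix B'} (cs' : CoxeterSystem M' W)
  (hdim' : ∀ T : Set B', 2 < T.ncard →
    (Subgroup.closure (cs'.simple '' T) : Set W).Infinite)

include hdim hdim' in
/-- An element odd for the first system and not a reflection for the second. -/
theorem keyA {r : W} (hr : cs.lengthParity r ≠ 1) (hr' : ¬ cs'.IsReflection r)
    (H : Subgroup W) [Finite H] (hrH : r ∈ H) :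
    ∃ P R, SimPair cs' P R ∧ H ≤ Subgroup.closure ({P, R} : Set W) ∧ P * R = R * P ∧
      r = P * R := by
  have hr1 : r ≠ 1 := by rintro rfl; exact hr (map_one _)
  obtain ⟨P, R, hPR, hfo, hle⟩ := finite_subgroup_two cs' hdim' H ⟨r, hrH, hr1⟩
  refine ⟨P, R, hPR, hle, ?_⟩
  rcases dihedral_cases hPR.left.mul_self hPR.right.mul_self (hle hrH)
    with ⟨k, rfl⟩ | ⟨g, rfl⟩ | ⟨g, rfl⟩
  · obtain ⟨h1, h2⟩ := torsion_zpow cs hdim hfo k hr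
    exact ⟨commute_of hPR.left.mul_self hPR.right.mul_self h1.mul_self, h2⟩
  · exact absurd (hPR.left.conj g) hr'
  · exact absurd (hPR.right.conj g) hr'

theorem simple_inj : Function.Injective cs.simple := by
  classical
  have := Fintype.ofFinite B
  exact simple_injective cs

theorem simple_ne_one (i : B) : cs.simple i ≠ 1 := by
  intro h
  apply parity_reflection cs (cs.isReflection_simple i)
  rw [h, map_one]

include hdim hdim' in
theorem neighbor {i j : B} (hi : ¬ cs'.IsReflection (cs.simple i)) (hij : j ≠ i)
    (hM : M i j ≠ 0) :
    ∃ P R, SimPair cs' P R ∧ P * R = R * P ∧ cs.simple i = P * R ∧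
      cs.simple j = P ∧ cs.simple i * cs.simple j = R := by
  have hfo : IsOfFinOrder (cs.simple i * cs.simple j) :=
    isOfFinOrder_iff_pow_eq_one.2 ⟨M i j, Nat.pos_of_ne_zero hM, cs.simple_mul_simple_pow i j⟩
  have := dihedral_finite (cs.simple_mul_simple_self i) (cs.simple_mul_simple_self j) hfo
  obtain ⟨P, R, hPR, hle, hc, hs⟩ := keyA cs hdim cs' hdim'
    (parity_reflection cs (cs.isReflection_simple i)) hi
    (Subgroup.closure ({cs.simple i, cs.simple j} : Set W)) (Subgroup.subset_closure (by simp))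
  have hj : cs.simple j ∈ Subgroup.closure ({cs.simple i, cs.simple j} : Set W) :=
    Subgroup.subset_closure (by simp)
  rcases klein_cases hPR.left.mul_self hPR.right.mul_self hc (hle hj) with h | h | h | h
  · exact absurd h (simple_ne_one cs j)
  · refine ⟨P, R, hPR, hc, hs, h, ?_⟩
    rw [hs, h, hc, mul_assoc, hPR.left.mul_self, mul_one]
  · refine ⟨R, P, hPR.symm, hc.symm, hs.trans hc, h, ?_⟩
    rw [hs, h, mul_assoc, hPR.right.mul_self, mul_one]
  · rw [← hs] at h
    exact absurd (simple_inj cs h) hij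

include hdim hdim' in
theorem neighbor_two {i j : B} (hi : ¬ cs'.IsReflection (cs.simple i)) (hij : j ≠ i)
    (hM : M i j ≠ 0) : M i j = 2 ∧ cs.simple i * cs.simple j = cs.simple j * cs.simple i ∧
      cs'.IsReflection (cs.simple j) ∧ cs'.IsReflection (cs.simple i * cs.simple j) := by
  classical
  have := Fintype.ofFinite B
  obtain ⟨P, R, hPR, hc, h1, h2, h3⟩ := neighbor cs hdim cs' hdim' hi hij hM
  have hcomm : cs.simple i * cs.simple j = cs.simple j * cs.simple i := by
    rw [h3, h1, h2, ← mul_assoc, hPR.left.mul_self, one_mul]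
  exact ⟨M_eq_two cs hij.symm hcomm, hcomm, h2 ▸ hPR.left, h3 ▸ hPR.right⟩

include hdim hdim' in
theorem neighbor_unique {i j k : B} (hi : ¬ cs'.IsReflection (cs.simple i)) (hij : j ≠ i)
    (hM : M i j ≠ 0) (hik : k ≠ i) (hMk : M i k ≠ 0) : j = k := by
  obtain ⟨P, R, hPR, hc, h1, h2, h3⟩ := neighbor cs hdim cs' hdim' hi hij hM
  obtain ⟨P', R', hPR', hc', h1', h2', h3'⟩ := neighbor cs hdim cs' hdim' hi hik hMk
  have hn : ∀ {X Y : W}, SimPair cs' X Y → cs.simple i = X * Y → X ≠ Y := by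
    rintro X Y hXY h rfl
    rw [hXY.left.mul_self] at h
    exact simple_ne_one cs i h
  rcases root_lemma cs' hPR (hn hPR h1) hc hPR'.left hPR'.right hc' (hn hPR' h1')
    (h1.symm.trans h1') with h | h
  · rw [← h2, ← h2'] at h
    exact (simple_inj cs h).symm
  · exfalso
    rw [← h3, ← h2'] at h
    apply parity_reflection cs (cs.isReflection_simple k)
    rw [h, map_mul]
    exact parity_zmod' _ _ (parity_reflection cs (cs.isReflection_simple i))
      (parity_reflection cs (cs.isReflection_simple j))

include hdim hdim' in
theorem eq_of_conj {i a : B} (hi : ¬ cs'.IsReflection (cs.simple i)) {h : W}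
    (hh : cs.simple i = h * cs.simple a * h⁻¹) : a = i := by
  classical
  let f : B → Multiplicative (ZMod 2) := fun k => if k = i then Multiplicative.ofAdd 1 else 1
  have hsq : ∀ a : Multiplicative (ZMod 2), a ^ 2 = 1 := by decide
  have hf : M.IsLiftable f := by
    intro k l
    by_cases hkl : k = l
    · subst hkl
      rw [M.diagonal, pow_one, ← pow_two, hsq]
    by_cases hM0 : M k l = 0
    · rw [hM0, pow_zero]
    by_cases hk : k = i
    · subst hk
      rw [(neighbor_two cs hdim cs' hdim' hi (Ne.symm hkl) hM0).1, hsq]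
    by_cases hl : l = i
    · subst hl
      rw [M.symmetric] at hM0 ⊢
      rw [(neighbor_two cs hdim cs' hdim' hi hkl hM0).1, hsq]
    simp [f, hk, hl]
  have h1 := congrArg (cs.lift ⟨f, hf⟩) hh
  rw [map_mul, map_mul, map_inv, mul_comm (cs.lift ⟨f, hf⟩ h), mul_inv_cancel_right,
    cs.lift_apply_simple hf, cs.lift_apply_simple hf] at h1
  by_contra hne
  simp only [f, if_true, hne, if_false] at h1
  revert h1
  decide

include hdim hdim' in
theorem exists_neighbor {i : B} (hi : ¬ cs'.IsReflection (cs.simple i)) :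
    ∃ j, j ≠ i ∧ M i j ≠ 0 := by
  classical
  have := Fintype.ofFinite B
  have hfin0 : Finite (Subgroup.zpowers (cs.simple i)) :=
    (finite_zpowers.2
      (isOfFinOrder_iff_pow_eq_one.2 ⟨2, by norm_num, cs.simple_sq i⟩)).to_subtype
  obtain ⟨P, R, hPR, hc, hs⟩ : ∃ P R, SimPair cs' P R ∧ P * R = R * P ∧ cs.simple i = P * R := by
    obtain ⟨P, R, hPR, -, hc, hs⟩ := keyA cs hdim cs' hdim'
      (parity_reflection cs (cs.isReflection_simple i)) hi _ (Subgroup.mem_zpowers (cs.simple i))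
    exact ⟨P, R, hPR, hc, hs⟩
  obtain ⟨P, R, hPR, hc, hs, hPe⟩ : ∃ P R, SimPair cs' P R ∧ P * R = R * P ∧
      cs.simple i = P * R ∧ cs.lengthParity P = 1 := by
    have hp := parity_reflection cs (cs.isReflection_simple i)
    rw [hs, map_mul] at hp
    rcases parity_zmod _ _ hp with h | h
    · exact ⟨P, R, hPR, hc, hs, h.1⟩
    · exact ⟨R, P, hPR.symm, hc.symm, hs.trans hc, h.2⟩
  have hfo : IsOfFinOrder (P * R) := by
    rw [← hs]
    exact isOfFinOrder_iff_pow_eq_one.2 ⟨2, by norm_num, cs.simple_sq i⟩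
  have := dihedral_finite hPR.left.mul_self hPR.right.mul_self hfo
  have hPmem : P ∈ Subgroup.closure ({P, R} : Set W) := Subgroup.subset_closure (by simp)
  have hRmem : R ∈ Subgroup.closure ({P, R} : Set W) := Subgroup.subset_closure (by simp)
  obtain ⟨A, C, hAC, hle, hc2, hP⟩ := keyA cs' hdim' cs hdim (parity_reflection cs' hPR.left)
    (fun h => parity_reflection cs h hPe) _ hPmem
  have hsmem := hle (mul_mem hPmem hRmem)
  rw [← hs] at hsmem
  have hAC' : ∃ A C, SimPair cs A C ∧ A * C = C * A ∧ P = A * C ∧ cs.simple i = A := by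
    rcases klein_cases hAC.left.mul_self hAC.right.mul_self hc2 hsmem with h | h | h | h
    · exact absurd h (simple_ne_one cs i)
    · exact ⟨A, C, hAC, hc2, hP, h⟩
    · exact ⟨C, A, hAC.symm, hc2.symm, hP.trans hc2, h⟩
    · exfalso
      rw [← hP] at h
      apply parity_reflection cs (cs.isReflection_simple i)
      rw [h, hPe]
  obtain ⟨A, C, ⟨w, a, b, rfl, rfl⟩, hc2, hP, hsA⟩ := hAC'
  obtain rfl := eq_of_conj cs hdim cs' hdim' hi hsA
  have hcomm : cs.simple a * cs.simple b = cs.simple b * cs.simple a := by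
    have := congrArg (fun x => w⁻¹ * x * w) hc2
    simpa [mul_assoc] using this
  have hne : b ≠ a := by
    rintro rfl
    apply parity_reflection cs' hPR.left
    rw [hP]
    simp [mul_assoc]
  refine ⟨b, hne, ?_⟩
  rw [M_eq_two cs hne.symm hcomm]
  norm_num

end Main

end Cox

theorem stmt_18 {B B' : Type*} {W : Type*} [Group W] [Finite B] [Finite B']
    {M : CoxeterMatrix B} {M' : CoxeterMatrix B'}
    (cs : CoxeterSystem M W) (cs' : CoxeterSystem M' W)
    (hdim : ∀ T : Set B, 2 < T.ncard → (Subgroup.closure (cs.simple '' T) : Set W).Infinite)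
    (hdim' : ∀ T' : Set B', 2 < T'.ncard →
      (Subgroup.closure (cs'.simple '' T') : Set W).Infinite) :
    ∃ cs'' : CoxeterSystem M W,
      ∀ w : W, cs''.IsReflection w ↔ cs'.IsReflection w := by
  classical
  have hex : ∀ i, ∃ j, ¬ cs'.IsReflection (cs.simple i) → j ≠ i ∧ M i j ≠ 0 := by
    intro i
    by_cases hi : cs'.IsReflection (cs.simple i)
    · exact ⟨i, fun h => absurd hi h⟩
    · obtain ⟨j, hj⟩ := Cox.exists_neighbor cs hdim cs' hdim' hi
      exact ⟨j, fun _ => hj⟩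
  choose u hu using hex
  have hu2 := fun i (hi : ¬ cs'.IsReflection (cs.simple i)) =>
    Cox.neighbor_two cs hdim cs' hdim' hi (hu i hi).1 (hu i hi).2
  have huniq := fun i (hi : ¬ cs'.IsReflection (cs.simple i)) j (hj : j ≠ i) (hM : M i j ≠ 0) =>
    Cox.neighbor_unique cs hdim cs' hdim' hi hj hM (hu i hi).1 (hu i hi).2
  let f : B → W := fun i => if cs'.IsReflection (cs.simple i) then cs.simple i
    else cs.simple i * cs.simple (u i)
  have hfgood : ∀ i, cs'.IsReflection (cs.simple i) → f i = cs.simple i := fun i hi => if_pos hi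
  have hfbad : ∀ i, ¬ cs'.IsReflection (cs.simple i) → f i = cs.simple i * cs.simple (u i) :=
    fun i hi => if_neg hi
  have hfrefl : ∀ i, cs'.IsReflection (f i) := by
    intro i
    by_cases hi : cs'.IsReflection (cs.simple i)
    · rwa [hfgood i hi]
    · rw [hfbad i hi]; exact (hu2 i hi).2.2.2
  have hbadcase : ∀ i j, ¬ cs'.IsReflection (cs.simple i) → j ≠ i → M i j ≠ 0 →
      M i j = 2 ∧ f i * f j = cs.simple i := by
    intro i j hi hji hM
    obtain rfl := huniq i hi j hji hM
    refine ⟨(hu2 i hi).1, ?_⟩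
    rw [hfbad i hi, hfgood _ (hu2 i hi).2.2.1, cs.simple_mul_simple_cancel_right]
  have hf : M.IsLiftable f := by
    intro i j
    by_cases hij : i = j
    · subst hij
      rw [M.diagonal, pow_one, (hfrefl i).mul_self]
    by_cases hM : M i j = 0
    · rw [hM, pow_zero]
    by_cases hi : cs'.IsReflection (cs.simple i)
    · by_cases hj : cs'.IsReflection (cs.simple j)
      · rw [hfgood i hi, hfgood j hj, cs.simple_mul_simple_pow]
      · rw [M.symmetric] at hM
        obtain ⟨h1, h2⟩ := hbadcase j i hj hij hM
        have h3 : f i * f j = cs.simple j := by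
          have := congrArg (·⁻¹) h2
          simpa [mul_inv_rev, (hfrefl i).inv, (hfrefl j).inv] using this
        rw [M.symmetric, h1, h3, cs.simple_sq]
    · obtain ⟨h1, h2⟩ := hbadcase i j hi (Ne.symm hij) hM
      rw [h1, h2, cs.simple_sq]
  let φ : W →* W := cs.lift ⟨f, hf⟩
  have hφs : ∀ i, φ (cs.simple i) = f i := fun i => cs.lift_apply_simple hf i
  have hφφ : φ.comp φ = MonoidHom.id W := by
    apply cs.ext_simple
    intro i
    rw [MonoidHom.comp_apply, hφs, MonoidHom.id_apply]
    by_cases hi : cs'.IsReflection (cs.simple i)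
    · rw [hfgood i hi, hφs, hfgood i hi]
    · rw [hfbad i hi, map_mul, hφs, hφs]
      exact (hbadcase i (u i) hi (hu i hi).1 (hu i hi).2).2
  let Φ : W ≃* W := MonoidHom.toMulEquiv φ φ hφφ hφφ
  have hΦ : ∀ x, Φ x = φ x := fun _ => rfl
  let cs'' : CoxeterSystem M W := cs.map Φ
  have hs'' : ∀ i, cs''.simple i = f i := fun i => by
    rw [CoxeterSystem.map_simple, hΦ, hφs]
  have hdim'' : ∀ T : Set B, 2 < T.ncard →
      (Subgroup.closure (cs''.simple '' T) : Set W).Infinite := by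
    intro T hT
    have h1 : cs''.simple '' T = φ '' (cs.simple '' T) := by
      rw [Set.image_image]
      exact Set.image_congr fun i _ => by rw [hs'', hφs]
    rw [h1, ← MonoidHom.map_closure, Subgroup.coe_map]
    exact (hdim T hT).image (Φ.injective.injOn)
  have hfor : ∀ w, cs''.IsReflection w → cs'.IsReflection w := by
    rintro _ ⟨w, i, rfl⟩
    rw [hs'']
    exact (hfrefl i).conj w
  have hpar : cs''.lengthParity = cs'.lengthParity := by
    apply cs''.ext_simple
    intro i
    have h1 := Cox.parity_reflection cs'' (cs''.isReflection_simple i)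
    have h2 := Cox.parity_reflection cs' (hfor _ (cs''.isReflection_simple i))
    have : ∀ a b : Multiplicative (ZMod 2), a ≠ 1 → b ≠ 1 → a = b := by decide
    exact this _ _ h1 h2
  refine ⟨cs'', fun w => ⟨hfor w, fun hw => ?_⟩⟩
  have hfo : IsOfFinOrder w := isOfFinOrder_iff_pow_eq_one.2 ⟨2, by norm_num, hw.pow_two⟩
  rcases Cox.torsion cs'' hdim'' hfo with h | h
  · exact h
  · rw [hpar] at h
    exact absurd h (Cox.parity_reflection cs' hw)
end
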